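/- Let u : ℝ^N → ℝ with values in [−1,1] be a viscosity solution of F(∇u, D²u) + f(u) = 0 in ℝ^N. Assume that lim_{x₁→+∞} u(x₁, x′) = 1 and lim_{x₁→−∞} u(x₁, x′) = −1 uniformly with respect to x′ ∈ ℝ^{N−1}, and, in case α ≠ 0, that for every b < c there exists m > 0 such that |∇u| ≥ m in [b,c] × ℝ^{N−1} in the viscosity sense. Then for every vector ν = (ν₁, ν′) ∈ ℝ^N with ν₁ > 0 and every t ≥ 0, u(x + tν) ≥ u(x) for all x ∈ ℝ^N; in particular u is nondecreasing in the x₁ variable. -/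

import Mathlib

noncomputable section

open Metric Filter Topology Real

/-- `ℝ^N` as a Euclidean space. -/
abbrev ESp (N : ℕ) := EuclideanSpace ℝ (Fin N)

/-- The Hessian matrix of a function `φ : ℝ^N → ℝ` at a point `x`. -/
def hessianMatrix {N : ℕ} (φ : ESp N → ℝ) (x : ESp N) : Matrix (Fin N) (Fin N) ℝ :=
  Matrix.of fun i j =>
    fderiv ℝ (fun y => fderiv ℝ φ y (EuclideanSpace.single j (1 : ℝ))) x
      (EuclideanSpace.single i (1 : ℝ))

/-- `F̃` is positively homogeneous of degree one and uniformly elliptic with constants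
`0 < a ≤ A`, i.e. `a tr(P) ≤ F̃(M+P) - F̃(M) ≤ A tr(P)` for symmetric `M` and
positive semidefinite symmetric `P`. -/
def UniformlyElliptic (N : ℕ) (a A : ℝ) (Ftil : Matrix (Fin N) (Fin N) ℝ → ℝ) : Prop :=
  (∀ t : ℝ, 0 ≤ t → ∀ M : Matrix (Fin N) (Fin N) ℝ, M.IsSymm → Ftil (t • M) = t * Ftil M) ∧
  ∀ M P : Matrix (Fin N) (Fin N) ℝ, M.IsSymm → P.IsSymm → P.PosSemidef →
    a * P.trace ≤ Ftil (M + P) - Ftil M ∧ Ftil (M + P) - Ftil M ≤ A * P.trace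

/-- `v` is a viscosity supersolution of `|∇u|^α F̃(D²u) = g(x,u)` in `Ω`. -/
def ViscSuper {N : ℕ} (α : ℝ) (Ftil : Matrix (Fin N) (Fin N) ℝ → ℝ)
    (g : ESp N → ℝ → ℝ) (Ω : Set (ESp N)) (v : ESp N → ℝ) : Prop :=
  ∀ x₀ ∈ Ω,
    (∃ δ > (0:ℝ), ∃ c : ℝ, ball x₀ δ ⊆ Ω ∧ (∀ x ∈ ball x₀ δ, v x = c) ∧
      ∀ x ∈ ball x₀ δ, 0 ≤ g x c) ∨
    (∀ φ : ESp N → ℝ, ContDiff ℝ 2 φ →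
      IsLocalMin (fun x => v x - φ x) x₀ → gradient φ x₀ ≠ 0 →
      ‖gradient φ x₀‖ ^ α * Ftil (hessianMatrix φ x₀) ≤ g x₀ (v x₀))

/-- `v` is a viscosity subsolution of `|∇u|^α F̃(D²u) = g(x,u)` in `Ω`. -/
def ViscSub {N : ℕ} (α : ℝ) (Ftil : Matrix (Fin N) (Fin N) ℝ → ℝ)
    (g : ESp N → ℝ → ℝ) (Ω : Set (ESp N)) (v : ESp N → ℝ) : Prop :=
  ∀ x₀ ∈ Ω,
    (∃ δ > (0:ℝ), ∃ c : ℝ, ball x₀ δ ⊆ Ω ∧ (∀ x ∈ ball x₀ δ, v x = c) ∧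
      ∀ x ∈ ball x₀ δ, g x c ≤ 0) ∨
    (∀ φ : ESp N → ℝ, ContDiff ℝ 2 φ →
      IsLocalMax (fun x => v x - φ x) x₀ → gradient φ x₀ ≠ 0 →
      g x₀ (v x₀) ≤ ‖gradient φ x₀‖ ^ α * Ftil (hessianMatrix φ x₀))

/-- `v` is a viscosity solution of `|∇u|^α F̃(D²u) = g(x,u)` in `Ω`. -/
def ViscSol {N : ℕ} (α : ℝ) (Ftil : Matrix (Fin N) (Fin N) ℝ → ℝ)
    (g : ESp N → ℝ → ℝ) (Ω : Set (ESp N)) (v : ESp N → ℝ) : Prop :=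
  ViscSub α Ftil g Ω v ∧ ViscSuper α Ftil g Ω v

/-- `|∇u| ≥ m` in `Ω` in the viscosity sense. -/
def GradGE {N : ℕ} (m : ℝ) (Ω : Set (ESp N)) (u : ESp N → ℝ) : Prop :=
  ∀ φ : ESp N → ℝ, ContDiff ℝ 2 φ → ∀ x₀ ∈ Ω,
    (IsLocalMin (fun x => u x - φ x) x₀ ∨ IsLocalMax (fun x => u x - φ x) x₀) →
    m ≤ ‖gradient φ x₀‖

open scoped RealInnerProductSpace
set_option linter.unusedSectionVars false

section SemiconvexJets
variable {V : Type*} [NormedAddCommGroup V] [InnerProductSpace ℝ V] [FiniteDimensional ℝ V]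

/-- `U` has at every point a global lower paraboloid of opening `C`. -/
def LowerParab (C : ℝ) (U : V → ℝ) : Prop :=
  ∀ x, ∃ q : V, ∀ w, U x + ⟪q, w - x⟫ - C / 2 * ‖w - x‖ ^ 2 ≤ U w

theorem LowerParab.continuous {C : ℝ} {U : V → ℝ} (h : LowerParab C U) : Continuous U := by
  have hc : ConvexOn ℝ Set.univ (fun x => U x + C / 2 * ‖x‖ ^ 2) := by
    refine ⟨convex_univ, ?_⟩
    intro x _ y _ s t hs ht hst
    obtain ⟨q, hq⟩ := h (s • x + t • y)
    have h1 := hq x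
    have h2 := hq y
    set z := s • x + t • y with hz
    have e1 : ‖x - z‖ ^ 2 = ‖x‖ ^ 2 - 2 * ⟪x, z⟫ + ‖z‖ ^ 2 := norm_sub_sq_real x z
    have e2 : ‖y - z‖ ^ 2 = ‖y‖ ^ 2 - 2 * ⟪y, z⟫ + ‖z‖ ^ 2 := norm_sub_sq_real y z
    have e3 : s * ⟪x, z⟫ + t * ⟪y, z⟫ = ‖z‖ ^ 2 := by
      rw [← real_inner_self_eq_norm_sq z]
      conv_rhs => rw [hz]
      rw [inner_add_left, real_inner_smul_left, real_inner_smul_left]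
    have e4 : s * ⟪q, x - z⟫ + t * ⟪q, y - z⟫ = 0 := by
      rw [inner_sub_right, inner_sub_right]
      have : ⟪q, z⟫ = s * ⟪q, x⟫ + t * ⟪q, y⟫ := by
        rw [hz, inner_add_right, real_inner_smul_right, real_inner_smul_right]
      have ht' : t = 1 - s := by linarith
      rw [this, ht']; ring
    simp only [smul_eq_mul]
    rw [e1] at h1
    rw [e2] at h2
    have h3 := mul_le_mul_of_nonneg_left h1 hs
    have h4 := mul_le_mul_of_nonneg_left h2 ht
    have ht' : t = 1 - s := by linarith
    subst ht'
    have e5 : C * (s * ⟪x, z⟫ + (1 - s) * ⟪y, z⟫) = C * ‖z‖ ^ 2 := by rw [e3]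
    nlinarith
  have h2 := hc.continuousOn isOpen_univ
  rw [← continuousOn_univ]
  have h3 : ContinuousOn (fun x : V => C / 2 * ‖x‖ ^ 2) Set.univ := by fun_prop
  have := h2.sub h3
  refine this.congr ?_
  intro x _
  simp

theorem increment_le_of_lower_bound (D : ℝ → ℝ) (e c : ℝ)
    (h : ∀ s ∈ Set.Icc (0:ℝ) 1, ∀ t ∈ Set.Icc (0:ℝ) 1,
      D t - e * |s - t| - c * (s - t) ^ 2 ≤ D s) : |D 1 - D 0| ≤ e := by
  have key : ∀ n : ℕ, |D 1 - D 0| ≤ e + c / (n + 1) := by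
    intro n
    have hn : (0:ℝ) < n + 1 := by positivity
    have step : ∀ i : ℕ, i ≤ n + 1 →
        |D (i / (n + 1)) - D 0| ≤ i * (e / (n + 1) + c / (n + 1) ^ 2) := by
      intro i
      induction i with
      | zero => intro _; simp
      | succ i ih =>
        intro hi
        have ih' := ih (by omega)
        have m1 : ((i:ℝ) / (n + 1)) ∈ Set.Icc (0:ℝ) 1 := by
          constructor
          · positivity
          · rw [div_le_one hn]; exact_mod_cast (by omega : i ≤ n + 1)
        have m2 : (((i + 1 : ℕ):ℝ) / (n + 1)) ∈ Set.Icc (0:ℝ) 1 := by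
          constructor
          · positivity
          · rw [div_le_one hn]; exact_mod_cast hi
        have d : (((i + 1 : ℕ):ℝ) / (n + 1)) - ((i:ℝ) / (n + 1)) = 1 / (n + 1) := by
          push_cast; field_simp; ring
        have a1 := h _ m2 _ m1
        have a2 := h _ m1 _ m2
        rw [abs_sub_comm, ← neg_sub ((((i + 1 : ℕ):ℝ) / (n + 1))), d, neg_sq] at a2
        rw [d] at a1
        rw [abs_of_nonneg (by positivity)] at a1 a2
        have e1 : e * (1 / ((n:ℝ) + 1)) = e / (n + 1) := by ring
        have e2 : c * (1 / ((n:ℝ) + 1)) ^ 2 = c / (n + 1) ^ 2 := by field_simp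
        rw [e1, e2] at a1 a2
        push_cast at *
        rw [abs_le] at *
        constructor <;> nlinarith
    have := step (n + 1) le_rfl
    push_cast at this
    rw [div_self hn.ne'] at this
    calc _ ≤ _ := this
      _ = _ := by field_simp
  have lim : Tendsto (fun n : ℕ => e + c / ((n:ℝ) + 1)) atTop (𝓝 (e + 0)) := by
    refine tendsto_const_nhds.add ?_
    have := (tendsto_one_div_add_atTop_nhds_zero_nat (𝕜 := ℝ)).const_mul c
    simpa [div_eq_mul_inv] using this
  rw [add_zero] at lim
  exact ge_of_tendsto' lim key

theorem eventually_exists_mem_near_of_density [MeasurableSpace V] [BorelSpace V]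
    (μ : MeasureTheory.Measure V) [μ.IsAddHaarMeasure] (K : Set V) :
    ∀ᵐ x ∂(μ.restrict K), ∀ η > (0:ℝ), ∀ᶠ y in 𝓝[≠] x, ∃ z ∈ K, ‖z - y‖ ≤ η * ‖y - x‖ := by
  have h : ∀ᵐ x ∂(μ.restrict K), ∀ n : ℕ,
      ∀ᶠ y in 𝓝[≠] x, ∃ z ∈ K, ‖z - y‖ ≤ (1 / ((n:ℝ) + 1)) * ‖y - x‖ := by
    rw [MeasureTheory.ae_all_iff]
    intro n
    filter_upwards [IsUnifLocDoublingMeasure.ae_tendsto_measure_inter_div μ K ((n:ℝ) + 1)] with x hx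
    have hn : (0:ℝ) < n + 1 := by positivity
    have t1 : Tendsto (fun y : V => (1 / ((n:ℝ) + 1)) * ‖y - x‖) (𝓝[≠] x) (𝓝[>] 0) := by
      rw [tendsto_nhdsWithin_iff]
      constructor
      · have : Tendsto (fun y : V => (1 / ((n:ℝ) + 1)) * ‖y - x‖) (𝓝 x)
            (𝓝 ((1 / ((n:ℝ) + 1)) * ‖x - x‖)) := Continuous.tendsto (by fun_prop) x
        simp only [sub_self, norm_zero, mul_zero] at this
        exact this.mono_left nhdsWithin_le_nhds
      · filter_upwards [self_mem_nhdsWithin] with y hy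
        have : 0 < ‖y - x‖ := norm_pos_iff.2 (sub_ne_zero.2 hy)
        simp only [Set.mem_Ioi]; positivity
    have t2 := hx (fun y : V => y) _ t1 (by
      refine Eventually.of_forall fun y => ?_
      rw [mem_closedBall, dist_eq_norm, norm_sub_rev]
      have : ((n:ℝ) + 1) * (1 / ((n:ℝ) + 1) * ‖y - x‖) = ‖y - x‖ := by field_simp
      rw [this])
    have t3 := t2.eventually (lt_mem_nhds (zero_lt_one))
    filter_upwards [t3] with y hy
    have : (K ∩ closedBall y (1 / ((n:ℝ) + 1) * ‖y - x‖)).Nonempty := by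
      by_contra hne
      rw [Set.not_nonempty_iff_eq_empty] at hne
      rw [hne] at hy
      simp at hy
    obtain ⟨z, hz, hz2⟩ := this
    exact ⟨z, hz, by simpa [dist_eq_norm] using hz2⟩
  filter_upwards [h] with x hx η hη
  obtain ⟨n, hn⟩ := exists_nat_one_div_lt hη
  filter_upwards [hx n] with y ⟨z, hz, hzy⟩
  exact ⟨z, hz, hzy.trans (by gcongr)⟩

theorem LowerParab.norm_subgradient_sub_le {C r : ℝ} {U : V → ℝ} {x z p q : V}
    (hC : 0 ≤ C)
    (hpl : ∀ w, U x + ⟪p, w - x⟫ - C / 2 * ‖w - x‖ ^ 2 ≤ U w)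
    (hpu : ∀ w ∈ closedBall (0:V) r, U w ≤ U x + ⟪p, w - x⟫)
    (hq : ∀ w, U z + ⟪q, w - z⟫ - C / 2 * ‖w - z‖ ^ 2 ≤ U w)
    {s : ℝ} (hs : 0 < s) (hsz : closedBall z s ⊆ closedBall (0:V) r) :
    s * ‖q - p‖ ≤ C / 2 * (‖z - x‖ ^ 2 + s ^ 2) := by
  by_cases hqp : q - p = 0
  · rw [hqp]; simp; positivity
  have hpos : 0 < ‖q - p‖ := norm_pos_iff.2 hqp
  set y := z + (s / ‖q - p‖) • (q - p) with hy
  have hyz : y - z = (s / ‖q - p‖) • (q - p) := by rw [hy]; abel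
  have hn : ‖y - z‖ = s := by
    rw [hyz, norm_smul, Real.norm_of_nonneg (by positivity)]; field_simp
  have h1 := hq y
  have h2 := hpl z
  have h3 := hpu y (hsz (by rw [mem_closedBall, dist_eq_norm, hn]))
  have h4 : ⟪q - p, y - z⟫ = s * ‖q - p‖ := by
    rw [hyz, real_inner_smul_right, real_inner_self_eq_norm_sq]; field_simp
  rw [inner_sub_left] at h4
  have h5 : ⟪p, y - x⟫ = ⟪p, y - z⟫ + ⟪p, z - x⟫ := by rw [← inner_add_right]; congr 1; abel
  rw [hn] at h1
  linarith

theorem LowerParab.exists_expansion {C r m₀ ε : ℝ} {U : V → ℝ} (hC : 0 ≤ C) (hr : 0 < r)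
    (hm : 0 < m₀) (hε : 0 < ε) (hU : LowerParab C U) (hs : ∀ y, ‖y‖ = r → U y ≤ U 0 - m₀) :
    ∃ x, ‖x‖ < r ∧ ∃ p : V, ‖p‖ ≤ ε ∧ ∃ B : V →L[ℝ] V, (∀ d, ⟪B d, d⟫ ≤ 0) ∧
      ∀ η > (0:ℝ), ∀ᶠ d in 𝓝 (0:V),
        |U (x + d) - U x - ⟪p, d⟫ - 1 / 2 * ⟪B d, d⟫| ≤ η * ‖d‖ ^ 2 := by
  have hUc := hU.continuous
  choose T hT using hU
  obtain ⟨ρ, hρ, hρε, hρm⟩ : ∃ ρ > (0:ℝ), ρ ≤ ε ∧ ρ * r < m₀ := by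
    refine ⟨min ε (m₀ / (2 * r)), by positivity, min_le_left _ _, ?_⟩
    calc _ ≤ m₀ / (2 * r) * r := by gcongr; exact min_le_right _ _
      _ = m₀ / 2 := by field_simp
      _ < m₀ := by linarith
  set K2 : Set (V × V) := {z | z.1 ∈ closedBall (0:V) r ∧ z.2 ∈ closedBall (0:V) ρ ∧
    ∀ y ∈ closedBall (0:V) r, U y ≤ U z.1 + ⟪z.2, y - z.1⟫} with hK2
  have hK2c : IsCompact K2 := by
    refine ((isCompact_closedBall (0:V) r).prod (isCompact_closedBall (0:V) ρ)).of_isClosed_subset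
      ?_ (fun z hz => ⟨hz.1, hz.2.1⟩)
    have e : K2 = (Prod.fst ⁻¹' closedBall (0:V) r) ∩ ((Prod.snd ⁻¹' closedBall (0:V) ρ) ∩
        ⋂ y ∈ closedBall (0:V) r, {z : V × V | U y ≤ U z.1 + ⟪z.2, y - z.1⟫}) := by
      ext z; simp [hK2]
    rw [e]
    refine (isClosed_closedBall.preimage continuous_fst).inter
      ((isClosed_closedBall.preimage continuous_snd).inter ?_)
    refine isClosed_biInter fun y _ => isClosed_le continuous_const (by fun_prop)
  set K : Set V := Prod.fst '' K2 with hK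
  have hKc : IsCompact K := hK2c.image continuous_fst
  have hint : ∀ x p, (x, p) ∈ K2 → ‖x‖ < r := by
    rintro x p ⟨h1, h2, h3⟩
    simp only [mem_closedBall, dist_zero_right] at h1 h2
    refine lt_of_le_of_ne h1 fun h => ?_
    have a1 := h3 0 (by simp [hr.le])
    have a2 := hs x h
    have a3 : ⟪p, 0 - x⟫ ≤ ρ * r := by
      refine (real_inner_le_norm _ _).trans ?_
      rw [zero_sub, norm_neg, h]; gcongr
    simp only at a1
    linarith
  have hsurj : ∀ p : V, ‖p‖ ≤ ρ → ∃ x, (x, p) ∈ K2 := by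
    intro p hp
    obtain ⟨x, hx, hmax⟩ := (isCompact_closedBall (0:V) r).exists_isMaxOn
      ⟨0, by simp [hr.le]⟩ (f := fun y => U y - ⟪p, y⟫) (by fun_prop)
    refine ⟨x, hx, by simpa using hp, fun y hy => ?_⟩
    have : U y - ⟪p, y⟫ ≤ U x - ⟪p, x⟫ := hmax hy
    simp only [inner_sub_right]
    linarith
  obtain ⟨σ, hσ, hgap⟩ : ∃ σ > (0:ℝ), ∀ x ∈ K, ‖x‖ ≤ r - 2 * σ := by
    obtain ⟨x0, hx0⟩ := hsurj 0 (by simp [hρ.le])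
    obtain ⟨z, hz, hmax⟩ := hKc.exists_isMaxOn ⟨x0, _, hx0, rfl⟩ (f := fun x => ‖x‖) (by fun_prop)
    obtain ⟨⟨z1, z2⟩, hz1, rfl⟩ := hz
    have := hint _ _ hz1
    refine ⟨(r - ‖z1‖) / 2, by linarith, fun x hx => ?_⟩
    have : ‖x‖ ≤ ‖z1‖ := hmax hx
    linarith
  have hTK : ∀ x p, (x, p) ∈ K2 → T x = p := by
    intro x p hxp
    have hxK : x ∈ K := ⟨_, hxp, rfl⟩
    have hlow : ∀ w, U x + ⟪T x, w - x⟫ - C / 2 * ‖w - x‖ ^ 2 ≤ U w := hT x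
    obtain ⟨h1, h2, h3⟩ := hxp
    by_contra hne
    have hpos : 0 < ‖T x - p‖ := norm_pos_iff.2 (sub_ne_zero.2 hne)
    have key : ∀ s : ℝ, 0 < s → s ≤ 2 * σ → s * ‖T x - p‖ ≤ C / 2 * s ^ 2 := by
      intro s hs0 hsσ
      set y := x + (s / ‖T x - p‖) • (T x - p) with hy
      have hyz : y - x = (s / ‖T x - p‖) • (T x - p) := by rw [hy]; abel
      have hn : ‖y - x‖ = s := by
        rw [hyz, norm_smul, Real.norm_of_nonneg (by positivity)]; field_simp
      have b1 := hlow y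
      have b2 := h3 y (by
        rw [mem_closedBall, dist_zero_right]
        have : ‖y‖ ≤ ‖x‖ + ‖y - x‖ := by
          calc ‖y‖ = ‖x + (y - x)‖ := by congr 1; abel
            _ ≤ _ := norm_add_le _ _
        have := hgap x hxK
        linarith)
      have h4 : ⟪T x - p, y - x⟫ = s * ‖T x - p‖ := by
        rw [hyz, real_inner_smul_right, real_inner_self_eq_norm_sq]; field_simp
      rw [inner_sub_left] at h4
      simp only at b2
      rw [hn] at b1
      linarith
    set s := min (2 * σ) (‖T x - p‖ / (C + 1)) with hs'
    have hs0 : 0 < s := by rw [hs']; positivity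
    have k1 := key s hs0 (min_le_left _ _)
    have k2 : s ≤ ‖T x - p‖ / (C + 1) := min_le_right _ _
    rw [le_div_iff₀ (by linarith)] at k2
    have k3 : s * ‖T x - p‖ ≤ s * (C / 2 * s) := by nlinarith
    have k4 := le_of_mul_le_mul_left k3 hs0
    nlinarith
  have hKT : ∀ x ∈ K, ‖T x‖ ≤ ρ ∧ ∀ y ∈ closedBall (0:V) r, U y ≤ U x + ⟪T x, y - x⟫ := by
    rintro _ ⟨⟨x, p⟩, hxp, rfl⟩
    have := hTK x p hxp
    simp only [this]
    exact ⟨by simpa using hxp.2.1, hxp.2.2⟩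
  have hclose : ∀ x ∈ K, ∀ z, ‖z - x‖ ≤ σ → ‖T z - T x‖ ≤ C * ‖z - x‖ := by
    intro x hx z hz
    by_cases hzx : z = x
    · simp [hzx]
    have hpos : 0 < ‖z - x‖ := norm_pos_iff.2 (sub_ne_zero.2 hzx)
    have := LowerParab.norm_subgradient_sub_le (r := r) hC (hT x) (hKT x hx).2 (hT z) hpos (by
      intro y hy
      rw [mem_closedBall, dist_eq_norm] at hy
      rw [mem_closedBall, dist_zero_right]
      have h1 : ‖y‖ ≤ ‖y - z‖ + ‖z - x‖ + ‖x‖ := by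
        calc ‖y‖ = ‖(y - z) + (z - x) + x‖ := by congr 1; abel
          _ ≤ _ := norm_add₃_le
      have := hgap x hx
      linarith)
    have h2 : ‖z - x‖ * ‖T z - T x‖ ≤ ‖z - x‖ * (C * ‖z - x‖) := by linarith
    exact le_of_mul_le_mul_left h2 hpos
  have hlip : LipschitzOnWith (Real.toNNReal (C + 2 * ρ / σ)) T K := by
    refine LipschitzOnWith.of_dist_le_mul fun z hz x hx => ?_
    rw [dist_eq_norm, dist_eq_norm, Real.coe_toNNReal _ (by positivity)]
    by_cases h : ‖z - x‖ ≤ σ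
    · refine (hclose x hx z h).trans ?_
      gcongr
      have : 0 ≤ 2 * ρ / σ := by positivity
      linarith
    · push Not at h
      have h1 : ‖T z - T x‖ ≤ 2 * ρ := by
        have := norm_sub_le (T z) (T x)
        have := (hKT x hx).1
        have := (hKT z hz).1
        linarith
      refine h1.trans ?_
      calc 2 * ρ = 2 * ρ / σ * σ := by field_simp
        _ ≤ (C + 2 * ρ / σ) * ‖z - x‖ := by gcongr; linarith
  obtain ⟨G, hG, hGT⟩ := hlip.extend_finite_dimension
  borelize V
  set μ : MeasureTheory.Measure V :=
    MeasureTheory.Measure.hausdorffMeasure (Module.finrank ℝ V) with hμ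
  have : μ.IsAddHaarMeasure := MeasureTheory.isAddHaarMeasure_hausdorffMeasure
  have hKpos : μ K ≠ 0 := by
    intro h0
    have h1 : closedBall (0:V) ρ ⊆ T '' K := by
      intro p hp
      obtain ⟨x, hx⟩ := hsurj p (by simpa using hp)
      exact ⟨x, ⟨_, hx, rfl⟩, hTK x p hx⟩
    have h2 : μ (T '' K) ≤ _ :=
      hlip.hausdorffMeasure_image_le (d := Module.finrank ℝ V) (by positivity)
    have h3 : μ (T '' K) ≤ _ * μ K := h2
    rw [h0, mul_zero] at h3
    have h4 : μ (closedBall (0:V) ρ) = 0 :=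
      le_antisymm ((MeasureTheory.measure_mono h1).trans h3) (zero_le)
    exact (Metric.measure_closedBall_pos μ (0:V) hρ).ne' h4
  have hae : ∀ᵐ x ∂(μ.restrict K), x ∈ K ∧ DifferentiableAt ℝ G x ∧
      ∀ η > (0:ℝ), ∀ᶠ y in 𝓝[≠] x, ∃ z ∈ K, ‖z - y‖ ≤ η * ‖y - x‖ := by
    filter_upwards [MeasureTheory.ae_restrict_mem hKc.measurableSet,
      MeasureTheory.ae_restrict_of_ae (hG.ae_differentiableAt (μ := μ)),
      eventually_exists_mem_near_of_density μ K] with x h1 h2 h3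
    exact ⟨h1, h2, h3⟩
  have : (MeasureTheory.ae (μ.restrict K)).NeBot := by
    rw [MeasureTheory.ae_neBot, Ne, MeasureTheory.Measure.restrict_eq_zero]
    exact hKpos
  obtain ⟨x, hxK, hdiff, hdens⟩ := hae.exists
  set B := fderiv ℝ G x with hB
  have hder : HasFDerivAt G B x := hdiff.hasFDerivAt
  have hTG : ∀ z ∈ K, G z = T z := fun z hz => (hGT hz).symm
  have hgrad : ∀ η > (0:ℝ), ∀ᶠ y in 𝓝 x, ‖T y - T x - B (y - x)‖ ≤ η * ‖y - x‖ := by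
    intro η hη
    obtain ⟨κ, hκ, hκ1, hκη⟩ : ∃ κ > (0:ℝ), κ ≤ 1 ∧ κ * (C + ‖B‖ + 2) ≤ η := by
      refine ⟨min 1 (η / (C + ‖B‖ + 2)), by positivity, min_le_left _ _, ?_⟩
      calc _ ≤ η / (C + ‖B‖ + 2) * (C + ‖B‖ + 2) := by gcongr; exact min_le_right _ _
        _ = η := by field_simp
    have h1 := hder.isLittleO.def hκ
    obtain ⟨δ1, hδ1, h1'⟩ := Metric.eventually_nhds_iff.1 h1
    have h2 := hdens κ hκ
    rw [eventually_nhdsWithin_iff] at h2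
    filter_upwards [h2, Metric.ball_mem_nhds x (half_pos hδ1), Metric.ball_mem_nhds x hσ]
      with y hy hyδ hyσ
    by_cases hyx : y = x
    · simp [hyx]
    obtain ⟨z, hz, hzy⟩ := hy hyx
    rw [mem_ball, dist_eq_norm] at hyδ hyσ
    have d1 : ‖z - x‖ ≤ 2 * ‖y - x‖ := by
      have : ‖z - x‖ ≤ ‖z - y‖ + ‖y - x‖ := norm_sub_le_norm_sub_add_norm_sub _ _ _
      nlinarith [norm_nonneg (y - x)]
    have a1 := h1' (y := z) (by rw [dist_eq_norm]; linarith)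
    rw [hTG z hz, hTG x hxK] at a1
    have a2 := hclose z hz y (by rw [norm_sub_rev]; nlinarith [norm_nonneg (y - x)])
    have e : T y - T x - B (y - x) = (T y - T z) + (T z - T x - B (z - x)) + B (z - y) := by
      have : B (y - x) = B (z - x) - B (z - y) := by rw [← map_sub]; congr 1; abel
      rw [this]; abel
    rw [e]
    have a3 : ‖B (z - y)‖ ≤ ‖B‖ * ‖z - y‖ := B.le_opNorm _
    rw [norm_sub_rev y z] at a2
    calc _ ≤ ‖T y - T z‖ + ‖T z - T x - B (z - x)‖ + ‖B (z - y)‖ := norm_add₃_le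
      _ ≤ C * (κ * ‖y - x‖) + κ * (2 * ‖y - x‖) + ‖B‖ * (κ * ‖y - x‖) := by
        gcongr
        · exact a2.trans (by gcongr)
        · exact a1.trans (by gcongr)
        · exact a3.trans (by gcongr)
      _ = κ * (C + ‖B‖ + 2) * ‖y - x‖ := by ring
      _ ≤ _ := by gcongr
  have hexp : ∀ η > (0:ℝ), ∀ᶠ d in 𝓝 (0:V),
        |U (x + d) - U x - ⟪T x, d⟫ - 1 / 2 * ⟪B d, d⟫| ≤ η * ‖d‖ ^ 2 := by
    intro η hη
    obtain ⟨δ, hδ, h⟩ := Metric.eventually_nhds_iff.1 (hgrad η hη)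
    filter_upwards [Metric.ball_mem_nhds (0:V) hδ] with d hd
    rw [mem_ball, dist_zero_right] at hd
    have := increment_le_of_lower_bound
      (fun t => U (x + t • d) - t * ⟪T x, d⟫ - 1 / 2 * t ^ 2 * ⟪B d, d⟫)
      (η * ‖d‖ ^ 2) (C / 2 * ‖d‖ ^ 2 + 1 / 2 * ⟪B d, d⟫) (by
        intro s hs t ht
        have h1 := h (y := x + t • d) (by
          rw [dist_eq_norm, add_sub_cancel_left, norm_smul, Real.norm_of_nonneg ht.1]
          nlinarith [norm_nonneg d, ht.2])
        rw [add_sub_cancel_left, norm_smul, Real.norm_of_nonneg ht.1, map_smul] at h1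
        have h2 := hT (x + t • d) (x + s • d)
        have e1 : x + s • d - (x + t • d) = (s - t) • d := by rw [sub_smul]; abel
        rw [e1, norm_smul, mul_pow, Real.norm_eq_abs, sq_abs, real_inner_smul_right] at h2
        have h3 : |⟪T (x + t • d) - T x - t • B d, d⟫| ≤ η * ‖d‖ ^ 2 := by
          refine (abs_real_inner_le_norm _ _).trans ?_
          calc _ ≤ η * (t * ‖d‖) * ‖d‖ := by gcongr
            _ ≤ η * (1 * ‖d‖) * ‖d‖ := by gcongr; exact ht.2
            _ = _ := by ring
        rw [inner_sub_left, inner_sub_left, real_inner_smul_left] at h3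
        have h4 : -(|s - t| * (η * ‖d‖ ^ 2)) ≤
            (s - t) * (⟪T (x + t • d), d⟫ - ⟪T x, d⟫ - t * ⟪B d, d⟫) := by
          refine le_trans ?_ (neg_abs_le _)
          rw [abs_mul]
          gcongr
        nlinarith)
    simp only [one_smul, zero_smul, add_zero] at this
    convert this using 2
    ring
  refine ⟨x, ?_, T x, (hKT x hxK).1.trans hρε, B, ?_, hexp⟩
  · have := hgap x hxK; linarith
  · intro d
    by_contra hpos
    push Not at hpos
    set b := ⟪B d, d⟫ with hb
    have h1 := hexp (b / (4 * (‖d‖ ^ 2 + 1))) (by positivity)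
    have h2 : ∀ᶠ e in 𝓝 (0:V), U (x + e) ≤ U x + ⟪T x, e⟫ := by
      filter_upwards [Metric.ball_mem_nhds (0:V) hσ] with e he
      rw [mem_ball, dist_zero_right] at he
      have := (hKT x hxK).2 (x + e) (by
        rw [mem_closedBall, dist_zero_right]
        have := norm_add_le x e
        have := hgap x hxK
        linarith)
      simpa using this
    have h3 : Tendsto (fun t : ℝ => t • d) (𝓝[>] 0) (𝓝 0) := by
      have : Tendsto (fun t : ℝ => t • d) (𝓝 0) (𝓝 ((0:ℝ) • d)) :=
        Continuous.tendsto (by fun_prop) 0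
      rw [zero_smul] at this
      exact this.mono_left nhdsWithin_le_nhds
    obtain ⟨t, ⟨ht1, ht2⟩, ht⟩ := ((h3.eventually (h1.and h2)).and self_mem_nhdsWithin).exists
    have ht : 0 < t := ht
    rw [abs_le] at ht1
    have h5 := ht1.1
    rw [map_smul, real_inner_smul_left, real_inner_smul_right, real_inner_smul_right, ← hb,
      norm_smul, mul_pow, Real.norm_eq_abs, sq_abs] at h5
    rw [real_inner_smul_right] at ht2
    have h6 : b / (4 * (‖d‖ ^ 2 + 1)) * (t ^ 2 * ‖d‖ ^ 2) ≤ b * t ^ 2 / 4 := by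
      have : b / (4 * (‖d‖ ^ 2 + 1)) * (t ^ 2 * ‖d‖ ^ 2) =
        b * t ^ 2 / 4 * (‖d‖ ^ 2 / (‖d‖ ^ 2 + 1)) := by field_simp
      rw [this]
      refine mul_le_of_le_one_right (by positivity) ?_
      rw [div_le_one (by positivity)]; linarith
    have h7 : 0 < b * t ^ 2 := by positivity
    nlinarith

end SemiconvexJets

section Jets
variable {E : Type*} [NormedAddCommGroup E] [InnerProductSpace ℝ E]

/-- Second order superjet of `v` at `x`, in Peano form. -/
def SuperJet (v : E → ℝ) (x p : E) (X : E →L[ℝ] E) : Prop :=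
  ∀ η > (0:ℝ), ∀ᶠ d in 𝓝 (0:E), v (x + d) ≤ v x + ⟪p, d⟫ + 1 / 2 * ⟪X d, d⟫ + η * ‖d‖ ^ 2

/-- Second order subjet of `v` at `x`, in Peano form. -/
def SubJet (v : E → ℝ) (x p : E) (X : E →L[ℝ] E) : Prop :=
  ∀ η > (0:ℝ), ∀ᶠ d in 𝓝 (0:E), v x + ⟪p, d⟫ + 1 / 2 * ⟪X d, d⟫ - η * ‖d‖ ^ 2 ≤ v (x + d)

theorem superJet_neg {v : E → ℝ} {x p : E} {X : E →L[ℝ] E} :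
    SuperJet (fun y => -v y) x p X ↔ SubJet v x (-p) (-X) := by
  unfold SuperJet SubJet
  refine forall₂_congr fun η _ => eventually_congr (Eventually.of_forall fun d => ?_)
  simp only [inner_neg_left, neg_apply]
  constructor <;> intro h <;> linarith

variable [FiniteDimensional ℝ E]

theorem exists_supConvolution {a : E → ℝ} (ha : Continuous a) (x₀ : E) {η : ℝ} (hη : 0 < η) :
    ∃ C : ℝ, 0 ≤ C ∧ ∃ a' : E → ℝ, LowerParab C a' ∧ (∀ x ∈ closedBall x₀ 1, a x ≤ a' x) ∧
      ∀ x ∈ closedBall x₀ 1, a' x ≤ a x + η ∧ ∃ z, ‖z - x‖ ≤ η ∧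
        ∀ d, z + d ∈ closedBall x₀ 1 → a (z + d) - a z ≤ a' (x + d) - a' x := by
  have hK := isCompact_closedBall x₀ (1:ℝ)
  obtain ⟨W, hW⟩ := hK.exists_bound_of_continuousOn ha.continuousOn
  have huc := hK.uniformContinuousOn_of_continuous ha.continuousOn
  rw [Metric.uniformContinuousOn_iff_le] at huc
  obtain ⟨δ, hδ, hmod⟩ := huc η hη
  set δ' := min δ η with hδ'
  have hδ'0 : 0 < δ' := by positivity
  have hW0 : 0 ≤ W := (norm_nonneg _).trans (hW x₀ (by simp))
  set c := (2 * W + 1) / δ' ^ 2 with hc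
  have hc0 : 0 ≤ c := by positivity
  have hex : ∀ x, ∃ z ∈ closedBall x₀ (1:ℝ), ∀ w ∈ closedBall x₀ (1:ℝ),
      a w - c * ‖x - w‖ ^ 2 ≤ a z - c * ‖x - z‖ ^ 2 := by
    intro x
    obtain ⟨z, hz, hmax⟩ := hK.exists_isMaxOn ⟨x₀, by simp⟩
      (f := fun w => a w - c * ‖x - w‖ ^ 2) (by fun_prop)
    exact ⟨z, hz, fun w hw => hmax hw⟩
  choose z hz hmax using hex
  refine ⟨2 * c, by positivity, fun x => a (z x) - c * ‖x - z x‖ ^ 2, ?_, ?_, ?_⟩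
  · intro x
    refine ⟨(2 * c) • (z x - x), fun w => ?_⟩
    have h1 := hmax w (z x) (hz x)
    have h2 : ‖w - z x‖ ^ 2 = ‖w - x‖ ^ 2 - 2 * ⟪z x - x, w - x⟫ + ‖z x - x‖ ^ 2 := by
      have : w - z x = (w - x) - (z x - x) := by abel
      rw [this, norm_sub_sq_real, real_inner_comm]
    rw [norm_sub_rev (z x) x] at h2
    rw [real_inner_smul_left]
    rw [h2] at h1
    linarith
  · intro x hx
    simpa using hmax x x hx
  · intro x hx
    have h1 := hmax x x hx
    simp only [sub_self, norm_zero] at h1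
    have hzx : ‖x - z x‖ ≤ δ' := by
      by_contra hlt
      push Not at hlt
      have a1 := hW x hx
      have a2 := hW _ (hz x)
      rw [Real.norm_eq_abs, abs_le] at a1 a2
      have : 2 * W + 1 ≤ c * ‖x - z x‖ ^ 2 := by
        calc 2 * W + 1 = c * δ' ^ 2 := by rw [hc]; field_simp
          _ ≤ _ := by gcongr
      linarith [a1.1, a2.2]
    have h2 := hmod (z x) (hz x) x hx (by
      rw [dist_comm, dist_eq_norm]; exact hzx.trans (min_le_left _ _))
    rw [Real.dist_eq] at h2
    have h3 := (le_abs_self _).trans h2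
    refine ⟨?_, z x, by rw [norm_sub_rev]; exact hzx.trans (min_le_right _ _), ?_⟩
    · have : 0 ≤ c * ‖x - z x‖ ^ 2 := by positivity
      linarith
    · intro d hd
      have := hmax (x + d) (z x + d) hd
      have e : x + d - (z x + d) = x - z x := by abel
      rw [e] at this
      simp only
      linarith

theorem inner_clm_add_add (S : E →L[ℝ] E) (x d : E) :
    ⟪S (x + d), x + d⟫ = ⟪S x, x⟫ + ⟪S x + ContinuousLinearMap.adjoint S x, d⟫ + ⟪S d, d⟫ := by
  rw [inner_add_left, ContinuousLinearMap.adjoint_inner_left, map_add]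
  simp only [inner_add_left, inner_add_right]
  rw [real_inner_comm (S d) x]
  ring

theorem LowerParab.sub_quadratic {C : ℝ} {U : E → ℝ} (h : LowerParab C U) (l : E)
    (S : E →L[ℝ] E) :
    LowerParab (C + ‖S‖) (fun x => U x - ⟪l, x⟫ - 1 / 2 * ⟪S x, x⟫) := by
  intro x
  obtain ⟨q, hq⟩ := h x
  refine ⟨q - l - (1 / 2 : ℝ) • (S x + ContinuousLinearMap.adjoint S x), fun w => ?_⟩
  have h1 := hq w
  have h2 : ⟪S w, w⟫ = ⟪S x, x⟫ + ⟪S x + ContinuousLinearMap.adjoint S x, w - x⟫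
      + ⟪S (w - x), w - x⟫ := by
    have := inner_clm_add_add S x (w - x)
    rwa [add_sub_cancel] at this
  have h3 : ⟪S (w - x), w - x⟫ ≤ ‖S‖ * ‖w - x‖ ^ 2 := by
    refine (real_inner_le_norm _ _).trans ?_
    calc _ ≤ ‖S‖ * ‖w - x‖ * ‖w - x‖ := by gcongr; exact S.le_opNorm _
      _ = _ := by ring
  simp only
  rw [h2, inner_sub_left, inner_sub_left, real_inner_smul_left]
  have h4 : ⟪l, w - x⟫ = ⟪l, w⟫ - ⟪l, x⟫ := inner_sub_right _ _ _
  rw [h4]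
  linarith

theorem eq_zero_of_eventually_abs_inner_le {b : E → ℝ} (hb : ∀ (t : ℝ) d, b (t • d) = t ^ 2 * b d)
    (h : ∀ η > (0:ℝ), ∀ᶠ d in 𝓝 (0:E), |b d| ≤ η * ‖d‖ ^ 2) (d : E) : b d = 0 := by
  by_contra hne
  have hpos : 0 < |b d| := abs_pos.2 hne
  have h1 := h (|b d| / (2 * (‖d‖ ^ 2 + 1))) (by positivity)
  have h3 : Tendsto (fun t : ℝ => t • d) (𝓝[>] 0) (𝓝 0) := by
    have : Tendsto (fun t : ℝ => t • d) (𝓝 0) (𝓝 ((0:ℝ) • d)) :=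
      Continuous.tendsto (by fun_prop) 0
    rw [zero_smul] at this
    exact this.mono_left nhdsWithin_le_nhds
  obtain ⟨t, ht1, ht⟩ := ((h3.eventually h1).and self_mem_nhdsWithin).exists
  have ht : 0 < t := ht
  rw [hb, abs_mul, abs_of_pos (by positivity : (0:ℝ) < t ^ 2), norm_smul, mul_pow,
    Real.norm_eq_abs, sq_abs] at ht1
  have h6 : |b d| / (2 * (‖d‖ ^ 2 + 1)) * (t ^ 2 * ‖d‖ ^ 2) ≤ t ^ 2 * |b d| / 2 := by
    have : |b d| / (2 * (‖d‖ ^ 2 + 1)) * (t ^ 2 * ‖d‖ ^ 2) =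
        t ^ 2 * |b d| / 2 * (‖d‖ ^ 2 / (‖d‖ ^ 2 + 1)) := by field_simp
    rw [this]
    refine mul_le_of_le_one_right (by positivity) ?_
    rw [div_le_one (by positivity)]; linarith
  have h7 : 0 < t ^ 2 * |b d| := by positivity
  linarith

end Jets

section Doubling
variable {E : Type*} [NormedAddCommGroup E] [InnerProductSpace ℝ E] [FiniteDimensional ℝ E]

/-- The `L²` product of `E` with itself. -/
local notation "E₂" => WithLp 2 (E × E)

/-- First inclusion of `E` in the `L²` product. -/
def inlL2 : E →L[ℝ] E₂ :=
  ((WithLp.prodContinuousLinearEquiv 2 ℝ E E).symm : E × E →L[ℝ] E₂) ∘L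
    ContinuousLinearMap.inl ℝ E E

/-- Second inclusion of `E` in the `L²` product. -/
def inrL2 : E →L[ℝ] E₂ :=
  ((WithLp.prodContinuousLinearEquiv 2 ℝ E E).symm : E × E →L[ℝ] E₂) ∘L
    ContinuousLinearMap.inr ℝ E E

@[simp] theorem inlL2_fst (d : E) : (inlL2 d).fst = d := rfl
@[simp] theorem inlL2_snd (d : E) : (inlL2 d).snd = 0 := rfl
@[simp] theorem inrL2_fst (d : E) : (inrL2 d).fst = 0 := rfl
@[simp] theorem inrL2_snd (d : E) : (inrL2 d).snd = d := rfl

theorem inlL2_add_inrL2 (ζ : E₂) : inlL2 ζ.fst + inrL2 ζ.snd = ζ := by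
  apply WithLp.ofLp_injective
  apply Prod.ext
  · change ζ.fst + 0 = ζ.fst; simp
  · change 0 + ζ.snd = ζ.snd; simp

theorem norm_inlL2 (d : E) : ‖inlL2 d‖ = ‖d‖ := by
  have h := WithLp.prod_norm_sq_eq_of_L2 (inlL2 d)
  simp only [inlL2_fst, inlL2_snd, norm_zero] at h
  have : ‖inlL2 d‖ ^ 2 = ‖d‖ ^ 2 := by rw [h]; ring
  exact (sq_eq_sq₀ (norm_nonneg _) (norm_nonneg _)).1 this

theorem norm_inrL2 (d : E) : ‖inrL2 d‖ = ‖d‖ := by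
  have h := WithLp.prod_norm_sq_eq_of_L2 (inrL2 d)
  simp only [inrL2_fst, inrL2_snd, norm_zero] at h
  have : ‖inrL2 d‖ ^ 2 = ‖d‖ ^ 2 := by rw [h]; ring
  exact (sq_eq_sq₀ (norm_nonneg _) (norm_nonneg _)).1 this

theorem norm_fst_le_L2 (ζ : E₂) : ‖ζ.fst‖ ≤ ‖ζ‖ := by
  have h := WithLp.prod_norm_sq_eq_of_L2 ζ
  refine (sq_le_sq₀ (norm_nonneg _) (norm_nonneg _)).1 ?_
  rw [h]; nlinarith [norm_nonneg ζ.snd]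

theorem norm_snd_le_L2 (ζ : E₂) : ‖ζ.snd‖ ≤ ‖ζ‖ := by
  have h := WithLp.prod_norm_sq_eq_of_L2 ζ
  refine (sq_le_sq₀ (norm_nonneg _) (norm_nonneg _)).1 ?_
  rw [h]; nlinarith [norm_nonneg ζ.fst]

theorem inner_inlL2 (P : E₂) (d : E) : ⟪P, inlL2 d⟫ = ⟪P.fst, d⟫ := by
  rw [WithLp.prod_inner_apply]; simp [inlL2]

theorem inner_inrL2 (P : E₂) (d : E) : ⟪P, inrL2 d⟫ = ⟪P.snd, d⟫ := by
  rw [WithLp.prod_inner_apply]; simp [inrL2]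

/-- Restriction of an operator on the `L²` product to the first factor. -/
def blockFst (H : E₂ →L[ℝ] E₂) : E →L[ℝ] E := (WithLp.fstL 2 ℝ E E) ∘L H ∘L inlL2

/-- Restriction of an operator on the `L²` product to the second factor. -/
def blockSnd (H : E₂ →L[ℝ] E₂) : E →L[ℝ] E := (WithLp.sndL 2 ℝ E E) ∘L H ∘L inrL2

theorem inner_blockFst (H : E₂ →L[ℝ] E₂) (d : E) :
    ⟪blockFst H d, d⟫ = ⟪H (inlL2 d), inlL2 d⟫ := by
  rw [inner_inlL2]; rfl

theorem inner_blockSnd (H : E₂ →L[ℝ] E₂) (d : E) :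
    ⟪blockSnd H d, d⟫ = ⟪H (inrL2 d), inrL2 d⟫ := by
  rw [inner_inrL2]; rfl

/-- A separated function with a second order expansion has a block diagonal Hessian. -/
theorem expansion_separated {a b : E → ℝ} {x y : E} {P : E₂} {H : E₂ →L[ℝ] E₂}
    (h : ∀ η > (0:ℝ), ∀ᶠ ζ in 𝓝 (0:E₂), |a (x + ζ.fst) + b (y + ζ.snd) - (a x + b y) - ⟪P, ζ⟫
      - 1 / 2 * ⟪H ζ, ζ⟫| ≤ η * ‖ζ‖ ^ 2) :
    SuperJet a x P.fst (blockFst H) ∧ SuperJet b y P.snd (blockSnd H) ∧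
      ∀ ζ : E₂, ⟪blockFst H ζ.fst, ζ.fst⟫ + ⟪blockSnd H ζ.snd, ζ.snd⟫ = ⟪H ζ, ζ⟫ := by
  have tl : Tendsto (fun d : E => inlL2 d) (𝓝 0) (𝓝 0) := by
    simpa using (inlL2 (E := E)).continuous.tendsto 0
  have tr : Tendsto (fun d : E => inrL2 d) (𝓝 0) (𝓝 0) := by
    simpa using (inrL2 (E := E)).continuous.tendsto 0
  refine ⟨?_, ?_, ?_⟩
  · intro η hη
    filter_upwards [tl.eventually (h η hη)] with d hd
    rw [norm_inlL2, inner_inlL2, ← inner_blockFst, abs_le] at hd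
    simp only [inlL2_fst, inlL2_snd, add_zero] at hd
    linarith [hd.2]
  · intro η hη
    filter_upwards [tr.eventually (h η hη)] with d hd
    rw [norm_inrL2, inner_inrL2, ← inner_blockSnd, abs_le] at hd
    simp only [inrL2_fst, inrL2_snd, add_zero] at hd
    linarith [hd.2]
  · intro ζ
    have tf : Tendsto (fun ζ : E₂ => inlL2 ζ.fst) (𝓝 0) (𝓝 0) := by
      have : Continuous (fun ζ : E₂ => inlL2 ((WithLp.fstL 2 ℝ E E) ζ)) := by fun_prop
      simpa using this.tendsto 0
    have ts : Tendsto (fun ζ : E₂ => inrL2 ζ.snd) (𝓝 0) (𝓝 0) := by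
      have : Continuous (fun ζ : E₂ => inrL2 ((WithLp.sndL 2 ℝ E E) ζ)) := by fun_prop
      simpa using this.tendsto 0
    have key := eq_zero_of_eventually_abs_inner_le
      (b := fun ζ : E₂ => ⟪H (inlL2 ζ.fst), inlL2 ζ.fst⟫ + ⟪H (inrL2 ζ.snd), inrL2 ζ.snd⟫
        - ⟪H ζ, ζ⟫) (by
        intro t d
        simp only [WithLp.smul_fst, WithLp.smul_snd, map_smul, real_inner_smul_left,
          real_inner_smul_right]
        ring) (by
        intro η hη
        have hη' : 0 < η / 6 := by positivity
        filter_upwards [h _ hη', tf.eventually (h _ hη'), ts.eventually (h _ hη')] with ζ h1 h2 h3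
        simp only [inlL2_fst, inlL2_snd, inrL2_fst, inrL2_snd, add_zero, norm_inlL2,
          norm_inrL2] at h2 h3
        have n1 := norm_fst_le_L2 ζ
        have n2 := norm_snd_le_L2 ζ
        have n1' : η / 6 * ‖ζ.fst‖ ^ 2 ≤ η / 6 * ‖ζ‖ ^ 2 := by gcongr
        have n2' : η / 6 * ‖ζ.snd‖ ^ 2 ≤ η / 6 * ‖ζ‖ ^ 2 := by gcongr
        have e : ⟪P, ζ⟫ = ⟪P, inlL2 ζ.fst⟫ + ⟪P, inrL2 ζ.snd⟫ := by
          rw [← inner_add_right, inlL2_add_inrL2]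
        rw [e] at h1
        rw [abs_le] at *
        constructor <;> linarith [h1.1, h1.2, h2.1, h2.2, h3.1, h3.2]) ζ
    rw [inner_blockFst, inner_blockSnd]
    linarith

end Doubling

section Contact
variable {E : Type*} [NormedAddCommGroup E] [InnerProductSpace ℝ E] [FiniteDimensional ℝ E]
local notation "E₂" => WithLp 2 (E × E)

theorem LowerParab.separated {a b : E → ℝ} {C C' : ℝ} (hC : 0 ≤ C) (hC' : 0 ≤ C')
    (ha : LowerParab C a) (hb : LowerParab C' b) (x y : E) :
    LowerParab (C + C') (fun ζ : E₂ => a (x + ζ.fst) + b (y + ζ.snd)) := by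
  intro ζ
  obtain ⟨q, hq⟩ := ha (x + ζ.fst)
  obtain ⟨q', hq'⟩ := hb (y + ζ.snd)
  refine ⟨inlL2 q + inrL2 q', fun w => ?_⟩
  have h1 := hq (x + w.fst)
  have h2 := hq' (y + w.snd)
  rw [add_sub_add_left_eq_sub] at h1 h2
  have n1 : ‖w.fst - ζ.fst‖ ^ 2 ≤ ‖w - ζ‖ ^ 2 := by
    have := norm_fst_le_L2 (w - ζ)
    rw [WithLp.sub_fst] at this
    gcongr
  have n2 : ‖w.snd - ζ.snd‖ ^ 2 ≤ ‖w - ζ‖ ^ 2 := by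
    have := norm_snd_le_L2 (w - ζ)
    rw [WithLp.sub_snd] at this
    gcongr
  have e : ⟪inlL2 q + inrL2 q', w - ζ⟫ = ⟪q, w.fst - ζ.fst⟫ + ⟪q', w.snd - ζ.snd⟫ := by
    rw [inner_add_left, real_inner_comm, inner_inlL2, real_inner_comm,
      real_inner_comm _ (inrL2 q'), inner_inrL2, real_inner_comm q',
      WithLp.sub_fst, WithLp.sub_snd]
  rw [e]
  have m1 := mul_le_mul_of_nonneg_left n1 hC
  have m2 := mul_le_mul_of_nonneg_left n2 hC'
  simp only
  linarith

theorem exists_superJets_of_expansion {a b : E → ℝ} (ha : Continuous a) (hb : Continuous b)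
    {x₀ y₀ : E} {P : E₂} {S : E₂ →L[ℝ] E₂}
    (h : ∀ η > (0:ℝ), ∀ᶠ ζ in 𝓝 (0:E₂), a (x₀ + ζ.fst) + b (y₀ + ζ.snd) ≤
      a x₀ + b y₀ + ⟪P, ζ⟫ + 1 / 2 * ⟪S ζ, ζ⟫ + η * ‖ζ‖ ^ 2) {ε : ℝ} (hε : 0 < ε) :
    ∃ x y p q, ∃ X Y : E →L[ℝ] E, ‖x - x₀‖ ≤ ε ∧ ‖y - y₀‖ ≤ ε ∧ ‖p - P.fst‖ ≤ ε ∧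
      ‖q - P.snd‖ ≤ ε ∧ SuperJet a x p X ∧ SuperJet b y q Y ∧
      ∀ ζ : E₂, ⟪X ζ.fst, ζ.fst⟫ + ⟪Y ζ.snd, ζ.snd⟫ ≤ ⟪S ζ, ζ⟫ + ε * ‖ζ‖ ^ 2 := by
  obtain ⟨η, hη, hη1, hηε⟩ : ∃ η > (0:ℝ), η ≤ 1 / 4 ∧ η * (‖S‖ + 8) ≤ ε := by
    refine ⟨min (1 / 4) (ε / (‖S‖ + 8)), by positivity, min_le_left _ _, ?_⟩
    calc _ ≤ ε / (‖S‖ + 8) * (‖S‖ + 8) := by gcongr; exact min_le_right _ _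
      _ = ε := by field_simp
  obtain ⟨r₀, hr₀, hball⟩ := Metric.eventually_nhds_iff.1 (h η hη)
  set r := min (r₀ / 2) η with hr
  have hr0 : 0 < r := by positivity
  have hrη : r ≤ η := min_le_right _ _
  have hrr : r < r₀ := (min_le_left _ _).trans_lt (by linarith)
  set τ := η * r ^ 2 / 4 with hτ
  have hτ0 : 0 < τ := by positivity
  have hτη : τ ≤ η := by
    have : r ^ 2 ≤ 1 := by nlinarith
    nlinarith
  obtain ⟨C, hC, a', hpa, hage, ha'⟩ := exists_supConvolution ha x₀ hτ0
  obtain ⟨C', hC', b', hpb, hbge, hb'⟩ := exists_supConvolution hb y₀ hτ0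
  set S' : E₂ →L[ℝ] E₂ := S + (4 * η) • ContinuousLinearMap.id ℝ E₂ with hS'
  have hS'q : ∀ ζ, ⟪S' ζ, ζ⟫ = ⟪S ζ, ζ⟫ + 4 * η * ‖ζ‖ ^ 2 := by
    intro ζ
    rw [hS', add_apply, inner_add_left, smul_apply,
      ContinuousLinearMap.id_apply, real_inner_smul_left, real_inner_self_eq_norm_sq]
  set W : E₂ → ℝ := fun ζ => a' (x₀ + ζ.fst) + b' (y₀ + ζ.snd) with hW
  have hU : LowerParab (C + C' + ‖S'‖) (fun ζ => W ζ - ⟪P, ζ⟫ - 1 / 2 * ⟪S' ζ, ζ⟫) :=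
    (hpa.separated hC hC' hpb x₀ y₀).sub_quadratic P S'
  have hmem : ∀ (z e : E), ‖e‖ ≤ 1 → z + e ∈ closedBall z 1 := by
    intro z e he; simpa [mem_closedBall, dist_eq_norm] using he
  obtain ⟨ζ, hζr, p, hp, B, hB, hexp⟩ := hU.exists_expansion (m₀ := η * r ^ 2 / 2) (ε := η)
    (by positivity) hr0 (by positivity) hη (by
      intro y hy
      have h1 := hball (y := y) (by rw [dist_zero_right, hy]; exact hrr)
      have f1 := norm_fst_le_L2 y
      have f2 := norm_snd_le_L2 y
      have h2 := (ha' _ (hmem x₀ y.fst (by linarith))).1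
      have h3 := (hb' _ (hmem y₀ y.snd (by linarith))).1
      have h4 := hage x₀ (by simp)
      have h5 := hbge y₀ (by simp)
      have h6 : W 0 = a' x₀ + b' y₀ := by simp [hW]
      have h7 : W y = a' (x₀ + y.fst) + b' (y₀ + y.snd) := rfl
      simp only [inner_zero_right, mul_zero, sub_zero]
      rw [h6, h7, hS'q, hy]
      rw [hy] at h1
      linarith)
  set p' : E₂ := p + P + (1 / 2 : ℝ) • (S' ζ + ContinuousLinearMap.adjoint S' ζ) with hp'
  have hWexp : ∀ κ > (0:ℝ), ∀ᶠ d in 𝓝 (0:E₂), |a' (x₀ + ζ.fst + d.fst) + b' (y₀ + ζ.snd + d.snd)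
      - (a' (x₀ + ζ.fst) + b' (y₀ + ζ.snd)) - ⟪p', d⟫ - 1 / 2 * ⟪(B + S') d, d⟫| ≤
      κ * ‖d‖ ^ 2 := by
    intro κ hκ
    filter_upwards [hexp κ hκ] with d hd
    convert hd using 2
    simp only [hW, WithLp.add_fst, WithLp.add_snd]
    rw [inner_clm_add_add, hp', inner_add_right P,
      inner_add_left (p + P), inner_add_left p P, add_apply B S',
      inner_add_left (B d), real_inner_smul_left, add_assoc x₀, add_assoc y₀]
    ring
  obtain ⟨hXa, hYb, hblock⟩ := expansion_separated hWexp
  have f1 := norm_fst_le_L2 ζ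
  have f2 := norm_snd_le_L2 ζ
  obtain ⟨_, za, hza, hza'⟩ := ha' _ (hmem x₀ ζ.fst (by linarith))
  obtain ⟨_, zb, hzb, hzb'⟩ := hb' _ (hmem y₀ ζ.snd (by linarith))
  have near : ∀ (z₀ e z : E), ‖e‖ ≤ ‖ζ‖ → ‖z - (z₀ + e)‖ ≤ τ → ‖z - z₀‖ ≤ 2 * η := by
    intro z₀ e z he hz
    have : ‖z - z₀‖ ≤ ‖z - (z₀ + e)‖ + ‖e‖ := by
      calc ‖z - z₀‖ = ‖(z - (z₀ + e)) + e‖ := by congr 1; abel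
        _ ≤ _ := norm_add_le _ _
    linarith
  have na := near _ _ _ f1 hza
  have nb := near _ _ _ f2 hzb
  have hS'n : ‖S'‖ ≤ ‖S‖ + 4 * η := by
    refine ContinuousLinearMap.opNorm_le_bound _ (by positivity) fun x => ?_
    have e : S' x = S x + (4 * η) • x := rfl
    rw [e, add_mul]
    refine (norm_add_le _ _).trans (add_le_add (S.le_opNorm x) ?_)
    rw [norm_smul, Real.norm_of_nonneg (by positivity)]
  have hp'P : ‖p' - P‖ ≤ ε := by
    have e : p' - P = p + (1 / 2 : ℝ) • (S' ζ + ContinuousLinearMap.adjoint S' ζ) := by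
      rw [hp']; abel
    have e1 : ‖S' ζ‖ ≤ ‖S'‖ * ‖ζ‖ := S'.le_opNorm _
    have e2 : ‖ContinuousLinearMap.adjoint S' ζ‖ ≤ ‖S'‖ * ‖ζ‖ := by
      refine (ContinuousLinearMap.le_opNorm _ _).trans ?_
      rw [LinearIsometryEquiv.norm_map]
    rw [e]
    calc _ ≤ ‖p‖ + ‖(1 / 2 : ℝ) • (S' ζ + ContinuousLinearMap.adjoint S' ζ)‖ := norm_add_le _ _
      _ ≤ η + 1 / 2 * (‖S'‖ * ‖ζ‖ + ‖S'‖ * ‖ζ‖) := by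
        gcongr
        rw [norm_smul, Real.norm_of_nonneg (by positivity)]
        gcongr
        exact (norm_add_le _ _).trans (add_le_add e1 e2)
      _ = η + ‖S'‖ * ‖ζ‖ := by ring
      _ ≤ η + (‖S‖ + 4 * η) * η := by gcongr; linarith
      _ ≤ η * (‖S‖ + 8) := by nlinarith
      _ ≤ ε := hηε
  have h8 : 8 * η ≤ ε := by nlinarith [norm_nonneg S]
  have shift : ∀ {g g' : E → ℝ} {z₀ x z p : E} {X : E →L[ℝ] E}, ‖z - z₀‖ ≤ 2 * η →
      (∀ d, z + d ∈ closedBall z₀ 1 → g (z + d) - g z ≤ g' (x + d) - g' x) →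
      SuperJet g' x p X → SuperJet g z p X := by
    intro g g' z₀ x z p X hz hg hj κ hκ
    filter_upwards [hj κ hκ, Metric.ball_mem_nhds (0:E) (by norm_num : (0:ℝ) < 1 / 2)]
      with d hd hd'
    rw [mem_ball, dist_zero_right] at hd'
    have := hg d (by
      rw [mem_closedBall, dist_eq_norm]
      calc ‖z + d - z₀‖ = ‖(z - z₀) + d‖ := by congr 1; abel
        _ ≤ ‖z - z₀‖ + ‖d‖ := norm_add_le _ _
        _ ≤ 1 := by linarith)
    linarith
  refine ⟨za, zb, p'.fst, p'.snd, blockFst (B + S'), blockSnd (B + S'), by linarith, by linarith,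
    ?_, ?_, shift na hza' hXa, shift nb hzb' hYb, ?_⟩
  · exact (norm_fst_le_L2 (p' - P)).trans hp'P
  · exact (norm_snd_le_L2 (p' - P)).trans hp'P
  · intro d
    rw [hblock, add_apply, inner_add_left, hS'q]
    have := hB d
    nlinarith [sq_nonneg ‖d‖]

/-- Jets at a local minimum of `v y - v x - ψ (y - x) - β x`. -/
theorem exists_jets_of_contact {v : E → ℝ} (hv : Continuous v) {x₀ y₀ P b : E}
    {Ψ D : E →L[ℝ] E}
    (h : ∀ η > (0:ℝ), ∀ᶠ ζ in 𝓝 (0:E₂), v y₀ - v x₀ + ⟪P, ζ.snd - ζ.fst⟫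
      + 1 / 2 * ⟪Ψ (ζ.snd - ζ.fst), ζ.snd - ζ.fst⟫ + ⟪b, ζ.fst⟫ + 1 / 2 * ⟪D ζ.fst, ζ.fst⟫
      - η * ‖ζ‖ ^ 2 ≤ v (y₀ + ζ.snd) - v (x₀ + ζ.fst)) {ε : ℝ} (hε : 0 < ε) :
    ∃ x y p q, ∃ X Y : E →L[ℝ] E, ‖x - x₀‖ ≤ ε ∧ ‖y - y₀‖ ≤ ε ∧ ‖p - (P - b)‖ ≤ ε ∧
      ‖q - P‖ ≤ ε ∧ SuperJet v x p X ∧ SubJet v y q Y ∧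
      ∀ ξ ξ' : E, ⟪Ψ (ξ - ξ'), ξ - ξ'⟫ + ⟪D ξ', ξ'⟫ - ε * (‖ξ‖ ^ 2 + ‖ξ'‖ ^ 2) ≤
        ⟪Y ξ, ξ⟫ - ⟪X ξ', ξ'⟫ := by
  set pr : E₂ →L[ℝ] E := WithLp.sndL 2 ℝ E E - WithLp.fstL 2 ℝ E E with hpr
  set S : E₂ →L[ℝ] E₂ := -(inrL2 - inlL2) ∘L Ψ ∘L pr - inlL2 ∘L D ∘L WithLp.fstL 2 ℝ E E with hS
  have hSq : ∀ ζ : E₂, ⟪S ζ, ζ⟫ = -⟪Ψ (ζ.snd - ζ.fst), ζ.snd - ζ.fst⟫ - ⟪D ζ.fst, ζ.fst⟫ := by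
    intro ζ
    have e1 : S ζ = -(inrL2 (Ψ (ζ.snd - ζ.fst)) - inlL2 (Ψ (ζ.snd - ζ.fst)))
      - inlL2 (D ζ.fst) := rfl
    rw [e1, real_inner_comm, inner_sub_right, inner_neg_right, inner_sub_right, inner_inlL2,
      inner_inlL2, inner_inrL2, ← inner_sub_left, real_inner_comm, real_inner_comm ζ.fst]
  obtain ⟨x, y, p, q, X, Y, hx, hy, hp, hq, hX, hY, hXY⟩ := exists_superJets_of_expansion
    (a := v) (b := fun y => -v y) (x₀ := x₀) (y₀ := y₀) (P := inlL2 (P - b) + inrL2 (-P)) (S := S)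
    hv hv.neg (by
      intro η hη
      filter_upwards [h η hη] with ζ hζ
      rw [hSq, inner_add_left, real_inner_comm, inner_inlL2, real_inner_comm ζ, inner_inrL2,
        real_inner_comm _ ζ.fst, real_inner_comm _ ζ.snd, inner_sub_left, inner_neg_left]
      rw [inner_sub_right] at hζ
      linarith) hε
  refine ⟨x, y, p, -q, X, -Y, hx, hy, by simpa using hp, ?_, hX, superJet_neg.1 hY, ?_⟩
  · have : ‖-(q + P)‖ ≤ ε := by rw [norm_neg]; simpa using hq
    convert this using 2; abel
  · intro ξ ξ'
    have := hXY (inlL2 ξ' + inrL2 ξ)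
    rw [hSq, WithLp.prod_norm_sq_eq_of_L2] at this
    simp only [WithLp.add_fst, WithLp.add_snd, inlL2_fst, inlL2_snd, inrL2_fst, inrL2_snd,
      add_zero, zero_add] at this
    rw [neg_apply, inner_neg_left]
    linarith

end Contact

section Elliptic

/-- Positively homogeneous, uniformly elliptic operators acting on (the quadratic forms of)
endomorphisms. -/
structure EllipticOp {E : Type*} [NormedAddCommGroup E] [InnerProductSpace ℝ E] (a A : ℝ)
    (G : (E →L[ℝ] E) → ℝ) : Prop where
  homog : ∀ t : ℝ, 0 ≤ t → ∀ X, G (t • X) = t * G X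
  gain : ∀ (X Y : E →L[ℝ] E) (c₁ c₃ : ℝ) (e : E), 0 ≤ c₁ → ‖e‖ = 1 →
    (∀ k, ⟪X k, k⟫ - c₁ * ‖k‖ ^ 2 ≤ ⟪Y k, k⟫) → ⟪X e, e⟫ + c₃ ≤ ⟪Y e, e⟫ →
    a * c₃ - A * c₁ ≤ G Y - G X

variable {N : ℕ}

/-- The symmetric matrix of the quadratic form of an endomorphism. -/
def opMat (X : ESp N →L[ℝ] ESp N) : Matrix (Fin N) (Fin N) ℝ :=
  Matrix.of fun i j =>
    (⟪X (EuclideanSpace.single i 1), EuclideanSpace.single j 1⟫ +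
      ⟪X (EuclideanSpace.single j 1), EuclideanSpace.single i 1⟫) / 2

theorem opMat_isSymm (X : ESp N →L[ℝ] ESp N) : (opMat X).IsSymm := by
  ext i j
  simp only [opMat, Matrix.transpose_apply, Matrix.of_apply]
  ring

theorem opMat_add (X Y : ESp N →L[ℝ] ESp N) : opMat (X + Y) = opMat X + opMat Y := by
  ext i j
  simp only [opMat, Matrix.add_apply, Matrix.of_apply, add_apply, inner_add_left]
  ring

theorem opMat_smul (t : ℝ) (X : ESp N →L[ℝ] ESp N) : opMat (t • X) = t • opMat X := by
  ext i j
  simp only [opMat, Matrix.smul_apply, Matrix.of_apply, smul_apply, real_inner_smul_left,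
    smul_eq_mul]
  ring

theorem inner_clm_eq_sum (X : ESp N →L[ℝ] ESp N) (e : ESp N) :
    ⟪X e, e⟫ = ∑ i, ∑ j, e i * e j *
      ⟪X (EuclideanSpace.single i 1), EuclideanSpace.single j 1⟫ := by
  have he : e = ∑ i, e i • EuclideanSpace.single i (1:ℝ) := by
    have := (EuclideanSpace.basisFun (Fin N) ℝ).sum_repr e
    simpa using this.symm
  conv_lhs => rw [he]
  rw [map_sum, sum_inner]
  refine Finset.sum_congr rfl fun i _ => ?_
  rw [inner_sum]
  refine Finset.sum_congr rfl fun j _ => ?_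
  rw [map_smul, real_inner_smul_left, real_inner_smul_right]
  ring

theorem opMat_posSemidef {X : ESp N →L[ℝ] ESp N} (hX : ∀ k, 0 ≤ ⟪X k, k⟫) :
    (opMat X).PosSemidef := by
  refine Matrix.PosSemidef.of_dotProduct_mulVec_nonneg ?_ fun x => ?_
  · rw [Matrix.IsHermitian, Matrix.conjTranspose_eq_transpose_of_trivial]
    exact opMat_isSymm X
  · have h := hX (WithLp.toLp 2 x)
    rw [inner_clm_eq_sum] at h
    refine h.trans_eq ?_
    have hsw : ∑ i, ∑ j, x i * x j *
        ⟪X (EuclideanSpace.single j 1), (EuclideanSpace.single i 1 : ESp N)⟫ =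
        ∑ i, ∑ j, x i * x j *
        ⟪X (EuclideanSpace.single i 1), (EuclideanSpace.single j 1 : ESp N)⟫ := by
      rw [Finset.sum_comm]
      exact Finset.sum_congr rfl fun i _ => Finset.sum_congr rfl fun j _ => by ring
    simp only [dotProduct, Matrix.mulVec, star_trivial, Finset.mul_sum, opMat, Matrix.of_apply]
    have : ∀ i j, x i * ((⟪X (EuclideanSpace.single i 1), (EuclideanSpace.single j 1 : ESp N)⟫ +
        ⟪X (EuclideanSpace.single j 1), (EuclideanSpace.single i 1 : ESp N)⟫) / 2 * x j) =
        x i * x j * ⟪X (EuclideanSpace.single i 1), (EuclideanSpace.single j 1 : ESp N)⟫ / 2 +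
        x i * x j * ⟪X (EuclideanSpace.single j 1), (EuclideanSpace.single i 1 : ESp N)⟫ / 2 :=
      fun i j => by ring
    simp only [this, Finset.sum_add_distrib, ← Finset.sum_div]
    rw [hsw]
    ring

theorem inner_le_trace_opMat {X : ESp N →L[ℝ] ESp N} (hX : ∀ k, 0 ≤ ⟪X k, k⟫) {e : ESp N}
    (he : ‖e‖ = 1) : ⟪X e, e⟫ ≤ (opMat X).trace := by
  set B : Fin N → Fin N → ℝ :=
    fun i j => ⟪X (EuclideanSpace.single i 1), (EuclideanSpace.single j 1 : ESp N)⟫ with hB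
  have htr : (opMat X).trace = ∑ i, B i i := by
    simp [Matrix.trace, opMat, hB]
  have hq : ∀ i j,
      0 ≤ e j ^ 2 * B i i + e i ^ 2 * B j j - e i * e j * B i j - e i * e j * B j i := by
    intro i j
    have h := hX (e j • EuclideanSpace.single i 1 - e i • EuclideanSpace.single j 1)
    simp only [map_sub, map_smul, inner_sub_left, inner_sub_right, real_inner_smul_left,
      real_inner_smul_right] at h
    simp only [hB]
    linarith
  have hnorm : ∑ i, e i ^ 2 = 1 := by
    have := EuclideanSpace.real_norm_sq_eq e
    rw [he] at this
    linarith
  have hsum : 0 ≤ ∑ i, ∑ j,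
      (e j ^ 2 * B i i + e i ^ 2 * B j j - e i * e j * B i j - e i * e j * B j i) :=
    Finset.sum_nonneg fun i _ => Finset.sum_nonneg fun j _ => hq i j
  simp only [Finset.sum_sub_distrib, Finset.sum_add_distrib] at hsum
  have h1 : ∑ i, ∑ j, e j ^ 2 * B i i = ∑ i, B i i := by
    refine Finset.sum_congr rfl fun i _ => ?_
    rw [← Finset.sum_mul, hnorm, one_mul]
  have h2 : ∑ i, ∑ j, e i ^ 2 * B j j = ∑ i, B i i := by
    rw [Finset.sum_comm]; exact h1
  have h3 : ∑ i, ∑ j, e i * e j * B j i = ∑ i, ∑ j, e i * e j * B i j := by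
    rw [Finset.sum_comm]
    exact Finset.sum_congr rfl fun i _ => Finset.sum_congr rfl fun j _ => by ring
  rw [h1, h2, h3] at hsum
  rw [htr, inner_clm_eq_sum]
  linarith

theorem trace_opMat_id : (opMat (ContinuousLinearMap.id ℝ (ESp N))).trace = N := by
  simp [Matrix.trace, opMat]

theorem UniformlyElliptic.ellipticOp {a A : ℝ} {Ftil : Matrix (Fin N) (Fin N) ℝ → ℝ}
    (ha : 0 < a) (hF : UniformlyElliptic N a A Ftil) :
    EllipticOp a (A * N) (fun X => Ftil (opMat X)) where
  homog t ht X := by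
    simp only [opMat_smul]
    exact hF.1 t ht _ (opMat_isSymm X)
  gain X Y c₁ c₃ e hc he hk hgain := by
    have key : ∀ Z W : ESp N →L[ℝ] ESp N, (∀ k, 0 ≤ ⟪W k, k⟫) →
        a * (opMat W).trace ≤ Ftil (opMat (Z + W)) - Ftil (opMat Z) ∧
        Ftil (opMat (Z + W)) - Ftil (opMat Z) ≤ A * (opMat W).trace := by
      intro Z W hW
      rw [opMat_add]
      exact hF.2 _ _ (opMat_isSymm Z) (opMat_isSymm W) (opMat_posSemidef hW)
    set I := ContinuousLinearMap.id ℝ (ESp N)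
    have hI : ∀ k : ESp N, ⟪(c₁ • I) k, k⟫ = c₁ * ‖k‖ ^ 2 := by
      intro k
      rw [show (c₁ • I) k = c₁ • k from rfl, real_inner_smul_left, real_inner_self_eq_norm_sq]
    have hW : ∀ k, 0 ≤ ⟪(Y - X + c₁ • I) k, k⟫ := by
      intro k
      rw [add_apply (Y - X), inner_add_left, hI]
      have := hk k
      simp only [sub_apply, inner_sub_left]
      linarith
    have h1 := (key X _ hW).1
    have h2 := (key Y (c₁ • I) (fun k => by rw [hI]; positivity)).2
    have h3 := inner_le_trace_opMat hW he
    have h4 : X + (Y - X + c₁ • I) = Y + c₁ • I := by abel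
    rw [h4] at h1
    rw [opMat_smul, Matrix.trace_smul, trace_opMat_id, smul_eq_mul] at h2
    rw [add_apply (Y - X), inner_add_left, hI, he, sub_apply, inner_sub_left] at h3
    have h5 : a * (c₃ + c₁) ≤ a * (opMat (Y - X + c₁ • I)).trace := by
      refine mul_le_mul_of_nonneg_left ?_ ha.le
      linarith
    have h6 : 0 ≤ a * c₁ := by positivity
    show a * c₃ - A * N * c₁ ≤ Ftil (opMat Y) - Ftil (opMat X)
    nlinarith

end Elliptic

section ViscosityJets
variable {N : ℕ}

/-- The quadratic test function with prescribed gradient and second derivative at `x`. -/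
def quadTest (x p : ESp N) (Z : ESp N →L[ℝ] ESp N) (y : ESp N) : ℝ :=
  ⟪p, y - x⟫ + 1 / 2 * ⟪Z (y - x), y - x⟫

theorem contDiff_quadTest (x p : ESp N) (Z : ESp N →L[ℝ] ESp N) :
    ContDiff ℝ 2 (quadTest x p Z) := by
  unfold quadTest
  refine ContDiff.add ?_ (contDiff_const.mul ?_)
  · exact contDiff_const.inner ℝ (contDiff_id.sub contDiff_const)
  · exact ((Z.contDiff.comp (contDiff_id.sub contDiff_const))).inner ℝ
      (contDiff_id.sub contDiff_const)

theorem hasFDerivAt_quadTest (x p : ESp N) (Z : ESp N →L[ℝ] ESp N) (y : ESp N) :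
    HasFDerivAt (quadTest x p Z)
      (innerSL ℝ p + (1 / 2 : ℝ) • (innerSL ℝ (Z (y - x)) + (innerSL ℝ (y - x)) ∘L Z)) y := by
  unfold quadTest
  have h0 : HasFDerivAt (fun y : ESp N => y - x) (ContinuousLinearMap.id ℝ _) y :=
    (hasFDerivAt_id y).sub_const x
  have h1 : HasFDerivAt (fun y : ESp N => Z (y - x)) (Z ∘L ContinuousLinearMap.id ℝ _) y :=
    Z.hasFDerivAt.comp y h0
  have h2 : HasFDerivAt (fun y : ESp N => ⟪p, y - x⟫)
      (innerSL ℝ p ∘L ContinuousLinearMap.id ℝ _) y :=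
    (innerSL ℝ p).hasFDerivAt.comp y h0
  refine (h2.add ((h1.inner ℝ h0).const_mul (1/2 : ℝ))).congr_fderiv ?_
  ext w
  simp [fderivInnerCLM_apply, real_inner_comm, inner_sub_left, inner_sub_right]
  ring

theorem gradient_quadTest (x p : ESp N) (Z : ESp N →L[ℝ] ESp N) :
    gradient (quadTest x p Z) x = p := by
  apply HasGradientAt.gradient
  rw [hasGradientAt_iff_hasFDerivAt]
  refine (hasFDerivAt_quadTest x p Z x).congr_fderiv ?_
  ext w
  simp

theorem hessianMatrix_quadTest (x p : ESp N) (Z : ESp N →L[ℝ] ESp N) :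
    hessianMatrix (quadTest x p Z) x = opMat Z := by
  ext i j
  simp only [hessianMatrix, opMat, Matrix.of_apply]
  have h : (fun y => fderiv ℝ (quadTest x p Z) y (EuclideanSpace.single j (1 : ℝ))) =
      fun y => ⟪p, EuclideanSpace.single j 1⟫ + 1 / 2 *
        (⟪Z (y - x), EuclideanSpace.single j 1⟫ + ⟪y - x, Z (EuclideanSpace.single j 1)⟫) := by
    funext y
    rw [(hasFDerivAt_quadTest x p Z y).fderiv]
    simp [inner_sub_left]
    ring
  rw [h]
  have h0 : HasFDerivAt (fun y : ESp N => y - x) (ContinuousLinearMap.id ℝ _) x :=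
    (hasFDerivAt_id x).sub_const x
  have h1 : HasFDerivAt (fun y : ESp N => Z (y - x)) (Z ∘L ContinuousLinearMap.id ℝ _) x :=
    Z.hasFDerivAt.comp x h0
  have h2 := ((h1.inner ℝ (hasFDerivAt_const (EuclideanSpace.single j (1:ℝ)) x)).add
    (h0.inner ℝ (hasFDerivAt_const (Z (EuclideanSpace.single j (1:ℝ))) x))).const_mul (1/2 : ℝ)
  have h3 := h2.const_add ⟪p, EuclideanSpace.single j (1:ℝ)⟫
  refine (congrArg (fun T : ESp N →L[ℝ] ℝ => T (EuclideanSpace.single i (1:ℝ))) h3.fderiv).trans ?_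
  simp [fderivInnerCLM_apply, real_inner_comm]
  ring

theorem SuperJet.isLocalMax {v : ESp N → ℝ} {x p : ESp N} {X : ESp N →L[ℝ] ESp N}
    (h : SuperJet v x p X) {η : ℝ} (hη : 0 < η) :
    IsLocalMax (fun y => v y - quadTest x p (X + (2 * η) • ContinuousLinearMap.id ℝ _) y) x := by
  have h1 := h η hη
  have h2 : Tendsto (fun y => y - x) (𝓝 x) (𝓝 0) := by
    have : Continuous fun y : ESp N => y - x := by fun_prop
    simpa using this.tendsto x
  filter_upwards [h2.eventually h1] with y hy
  rw [add_sub_cancel] at hy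
  simp only [quadTest, sub_self, inner_zero_right, map_zero]
  rw [add_apply X, inner_add_left, smul_apply, real_inner_smul_left]
  simp only [ContinuousLinearMap.id_apply, real_inner_self_eq_norm_sq]
  linarith

theorem SubJet.neg {v : ESp N → ℝ} {x p : ESp N} {X : ESp N →L[ℝ] ESp N}
    (h : SubJet v x p X) : SuperJet (fun y => -v y) x (-p) (-X) := by
  rw [superJet_neg]; simpa using h

theorem SubJet.isLocalMin {v : ESp N → ℝ} {x p : ESp N} {X : ESp N →L[ℝ] ESp N}
    (h : SubJet v x p X) {η : ℝ} (hη : 0 < η) :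
    IsLocalMin (fun y => v y - quadTest x p (X + (-(2 * η)) • ContinuousLinearMap.id ℝ _) y) x := by
  have h1 := h.neg.isLocalMax hη
  filter_upwards [h1] with y hy
  simp only [quadTest, add_apply, inner_add_left, smul_apply, real_inner_smul_left, neg_apply,
    inner_neg_left] at hy ⊢
  linarith

theorem SuperJet.eq_zero_of_const {v : ESp N → ℝ} {x p : ESp N} {X : ESp N →L[ℝ] ESp N}
    (h : SuperJet v x p X) {c : ℝ} (hc : ∀ᶠ y in 𝓝 x, v y = c) : p = 0 := by
  have h1 := h.isLocalMax one_pos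
  set Z := X + (2 * (1:ℝ)) • ContinuousLinearMap.id ℝ (ESp N)
  have h2 : IsLocalMin (quadTest x p Z) x := by
    filter_upwards [h1, hc] with y hy hy'
    have := hc.self_of_nhds
    linarith
  have h3 := h2.fderiv_eq_zero
  rw [← gradient_quadTest x p Z, gradient, h3, map_zero]

theorem SubJet.eq_zero_of_const {v : ESp N → ℝ} {x p : ESp N} {X : ESp N →L[ℝ] ESp N}
    (h : SubJet v x p X) {c : ℝ} (hc : ∀ᶠ y in 𝓝 x, v y = c) : p = 0 := by
  have := h.neg.eq_zero_of_const (c := -c) (hc.mono fun y hy => by simp [hy])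
  simpa using this

theorem GradGE.le_of_superJet {m : ℝ} {Ω : Set (ESp N)} {v : ESp N → ℝ} (hv : GradGE m Ω v)
    {x p : ESp N} (hx : x ∈ Ω) {X : ESp N →L[ℝ] ESp N} (h : SuperJet v x p X) : m ≤ ‖p‖ := by
  have := hv _ (contDiff_quadTest x p _) x hx (Or.inr (h.isLocalMax one_pos))
  rwa [gradient_quadTest] at this

theorem GradGE.le_of_subJet {m : ℝ} {Ω : Set (ESp N)} {v : ESp N → ℝ} (hv : GradGE m Ω v)
    {x p : ESp N} (hx : x ∈ Ω) {X : ESp N →L[ℝ] ESp N} (h : SubJet v x p X) : m ≤ ‖p‖ := by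
  have := hv _ (contDiff_quadTest x p _) x hx (Or.inl (h.isLocalMin one_pos))
  rwa [gradient_quadTest] at this

theorem EllipticOp.add_id_le {E : Type*} [NormedAddCommGroup E] [InnerProductSpace ℝ E] {a A : ℝ}
    {G : (E →L[ℝ] E) → ℝ} (hG : EllipticOp a A G) (X : E →L[ℝ] E) {e : E} (he : ‖e‖ = 1)
    {η : ℝ} (hη : 0 ≤ η) :
    G (X + η • ContinuousLinearMap.id ℝ E) ≤ G X + (a + A) * η ∧
    G X - (a + A) * η ≤ G (X + (-η) • ContinuousLinearMap.id ℝ E) := by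
  have hI : ∀ (c : ℝ) (k : E), ⟪(X + c • ContinuousLinearMap.id ℝ E) k, k⟫ =
      ⟪X k, k⟫ + c * ‖k‖ ^ 2 := by
    intro c k
    rw [add_apply X, inner_add_left, smul_apply, real_inner_smul_left]
    simp
  constructor
  · have := hG.gain (X + η • ContinuousLinearMap.id ℝ E) X η (-η) e hη he
      (fun k => by rw [hI]; linarith) (by rw [hI, he]; linarith)
    linarith
  · have := hG.gain X (X + (-η) • ContinuousLinearMap.id ℝ E) η (-η) e hη he
      (fun k => by rw [hI]; linarith) (by rw [hI, he]; linarith)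
    linarith

end ViscosityJets

section Contact
variable {E : Type*} [NormedAddCommGroup E] [InnerProductSpace ℝ E]

/-- Structure condition for an operator `𝒢 s p X`: quantitative ellipticity in `X` and Lipschitz
dependence on `(s, p)`, as long as the gradient variable satisfies `Q`. -/
def StructCond (a A L : ℝ) (Q : E → Prop) (𝒢 : ℝ → E → (E →L[ℝ] E) → ℝ) : Prop :=
  ∀ (s s' : ℝ) (p p' : E) (X Y : E →L[ℝ] E) (c₁ c₃ : ℝ) (e : E), Q p → Q p' → 0 ≤ c₁ → ‖e‖ = 1 →
    (∀ k, ⟪X k, k⟫ - c₁ * ‖k‖ ^ 2 ≤ ⟪Y k, k⟫) → ⟪X e, e⟫ + c₃ ≤ ⟪Y e, e⟫ →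
    a * c₃ - A * c₁ - L * (|s - s'| + ‖p - p'‖) ≤ 𝒢 s' p' Y - 𝒢 s p X

/-- Structure condition as in `StructCond`, with a general modulus `ω` in the variable `s`. -/
def StructCondMod (a A L : ℝ) (ω : ℝ → ℝ → ℝ) (Q : E → Prop)
    (𝒢 : ℝ → E → (E →L[ℝ] E) → ℝ) : Prop :=
  ∀ (s s' : ℝ) (p p' : E) (X Y : E →L[ℝ] E) (c₁ c₃ : ℝ) (e : E), Q p → Q p' → 0 ≤ c₁ → ‖e‖ = 1 →
    (∀ k, ⟪X k, k⟫ - c₁ * ‖k‖ ^ 2 ≤ ⟪Y k, k⟫) → ⟪X e, e⟫ + c₃ ≤ ⟪Y e, e⟫ →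
    a * c₃ - A * c₁ - ω s s' - L * ‖p - p'‖ ≤ 𝒢 s' p' Y - 𝒢 s p X

/-- Jet formulation of viscosity solutions of `𝒢(v, ∇v, D²v) = 0` in `Ω`, tested only with
gradients satisfying `Q`. -/
def JetSol (Q : E → Prop) (𝒢 : ℝ → E → (E →L[ℝ] E) → ℝ) (Ω : Set E) (v : E → ℝ) : Prop :=
  ∀ x ∈ Ω, ∀ p X, Q p → (SuperJet v x p X → 0 ≤ 𝒢 (v x) p X) ∧ (SubJet v x p X → 𝒢 (v x) p X ≤ 0)

variable [FiniteDimensional ℝ E]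
local notation "E₂" => WithLp 2 (E × E)

theorem contact_estimate_mod {a A L : ℝ} {ω : ℝ → ℝ → ℝ}
    (hω : Continuous fun z : ℝ × ℝ => ω z.1 z.2) {Q : E → Prop} {𝒢 : ℝ → E → (E →L[ℝ] E) → ℝ}
    (hS : StructCondMod a A L ω Q 𝒢) (ha : 0 ≤ a) (hA : 0 ≤ A) (hL : 0 ≤ L)
    {v : E → ℝ} (hv : Continuous v) {Ω : Set E} (hΩ : IsOpen Ω) (hsol : JetSol Q 𝒢 Ω v)
    {x₀ y₀ P b : E} (hx₀ : x₀ ∈ Ω) (hy₀ : y₀ ∈ Ω) {Ψ D : E →L[ℝ] E}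
    (h : ∀ η > 0, ∀ᶠ ζ in 𝓝 (0:E₂), v y₀ - v x₀ + ⟪P, ζ.snd - ζ.fst⟫
      + 1 / 2 * ⟪Ψ (ζ.snd - ζ.fst), ζ.snd - ζ.fst⟫
      + ⟪b, ζ.fst⟫ + 1 / 2 * ⟪D ζ.fst, ζ.fst⟫ - η * ‖ζ‖ ^ 2 ≤ v (y₀ + ζ.snd) - v (x₀ + ζ.fst))
    {r : ℝ} (hr : 0 < r)
    (hQx : ∀ x p X, ‖x - x₀‖ ≤ r → ‖p - (P - b)‖ ≤ r → SuperJet v x p X → Q p)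
    (hQy : ∀ x p X, ‖x - y₀‖ ≤ r → ‖p - P‖ ≤ r → SubJet v x p X → Q p)
    {c₁ c₃ : ℝ} (hc₁ : 0 ≤ c₁) (hD : ∀ k, -(c₁ * ‖k‖ ^ 2) ≤ ⟪D k, k⟫) {e : E} (he : ‖e‖ = 1)
    (hgain : c₃ ≤ ⟪D e, e⟫ ∨ c₃ ≤ 4 * ⟪Ψ e, e⟫ + ⟪D e, e⟫) :
    a * c₃ ≤ A * c₁ + ω (v x₀) (v y₀) + L * ‖b‖ := by
  refine le_of_forall_pos_le_add fun θ hθ => ?_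
  set K := 2 * a + 2 * A + 4 * L + 1 with hK
  have hK0 : 0 < K := by positivity
  set η := θ / K with hη
  have hη0 : 0 < η := by positivity
  obtain ⟨r₁, hr₁, hball₁⟩ := Metric.isOpen_iff.1 hΩ x₀ hx₀
  obtain ⟨r₂, hr₂, hball₂⟩ := Metric.isOpen_iff.1 hΩ y₀ hy₀
  have hωv : Continuous fun z : E × E => ω (v z.1) (v z.2) :=
    hω.comp ((hv.comp continuous_fst).prodMk (hv.comp continuous_snd))
  obtain ⟨r₃, hr₃, hc₃'⟩ := Metric.continuousAt_iff.1 (hωv.continuousAt (x := (x₀, y₀))) η hη0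
  obtain ⟨ε, hε, hεr, hεη, hε1, hε2, hε3⟩ : ∃ ε > 0, ε ≤ r ∧ ε ≤ η ∧ ε < r₁ ∧ ε < r₂ ∧
      ε < r₃ := by
    refine ⟨min (min r η) (min (min (r₁/2) (r₂/2)) (r₃/2)), by positivity, ?_, ?_, ?_, ?_, ?_⟩
    · exact (min_le_left _ _).trans (min_le_left _ _)
    · exact (min_le_left _ _).trans (min_le_right _ _)
    · exact ((min_le_right _ _).trans ((min_le_left _ _).trans (min_le_left _ _))).trans_lt
        (half_lt_self hr₁)
    · exact ((min_le_right _ _).trans ((min_le_left _ _).trans (min_le_right _ _))).trans_lt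
        (half_lt_self hr₂)
    · exact ((min_le_right _ _).trans (min_le_right _ _)).trans_lt (half_lt_self hr₃)
  obtain ⟨x, y, p, q, X, Y, hx, hy, hp, hq, hX, hY, hXY⟩ := exists_jets_of_contact hv h hε
  have hQp : Q p := hQx x p X (hx.trans hεr) (hp.trans hεr) hX
  have hQq : Q q := hQy y q Y (hy.trans hεr) (hq.trans hεr) hY
  have hxΩ : x ∈ Ω := hball₁ (by rw [mem_ball, dist_eq_norm]; linarith)
  have hyΩ : y ∈ Ω := hball₂ (by rw [mem_ball, dist_eq_norm]; linarith)
  have hvxy : ω (v x) (v y) < ω (v x₀) (v y₀) + η := by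
    have := hc₃' (x := (x, y)) (by
      rw [Prod.dist_eq, dist_eq_norm, dist_eq_norm]
      exact max_lt (by linarith) (by linarith))
    rw [Real.dist_eq] at this
    linarith [(abs_lt.1 this).2]
  have h1 := (hsol x hxΩ p X hQp).1 hX
  have h2 := (hsol y hyΩ q Y hQq).2 hY
  have h3 := hS (v x) (v y) p q X Y (c₁ + 2 * ε) (c₃ - 2 * ε) e hQp hQq (by positivity) he
    (fun k => by
      have h4 := hXY k k
      have h5 := hD k
      simp only [sub_self, map_zero, inner_zero_left] at h4
      linarith)
    (by
      rcases hgain with hg | hg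
      · have h4 := hXY e e
        simp only [sub_self, map_zero, inner_zero_left, he] at h4
        linarith
      · have h4 := hXY e (-e)
        have h5 : e - -e = (2:ℝ) • e := by rw [two_smul]; abel
        simp only [h5, map_smul, map_neg, inner_neg_neg, real_inner_smul_left,
          real_inner_smul_right, norm_neg, he] at h4
        linarith)
  have h5 : ‖p - q‖ ≤ ‖b‖ + 2 * ε := by
    have : p - q = (p - (P - b)) - (q - P) + -b := by abel
    rw [this]
    refine (norm_add_le _ _).trans ?_
    rw [norm_neg]
    have := norm_sub_le (p - (P - b)) (q - P)
    linarith
  have h6 : L * ‖p - q‖ ≤ L * (‖b‖ + 2 * η) := mul_le_mul_of_nonneg_left (by linarith) hL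
  have h7 : a * ε ≤ a * η := mul_le_mul_of_nonneg_left hεη ha
  have h8 : A * ε ≤ A * η := mul_le_mul_of_nonneg_left hεη hA
  have h9 : K * η = θ := by rw [hη]; field_simp
  rw [hK] at h9
  have h10 : 0 ≤ a * η := by positivity
  have h11 : 0 ≤ A * η := by positivity
  have h12 : 0 ≤ L * η := by positivity
  linarith

theorem contact_estimate {a A L : ℝ} {Q : E → Prop} {𝒢 : ℝ → E → (E →L[ℝ] E) → ℝ}
    (hS : StructCond a A L Q 𝒢) (ha : 0 ≤ a) (hA : 0 ≤ A) (hL : 0 ≤ L)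
    {v : E → ℝ} (hv : Continuous v) {Ω : Set E} (hΩ : IsOpen Ω) (hsol : JetSol Q 𝒢 Ω v)
    {x₀ y₀ P b : E} (hx₀ : x₀ ∈ Ω) (hy₀ : y₀ ∈ Ω) {Ψ D : E →L[ℝ] E}
    (h : ∀ η > 0, ∀ᶠ ζ in 𝓝 (0:E₂), v y₀ - v x₀ + ⟪P, ζ.snd - ζ.fst⟫
      + 1 / 2 * ⟪Ψ (ζ.snd - ζ.fst), ζ.snd - ζ.fst⟫
      + ⟪b, ζ.fst⟫ + 1 / 2 * ⟪D ζ.fst, ζ.fst⟫ - η * ‖ζ‖ ^ 2 ≤ v (y₀ + ζ.snd) - v (x₀ + ζ.fst))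
    {r : ℝ} (hr : 0 < r)
    (hQx : ∀ x p X, ‖x - x₀‖ ≤ r → ‖p - (P - b)‖ ≤ r → SuperJet v x p X → Q p)
    (hQy : ∀ x p X, ‖x - y₀‖ ≤ r → ‖p - P‖ ≤ r → SubJet v x p X → Q p)
    {c₁ c₃ : ℝ} (hc₁ : 0 ≤ c₁) (hD : ∀ k, -(c₁ * ‖k‖ ^ 2) ≤ ⟪D k, k⟫) {e : E} (he : ‖e‖ = 1)
    (hgain : c₃ ≤ ⟪D e, e⟫ ∨ c₃ ≤ 4 * ⟪Ψ e, e⟫ + ⟪D e, e⟫) :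
    a * c₃ ≤ A * c₁ + L * (|v y₀ - v x₀| + ‖b‖) := by
  have h1 := contact_estimate_mod (ω := fun s s' => L * |s - s'|) (L := L) (by fun_prop)
    (fun s s' p p' X Y c₁ c₃ e hp hp' hc he hk hke => by
      have := hS s s' p p' X Y c₁ c₃ e hp hp' hc he hk hke
      linarith) ha hA hL hv hΩ hsol hx₀ hy₀ h hr hQx hQy hc₁ hD he hgain
  rw [abs_sub_comm] at h1
  linarith

end Contact

section JetCalculus
variable {E : Type*} [NormedAddCommGroup E] [InnerProductSpace ℝ E]

/-- One-dimensional second order lower Taylor expansion in Peano form. -/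
def LowerPeano (χ : ℝ → ℝ) (s c₁ c₂ : ℝ) : Prop :=
  ∀ η > (0:ℝ), ∀ᶠ τ in 𝓝 (0:ℝ), χ s + c₁ * τ + c₂ / 2 * τ ^ 2 - η * τ ^ 2 ≤ χ (s + τ)

/-- The rank one endomorphism `k ↦ ⟪p, k⟫ p`. -/
def rankOneSelf (p : E) : E →L[ℝ] E := (innerSL ℝ p).smulRight p

@[simp] theorem inner_rankOneSelf (p k : E) : ⟪rankOneSelf p k, k⟫ = ⟪p, k⟫ ^ 2 := by
  simp [rankOneSelf, real_inner_smul_left, sq]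

theorem inner_smul_clm (c : ℝ) (X : E →L[ℝ] E) (k l : E) : ⟪(c • X) k, l⟫ = c * ⟪X k, l⟫ :=
  real_inner_smul_left _ _ _

theorem inner_add_clm (X Y : E →L[ℝ] E) (k l : E) : ⟪(X + Y) k, l⟫ = ⟪X k, l⟫ + ⟪Y k, l⟫ :=
  inner_add_left _ _ _

theorem SubJet.of_le {v : E → ℝ} {x p : E} {X : E →L[ℝ] E}
    (h : ∀ᶠ d in 𝓝 (0:E), v x + ⟪p, d⟫ + 1 / 2 * ⟪X d, d⟫ ≤ v (x + d)) : SubJet v x p X := by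
  intro η hη
  filter_upwards [h] with d hd
  have : 0 ≤ η * ‖d‖ ^ 2 := by positivity
  linarith

theorem SubJet.add {v w : E → ℝ} {x p q : E} {X Y : E →L[ℝ] E} (hv : SubJet v x p X)
    (hw : SubJet w x q Y) : SubJet (fun y => v y + w y) x (p + q) (X + Y) := by
  intro η hη
  filter_upwards [hv (η / 2) (by positivity), hw (η / 2) (by positivity)] with d h1 h2
  rw [inner_add_clm, inner_add_left]
  linarith

theorem SubJet.const_add {v : E → ℝ} {x p : E} {X : E →L[ℝ] E} (hv : SubJet v x p X) (c : ℝ) :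
    SubJet (fun y => c + v y) x p X := by
  intro η hη
  filter_upwards [hv η hη] with d h1
  linarith

theorem SubJet.const_mul {v : E → ℝ} {x p : E} {X : E →L[ℝ] E} (hv : SubJet v x p X) {c : ℝ}
    (hc : 0 ≤ c) : SubJet (fun y => c * v y) x (c • p) (c • X) := by
  intro η hη
  filter_upwards [hv (η / (c + 1)) (by positivity)] with d h1
  have h2 := mul_le_mul_of_nonneg_left h1 hc
  rw [inner_smul_clm, real_inner_smul_left]
  have h3 : c * (η / (c + 1)) ≤ η := by
    rw [mul_div_assoc', div_le_iff₀ (by positivity)]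
    nlinarith
  have h4 := mul_le_mul_of_nonneg_right h3 (sq_nonneg ‖d‖)
  linarith

theorem SubJet.mono_left {v w : E → ℝ} {x p : E} {X : E →L[ℝ] E} (hv : SubJet v x p X)
    (h0 : w x = v x) (h : ∀ᶠ y in 𝓝 x, v y ≤ w y) : SubJet w x p X := by
  intro η hη
  have h2 : Tendsto (fun d : E => x + d) (𝓝 0) (𝓝 x) := by
    have : Continuous fun y : E => x + y := by fun_prop
    simpa using this.tendsto 0
  filter_upwards [hv η hη, h2.eventually h] with d h1 h3
  linarith

theorem abs_half_mul_sq_sub_sq_le {c₂ B T n τ P η : ℝ} (hB : 0 ≤ B) (hη : 0 ≤ η)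
    (hdiff : |τ - P| ≤ B * n ^ 2) (hsum : |τ + P| ≤ 2 * T * n)
    (hsmall : |c₂| * B * (2 * T) * n ≤ η / 4) :
    |c₂ / 2 * (τ ^ 2 - P ^ 2)| ≤ η / 4 * n ^ 2 := by
  have e1 : τ ^ 2 - P ^ 2 = (τ - P) * (τ + P) := by ring
  rw [e1, abs_mul, abs_mul, abs_div, abs_of_pos (two_pos : (0:ℝ) < 2)]
  calc |c₂| / 2 * (|τ - P| * |τ + P|)
      ≤ |c₂| / 2 * (B * n ^ 2 * (2 * T * n)) := by gcongr
    _ = (|c₂| * B * (2 * T) * n) * n ^ 2 / 2 := by ring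
    _ ≤ (η / 4) * n ^ 2 / 2 := by gcongr
    _ ≤ η / 4 * n ^ 2 := half_le_self (by positivity)

set_option maxHeartbeats 800000 in
theorem SubJet.comp {g : E → ℝ} {x p : E} {X : E →L[ℝ] E} (hg : SubJet g x p X)
    (hgc : ContinuousAt g x) {χ : ℝ → ℝ} {U : Set ℝ} (hU : U ∈ 𝓝 (g x)) (hmono : MonotoneOn χ U)
    {c₁ c₂ : ℝ} (hc₁ : 0 ≤ c₁) (hχ : LowerPeano χ (g x) c₁ c₂) :
    SubJet (fun y => χ (g y)) x (c₁ • p) (c₁ • X + c₂ • rankOneSelf p) := by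
  intro η hη
  set η₁ := η / (4 * (c₁ + 1)) with hη₁
  have hη₁0 : 0 < η₁ := by positivity
  set B := 1 / 2 * ‖X‖ + η₁ with hB
  have hB0 : 0 < B := by positivity
  set T := ‖p‖ + B with hT
  have hT0 : 0 < T := by positivity
  set η₂ := η / (4 * (T ^ 2 + 1)) with hη₂
  have hη₂0 : 0 < η₂ := by positivity
  set τ : E → ℝ := fun d => ⟪p, d⟫ + 1 / 2 * ⟪X d, d⟫ - η₁ * ‖d‖ ^ 2 with hτ
  have hτc : Tendsto τ (𝓝 0) (𝓝 0) := by
    have : Continuous τ := by fun_prop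
    simpa [hτ] using this.tendsto 0
  have hshift : Tendsto (fun d : E => x + d) (𝓝 0) (𝓝 x) := by
    have : Continuous fun y : E => x + y := by fun_prop
    simpa using this.tendsto 0
  have hτU : ∀ᶠ d in 𝓝 (0:E), g x + τ d ∈ U := by
    have : Tendsto (fun d => g x + τ d) (𝓝 0) (𝓝 (g x)) := by
      simpa using hτc.const_add (g x)
    exact this hU
  set ρ := min 1 (η / (4 * (|c₂| * B * (2 * T) + 1))) with hρ
  have hρ0 : 0 < ρ := by positivity
  filter_upwards [hg η₁ hη₁0, hτc.eventually (hχ η₂ hη₂0), hτU, (hgc.tendsto.comp hshift) hU,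
    Metric.ball_mem_nhds (0:E) hρ0] with d h1 h2 h3 h4 h5
  rw [mem_ball_zero_iff] at h5
  have hd1 : ‖d‖ ≤ 1 := (h5.trans_le (min_le_left _ _)).le
  have h6 : χ (g x + τ d) ≤ χ (g (x + d)) := hmono h3 h4 (by simp only [hτ]; linarith)
  have hXd : |⟪X d, d⟫| ≤ ‖X‖ * ‖d‖ ^ 2 := by
    refine (abs_real_inner_le_norm _ _).trans ?_
    have := mul_le_mul_of_nonneg_right (X.le_opNorm d) (norm_nonneg d)
    rwa [mul_assoc, ← sq] at this
  have hpd : |⟪p, d⟫| ≤ ‖p‖ * ‖d‖ := abs_real_inner_le_norm _ _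
  have hdd : ‖d‖ ^ 2 ≤ ‖d‖ := by nlinarith [norm_nonneg d]
  have hdiff : |τ d - ⟪p, d⟫| ≤ B * ‖d‖ ^ 2 := by
    have e1 : τ d - ⟪p, d⟫ = 1 / 2 * ⟪X d, d⟫ - η₁ * ‖d‖ ^ 2 := by simp only [hτ]; ring
    rw [e1, abs_le]
    rw [abs_le] at hXd
    have : 0 ≤ η₁ * ‖d‖ ^ 2 := by positivity
    constructor <;> rw [hB] <;> linarith
  have hτabs : |τ d| ≤ T * ‖d‖ := by
    have e1 : |τ d| ≤ |τ d - ⟪p, d⟫| + |⟪p, d⟫| := by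
      have := abs_add_le (τ d - ⟪p, d⟫) ⟪p, d⟫
      rwa [sub_add_cancel] at this
    have := mul_le_mul_of_nonneg_left hdd hB0.le
    rw [hT]; linarith
  have hsum : |τ d + ⟪p, d⟫| ≤ 2 * T * ‖d‖ := by
    refine (abs_add_le _ _).trans ?_
    have : ‖p‖ * ‖d‖ ≤ T * ‖d‖ := mul_le_mul_of_nonneg_right (by rw [hT]; linarith) (norm_nonneg _)
    linarith
  have hsq : |c₂ / 2 * (τ d ^ 2 - ⟪p, d⟫ ^ 2)| ≤ η / 4 * ‖d‖ ^ 2 := by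
    refine abs_half_mul_sq_sub_sq_le hB0.le hη.le hdiff hsum ?_
    have e4 : ‖d‖ ≤ η / (4 * (|c₂| * B * (2 * T) + 1)) := (h5.trans_le (min_le_right _ _)).le
    rw [le_div_iff₀ (by positivity)] at e4
    have e5 := norm_nonneg d
    linarith
  have hη2 : η₂ * τ d ^ 2 ≤ η / 4 * ‖d‖ ^ 2 := by
    have e1 : τ d ^ 2 ≤ T ^ 2 * ‖d‖ ^ 2 := by
      rw [← mul_pow, ← sq_abs]
      exact pow_le_pow_left₀ (abs_nonneg _) hτabs 2
    have e2 : η₂ * T ^ 2 ≤ η / 4 := by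
      rw [hη₂, div_mul_eq_mul_div, div_le_iff₀ (by positivity)]
      nlinarith [sq_nonneg T]
    calc η₂ * τ d ^ 2 ≤ η₂ * (T ^ 2 * ‖d‖ ^ 2) := by gcongr
      _ = (η₂ * T ^ 2) * ‖d‖ ^ 2 := by ring
      _ ≤ _ := by gcongr
  have hη1 : c₁ * (η₁ * ‖d‖ ^ 2) ≤ η / 4 * ‖d‖ ^ 2 := by
    have e2 : c₁ * η₁ ≤ η / 4 := by
      rw [hη₁, mul_div_assoc', div_le_iff₀ (by positivity)]
      nlinarith
    rw [← mul_assoc]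
    exact mul_le_mul_of_nonneg_right e2 (sq_nonneg _)
  have hform : ⟪(c₁ • X + c₂ • rankOneSelf p) d, d⟫ = c₁ * ⟪X d, d⟫ + c₂ * ⟪p, d⟫ ^ 2 := by
    rw [inner_add_clm, inner_smul_clm, inner_smul_clm, inner_rankOneSelf]
  rw [hform, real_inner_smul_left]
  rw [abs_le] at hsq
  have hc1τ : c₁ * τ d = c₁ * ⟪p, d⟫ + 1 / 2 * (c₁ * ⟪X d, d⟫) - c₁ * (η₁ * ‖d‖ ^ 2) := by
    simp only [hτ]; ring
  have hpos : 0 ≤ η * ‖d‖ ^ 2 := by positivity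
  linarith [hsq.1]

theorem SubJet.superJet_neg {v : E → ℝ} {x p : E} {X : E →L[ℝ] E} (h : SubJet v x p X) :
    SuperJet (fun y => -v y) x (-p) (-X) := by
  rw [_root_.superJet_neg]; simpa using h

theorem SuperJet.subJet_neg {v : E → ℝ} {x p : E} {X : E →L[ℝ] E} (h : SuperJet v x p X) :
    SubJet (fun y => -v y) x (-p) (-X) := by
  rw [← _root_.superJet_neg]; simpa using h

theorem lowerPeano_of_deriv {χ χ' : ℝ → ℝ} {s c₂ : ℝ}
    (h1 : ∀ᶠ t in 𝓝 s, HasDerivAt χ (χ' t) t) (h2 : HasDerivAt χ' c₂ s) :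
    LowerPeano χ s (χ' s) c₂ := by
  intro η hη
  have h3 : ∀ᶠ t in 𝓝 s, |χ' t - χ' s - (t - s) * c₂| ≤ η * |t - s| := by
    have := (hasDerivAt_iff_isLittleO.1 h2).def hη
    simpa [Real.norm_eq_abs] using this
  obtain ⟨r, hr, hball⟩ := Metric.eventually_nhds_iff_ball.1 (h1.and h3)
  rw [Metric.eventually_nhds_iff_ball]
  refine ⟨r, hr, fun τ hτ => ?_⟩
  rw [mem_ball_zero_iff, Real.norm_eq_abs] at hτ
  set D : ℝ → ℝ := fun t => χ t - χ' s * (t - s) - c₂ / 2 * (t - s) ^ 2 with hD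
  have hDd : ∀ t ∈ ball s r, HasDerivAt D (χ' t - χ' s - (t - s) * c₂) t := by
    intro t ht
    have e1 := (hball t ht).1
    have e2 : HasDerivAt (fun t => t - s) 1 t := (hasDerivAt_id t).sub_const s
    have := (e1.sub (e2.const_mul (χ' s))).sub ((e2.pow 2).const_mul (c₂ / 2))
    refine this.congr_deriv ?_
    simp only [mul_one, Nat.cast_ofNat, Nat.add_one_sub_one, pow_one]
    ring
  have hbound : ∀ t ∈ closedBall s |τ|, ‖deriv D t‖ ≤ η * |τ| := by
    intro t ht
    rw [mem_closedBall, Real.dist_eq] at ht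
    have htr : t ∈ ball s r := by rw [mem_ball, Real.dist_eq]; linarith
    rw [(hDd t htr).deriv, Real.norm_eq_abs]
    exact (hball t htr).2.trans (by gcongr)
  have hdiff : ∀ t ∈ closedBall s |τ|, DifferentiableAt ℝ D t := by
    intro t ht
    rw [mem_closedBall, Real.dist_eq] at ht
    exact (hDd t (by rw [mem_ball, Real.dist_eq]; linarith)).differentiableAt
  have h4 := (convex_closedBall s |τ|).norm_image_sub_le_of_norm_deriv_le hdiff hbound
    (mem_closedBall_self (abs_nonneg _)) (show s + τ ∈ closedBall s |τ| by simp)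
  simp only [hD, add_sub_cancel_left, sub_self, Real.norm_eq_abs] at h4
  have h5 : η * |τ| * |τ| = η * τ ^ 2 := by rw [mul_assoc, ← sq, sq_abs]
  rw [h5, abs_le] at h4
  linarith [h4.1]

theorem subJet_neg_normSq (c x : E) :
    SubJet (fun y => -‖y - c‖ ^ 2) x (-(2:ℝ) • (x - c)) (-(2:ℝ) • ContinuousLinearMap.id ℝ E) := by
  refine SubJet.of_le (Eventually.of_forall fun d => ?_)
  have : x + d - c = (x - c) + d := by abel
  rw [this, norm_add_sq_real]
  simp [real_inner_smul_left]

/-- The smooth substitute `√(1+‖x‖²)` for the norm. -/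
def smoothNorm (x : E) : ℝ := √(1 + ‖x‖ ^ 2)

theorem one_le_smoothNorm (x : E) : 1 ≤ smoothNorm x := by
  rw [smoothNorm, Real.one_le_sqrt]; nlinarith [sq_nonneg ‖x‖]

theorem norm_le_smoothNorm (x : E) : ‖x‖ ≤ smoothNorm x := by
  rw [smoothNorm]; exact Real.le_sqrt_of_sq_le (by linarith)

theorem continuous_smoothNorm : Continuous (smoothNorm : E → ℝ) := by
  unfold smoothNorm; fun_prop

theorem exists_subJet_neg_smoothNorm (x : E) : ∃ (b : E) (D : E →L[ℝ] E),
    SubJet (fun y => -smoothNorm y) x b D ∧ ‖b‖ ≤ 1 ∧ ∀ k, -‖k‖ ^ 2 ≤ ⟪D k, k⟫ := by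
  have h1 := one_le_smoothNorm x
  set S := smoothNorm x with hS
  have hS0 : 0 < S := by linarith
  have hS2 : S ^ 2 = 1 + ‖x‖ ^ 2 := by rw [hS, smoothNorm, Real.sq_sqrt (by positivity)]
  refine ⟨(-S⁻¹) • x, (-S⁻¹) • ContinuousLinearMap.id ℝ E, SubJet.of_le
    (Eventually.of_forall fun d => ?_), ?_, fun k => ?_⟩
  · have h2 : smoothNorm (x + d) ≤ S + S⁻¹ * ⟪x, d⟫ + 1 / 2 * (S⁻¹ * ‖d‖ ^ 2) := by
      have hT := one_le_smoothNorm (x + d)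
      have hT2 : smoothNorm (x + d) ^ 2 = 1 + ‖x + d‖ ^ 2 := by
        rw [smoothNorm, Real.sq_sqrt (by positivity)]
      rw [norm_add_sq_real] at hT2
      have : S * smoothNorm (x + d) ≤ S * (S + S⁻¹ * ⟪x, d⟫ + 1 / 2 * (S⁻¹ * ‖d‖ ^ 2)) := by
        have e : S * (S + S⁻¹ * ⟪x, d⟫ + 1 / 2 * (S⁻¹ * ‖d‖ ^ 2)) =
          S ^ 2 + ⟪x, d⟫ + 1 / 2 * ‖d‖ ^ 2 := by field_simp
        rw [e]
        nlinarith [sq_nonneg (S - smoothNorm (x + d))]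
      exact le_of_mul_le_mul_left this hS0
    rw [inner_smul_clm, real_inner_smul_left]
    simp only [ContinuousLinearMap.id_apply, real_inner_self_eq_norm_sq]
    linarith
  · rw [norm_smul, norm_neg, norm_inv, Real.norm_eq_abs, abs_of_pos hS0, inv_mul_le_iff₀ hS0,
      mul_one]
    exact norm_le_smoothNorm x
  · rw [inner_smul_clm]
    simp only [ContinuousLinearMap.id_apply, real_inner_self_eq_norm_sq]
    have : S⁻¹ ≤ 1 := inv_le_one_of_one_le₀ h1
    nlinarith [sq_nonneg ‖k‖]

variable [FiniteDimensional ℝ E]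
local notation "E₂" => WithLp 2 (E × E)

theorem contact_of_lower {v ψ β : E → ℝ} {x₀ y₀ P b : E} {Ψ D : E →L[ℝ] E}
    (hψ : SubJet ψ (y₀ - x₀) P Ψ) (hβ : SubJet β x₀ b D)
    (heq : ψ (y₀ - x₀) + β x₀ = v y₀ - v x₀)
    (hmin : ∀ᶠ z : E × E in 𝓝 (x₀, y₀), ψ (z.2 - z.1) + β z.1 ≤ v z.2 - v z.1) :
    ∀ η > 0, ∀ᶠ ζ in 𝓝 (0:E₂), v y₀ - v x₀ + ⟪P, ζ.snd - ζ.fst⟫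
      + 1 / 2 * ⟪Ψ (ζ.snd - ζ.fst), ζ.snd - ζ.fst⟫
      + ⟪b, ζ.fst⟫ + 1 / 2 * ⟪D ζ.fst, ζ.fst⟫ - η * ‖ζ‖ ^ 2 ≤ v (y₀ + ζ.snd) - v (x₀ + ζ.fst) := by
  intro η hη
  have hc1 : Continuous fun ζ : E₂ => ζ.fst := (WithLp.fstL 2 ℝ E E).continuous
  have hc2 : Continuous fun ζ : E₂ => ζ.snd := (WithLp.sndL 2 ℝ E E).continuous
  have ht1 : Tendsto (fun ζ : E₂ => ζ.snd - ζ.fst) (𝓝 0) (𝓝 0) := by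
    have : Continuous fun ζ : E₂ => ζ.snd - ζ.fst := hc2.sub hc1
    simpa using this.tendsto 0
  have ht2 : Tendsto (fun ζ : E₂ => ζ.fst) (𝓝 0) (𝓝 0) := by
    simpa using hc1.tendsto 0
  have ht3 : Tendsto (fun ζ : E₂ => (x₀ + ζ.fst, y₀ + ζ.snd)) (𝓝 0) (𝓝 (x₀, y₀)) := by
    have : Continuous fun ζ : E₂ => (x₀ + ζ.fst, y₀ + ζ.snd) :=
      (continuous_const.add hc1).prodMk (continuous_const.add hc2)
    simpa using this.tendsto 0
  filter_upwards [ht1.eventually (hψ (η / 8) (by positivity)),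
    ht2.eventually (hβ (η / 2) (by positivity)), ht3.eventually hmin] with ζ h1 h2 h3
  have e1 : y₀ + ζ.snd - (x₀ + ζ.fst) = y₀ - x₀ + (ζ.snd - ζ.fst) := by abel
  simp only [e1] at h3
  have n1 := norm_fst_le_L2 ζ
  have n2 := norm_snd_le_L2 ζ
  have n3 : ‖ζ.snd - ζ.fst‖ ≤ 2 * ‖ζ‖ := (norm_sub_le _ _).trans (by linarith)
  have n4 : ‖ζ.snd - ζ.fst‖ ^ 2 ≤ (2 * ‖ζ‖) ^ 2 := pow_le_pow_left₀ (norm_nonneg _) n3 2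
  have n5 : ‖ζ.fst‖ ^ 2 ≤ ‖ζ‖ ^ 2 := pow_le_pow_left₀ (norm_nonneg _) n1 2
  nlinarith

end JetCalculus

section Lipschitz

theorem exists_min_of_bounded_sublevel {α : Type*} [PseudoMetricSpace α] [ProperSpace α]
    {Φ : α → ℝ} (hΦ : Continuous Φ) {S : Set α} (hS : IsClosed S) {z₀ : α} (hz₀ : z₀ ∈ S)
    (hb : Bornology.IsBounded {z | z ∈ S ∧ Φ z ≤ Φ z₀}) :
    ∃ z ∈ S, Φ z ≤ Φ z₀ ∧ ∀ w ∈ S, Φ z ≤ Φ w := by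
  have hcl : IsClosed {z | z ∈ S ∧ Φ z ≤ Φ z₀} :=
    hS.inter (isClosed_le hΦ continuous_const)
  have hK := Metric.isCompact_of_isClosed_isBounded hcl hb
  obtain ⟨z, hz, hmin⟩ := hK.exists_isMinOn ⟨z₀, hz₀, le_rfl⟩ hΦ.continuousOn
  refine ⟨z, hz.1, hz.2, fun w hw => ?_⟩
  by_cases h : Φ w ≤ Φ z₀
  · exact hmin ⟨hw, h⟩
  · exact hz.2.trans (not_le.1 h).le

variable {E : Type*} [NormedAddCommGroup E] [InnerProductSpace ℝ E]

theorem isBounded_pairs {S : Set (E × E)} {R R' : ℝ} (h : ∀ z ∈ S, ‖z.1‖ ≤ R ∧ ‖z.2‖ ≤ R') :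
    Bornology.IsBounded S := by
  refine ((isBounded_closedBall (x := (0:E)) (r := R)).prod
    (isBounded_closedBall (x := (0:E)) (r := R'))).subset fun z hz => ?_
  simpa using h z hz

theorem exists_subJet_neg_norm {h : E} (hh : h ≠ 0) : ∃ X : E →L[ℝ] E,
    SubJet (fun y : E => -‖y‖) h (-(‖h‖⁻¹ • h)) X ∧ ⟪X h, h⟫ = 0 := by
  have hr : 0 < ‖h‖ := norm_pos_iff.2 hh
  set r := ‖h‖ with hr'
  have hχ1 : ∀ t < (0:ℝ), HasDerivAt (fun t => -√(-t)) (1 / (2 * √(-t))) t := by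
    intro t ht
    have := ((hasDerivAt_neg t).sqrt (by simpa using ht.ne)).neg
    exact this.congr_deriv (by ring)
  have hχ2 : HasDerivAt (fun t : ℝ => 1 / (2 * √(-t))) (1 / (4 * r ^ 3)) (-r ^ 2) := by
    have h1 : HasDerivAt (fun t : ℝ => √(-t)) (-1 / (2 * √(-(-r ^ 2)))) (-r ^ 2) :=
      (hasDerivAt_neg _).sqrt (by simp [hr.ne'])
    rw [neg_neg, Real.sqrt_sq hr.le] at h1
    have h2 := (h1.const_mul 2).inv (by simp [Real.sqrt_sq hr.le, hr.ne'])
    simp only [neg_neg, Real.sqrt_sq hr.le] at h2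
    refine (h2.congr_of_eventuallyEq (Eventually.of_forall fun t => ?_)).congr_deriv ?_
    · simp
    · field_simp
      norm_num
  have hneg : -r ^ 2 < 0 := by have := pow_pos hr 2; linarith
  have hp := lowerPeano_of_deriv (χ := fun t => -√(-t)) (χ' := fun t => 1 / (2 * √(-t)))
    (s := -r ^ 2) ((eventually_lt_nhds hneg).mono hχ1) hχ2
  simp only [neg_neg, Real.sqrt_sq hr.le] at hp
  have hg := subJet_neg_normSq (0:E) h
  have hcomp := hg.comp (χ := fun t => -√(-t)) (U := Set.univ) (c₁ := 1 / (2 * r))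
    (c₂ := 1 / (4 * r ^ 3)) (by fun_prop) univ_mem
    (fun s _ t _ hst => neg_le_neg (Real.sqrt_le_sqrt (neg_le_neg hst))) (by positivity)
    (by simpa using hp)
  refine ⟨(1 / (2 * r)) • (-(2:ℝ) • ContinuousLinearMap.id ℝ E) +
    (1 / (4 * r ^ 3)) • rankOneSelf (-(2:ℝ) • (h - 0)), ?_, ?_⟩
  · convert hcomp using 1
    · funext y
      simp [Real.sqrt_sq]
    · rw [sub_zero, smul_smul, ← neg_smul]
      congr 1
      field_simp
  · rw [inner_add_clm, inner_smul_clm, inner_smul_clm, inner_smul_clm, inner_rankOneSelf]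
    simp only [sub_zero, real_inner_smul_left, ContinuousLinearMap.id_apply,
      real_inner_self_eq_norm_sq, ← hr']
    field_simp
    ring

theorem exists_subJet_neg_log {K M : ℝ} (hK : 0 < K) (hM : 0 < M) {h : E} (hh : h ≠ 0) :
    ∃ X : E →L[ℝ] E,
      SubJet (fun y : E => -(K⁻¹ * Real.log (1 + M * ‖y‖))) h
        (-(M / (K * (1 + M * ‖h‖)) * ‖h‖⁻¹) • h) X ∧
      ⟪X (‖h‖⁻¹ • h), ‖h‖⁻¹ • h⟫ = K * (M / (K * (1 + M * ‖h‖))) ^ 2 := by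
  have hr : 0 < ‖h‖ := norm_pos_iff.2 hh
  obtain ⟨X, hX, hX0⟩ := exists_subJet_neg_norm hh
  set r := ‖h‖ with hr'
  have hpos : ∀ t < (0:ℝ), 0 < 1 - M * t := fun t ht => by nlinarith
  have hlin : ∀ t : ℝ, HasDerivAt (fun t => 1 - M * t) (-M) t := fun t => by
    simpa using ((hasDerivAt_id t).const_mul M).const_sub 1
  have hχ1 : ∀ t < (0:ℝ), HasDerivAt (fun t => -(K⁻¹ * Real.log (1 - M * t)))
      (M / (K * (1 - M * t))) t := by
    intro t ht
    have := (((hlin t).log (hpos t ht).ne').const_mul K⁻¹).neg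
    refine this.congr_deriv ?_
    have := (hpos t ht).ne'
    field_simp
  have hD : 0 < 1 + M * r := by positivity
  have hχ2 : HasDerivAt (fun t : ℝ => M / (K * (1 - M * t)))
      (M ^ 2 / (K * (1 + M * r) ^ 2)) (-r) := by
    have h1 := ((hlin (-r)).const_mul K).inv (by
      have := hpos (-r) (by linarith)
      positivity)
    have h2 := h1.const_mul M
    refine (h2.congr_of_eventuallyEq (Eventually.of_forall fun t => ?_)).congr_deriv ?_
    · simp [div_eq_mul_inv]
    · have e : 1 - M * -r = 1 + M * r := by ring
      rw [e]
      field_simp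
  have hp := lowerPeano_of_deriv (χ := fun t => -(K⁻¹ * Real.log (1 - M * t)))
    (χ' := fun t => M / (K * (1 - M * t)))
    (s := -r) ((eventually_lt_nhds (by linarith : -r < 0)).mono hχ1) hχ2
  have e : 1 - M * -r = 1 + M * r := by ring
  rw [e] at hp
  have hcomp := hX.comp (χ := fun t => -(K⁻¹ * Real.log (1 - M * t))) (U := Set.Iio 0)
    (c₁ := M / (K * (1 + M * r))) (c₂ := M ^ 2 / (K * (1 + M * r) ^ 2)) (by fun_prop)
    (Iio_mem_nhds (by linarith))
    (fun s hs t ht hst => by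
      have h1 := hpos t ht
      have h2 : Real.log (1 - M * t) ≤ Real.log (1 - M * s) :=
        Real.log_le_log h1 (by nlinarith)
      have h3 := mul_le_mul_of_nonneg_left h2 (inv_pos.2 hK).le
      show -(K⁻¹ * Real.log (1 - M * s)) ≤ -(K⁻¹ * Real.log (1 - M * t))
      linarith) (by positivity) hp
  refine ⟨(M / (K * (1 + M * r))) • X +
    (M ^ 2 / (K * (1 + M * r) ^ 2)) • rankOneSelf (-(r⁻¹ • h)), ?_, ?_⟩
  · convert hcomp using 1
    · funext y
      simp
    · rw [smul_neg, smul_smul, neg_smul]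
  · rw [inner_add_clm, inner_smul_clm, inner_smul_clm, inner_rankOneSelf]
    have hn : ‖r⁻¹ • h‖ = 1 := by
      rw [norm_smul, norm_inv, Real.norm_eq_abs, abs_of_pos hr, ← hr', inv_mul_cancel₀ hr.ne']
    have hX1 : ⟪X (r⁻¹ • h), r⁻¹ • h⟫ = 0 := by
      rw [map_smul, real_inner_smul_left, real_inner_smul_right, hX0]; ring
    rw [hX1, inner_neg_left, real_inner_self_eq_norm_sq, hn]
    field_simp
    ring

theorem lipschitz_of_local {v : E → ℝ} {Λ r : ℝ} (hr : 0 < r)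
    (h : ∀ x y, ‖y - x‖ ≤ r → v x - v y ≤ Λ * ‖y - x‖) (x y : E) :
    |v x - v y| ≤ Λ * ‖x - y‖ := by
  have key : ∀ x y, v x - v y ≤ Λ * ‖y - x‖ := by
    intro x y
    obtain ⟨n, hn⟩ := exists_nat_gt (‖y - x‖ / r)
    have hn0 : 0 < (n:ℝ) := lt_of_le_of_lt (by positivity) hn
    have hstep : ∀ k : ℕ, v x - v (x + ((k:ℝ) / n) • (y - x)) ≤ k * (Λ * (‖y - x‖ / n)) := by
      intro k
      induction k with
      | zero => simp
      | succ k ih =>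
        have e : x + (((k + 1 : ℕ) : ℝ) / n) • (y - x) - (x + ((k:ℝ) / n) • (y - x)) =
            (1 / (n:ℝ)) • (y - x) := by
          rw [add_sub_add_left_eq_sub, ← sub_smul]
          congr 1
          push_cast
          ring
        have e2 : ‖(1 / (n:ℝ)) • (y - x)‖ = ‖y - x‖ / n := by
          rw [norm_smul, Real.norm_eq_abs, abs_of_pos (by positivity)]
          ring
        have := h (x + ((k:ℝ) / n) • (y - x)) (x + (((k + 1 : ℕ) : ℝ) / n) • (y - x)) (by
          rw [e, e2, div_le_iff₀ hn0]
          rw [div_lt_iff₀ hr] at hn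
          linarith)
        rw [e, e2] at this
        push_cast at this ⊢
        linarith
    have := hstep n
    rw [div_self hn0.ne', one_smul, add_sub_cancel] at this
    refine this.trans_eq ?_
    field_simp
  rw [abs_le]
  have h1 := key x y
  have h2 := key y x
  rw [norm_sub_rev] at h1
  constructor <;> linarith

end Lipschitz

section Lipschitz
variable {E : Type*} [NormedAddCommGroup E] [InnerProductSpace ℝ E]
variable [FiniteDimensional ℝ E]
local notation "E₂" => WithLp 2 (E × E)

theorem false_of_lipschitz_gain {a A C K M σ ε s t g₁ g₂ : ℝ} (ha : 0 < a) (hA : 0 ≤ A)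
    (hC : 0 ≤ C) (haK : C + 1 ≤ a * K) (hσ1 : 1 ≤ σ) (hσM : σ ≤ M) (hε0 : 0 < ε)
    (hεM : ε * (100 * (A + a + C + 1) * (M + 1)) ≤ 1) (hs0 : 0 ≤ s) (hs : s ≤ σ + 2 * ε)
    (ht0 : 0 ≤ t) (ht : t ≤ σ + ε) (h₁ : -(C * (1 + s ^ 2)) ≤ g₁)
    (h₂ : g₂ ≤ C * (1 + t ^ 2)) (h : a * (4 * (K * σ ^ 2) - 3 * ε) - A * (3 * ε) ≤ g₂ - g₁) :
    False := by
  have hM1 : 1 ≤ M := hσ1.trans hσM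
  have hS : 0 ≤ A + a + C + 1 := by linarith
  have hεS : ε * (A + a + C + 1) * M + ε * (A + a + C + 1) ≤ 1 / 100 := by linarith
  have hεS0 : 0 ≤ ε * (A + a + C + 1) := by positivity
  have hεS1 : 0 ≤ ε * (A + a + C + 1) * M := by positivity
  have hCM : ε * C * M ≤ 1 / 100 := by
    have : 0 ≤ ε * (A + a + 1) * M := by positivity
    linarith
  have hCε : ε * C ≤ 1 / 100 ∧ ε * a + ε * A + ε ≤ 1 / 100 := by
    have h1 : 0 ≤ ε * A := by positivity
    have h2 : 0 ≤ ε * a := by positivity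
    have h3 : 0 ≤ ε * C := by positivity
    constructor <;> linarith
  have hε1 : ε ≤ 1 / 100 := by
    have h1 : 0 ≤ ε * A := by positivity
    have h2 : 0 ≤ ε * a := by positivity
    linarith
  have hεσ : ε * σ ≤ ε * M := by gcongr
  have hεε : ε * ε ≤ ε * (1 / 100) := by gcongr
  have hs2 : s ^ 2 ≤ σ ^ 2 + (4 * (ε * M) + ε) := by
    have : s ^ 2 ≤ (σ + 2 * ε) ^ 2 := pow_le_pow_left₀ hs0 hs 2
    linarith
  have ht2 : t ^ 2 ≤ σ ^ 2 + (4 * (ε * M) + ε) := by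
    have : t ^ 2 ≤ (σ + ε) ^ 2 := pow_le_pow_left₀ ht0 ht 2
    have : 0 ≤ ε * M := by positivity
    linarith
  have e1 := mul_le_mul_of_nonneg_left hs2 hC
  have e2 := mul_le_mul_of_nonneg_left ht2 hC
  have hσ2 : 1 ≤ σ ^ 2 := one_le_pow₀ hσ1
  have hs3 : (C + 1) * σ ^ 2 ≤ (a * K) * σ ^ 2 := by gcongr
  have hs4 : C * 1 ≤ C * σ ^ 2 := by gcongr
  linarith [hCε.1, hCε.2]

set_option maxHeartbeats 4000000 in
theorem exists_lipschitz_of_jets {a A : ℝ} {G : (E →L[ℝ] E) → ℝ} (hG : EllipticOp a A G)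
    (ha : 0 < a) (hA : 0 ≤ A) {v : E → ℝ} (hv : Continuous v) {B C : ℝ} (hC : 0 ≤ C)
    (hB : ∀ x y, ‖y - x‖ ≤ 1 → v x - v y ≤ B)
    (hjet : ∀ x p X, 1 / 2 ≤ ‖p‖ → (SuperJet v x p X → -(C * (1 + ‖p‖ ^ 2)) ≤ G X) ∧
      (SubJet v x p X → G X ≤ C * (1 + ‖p‖ ^ 2))) :
    ∃ Λ : ℝ, 0 ≤ Λ ∧ ∀ x y, |v x - v y| ≤ Λ * ‖x - y‖ := by
  set K := (C + 1) / a + 1 with hK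
  have hK1 : 1 ≤ K := by rw [hK]; have : 0 ≤ (C + 1) / a := by positivity
                         linarith
  have hK0 : 0 < K := by linarith
  have haK : C + 1 ≤ a * K := by
    rw [hK, mul_add, mul_div_cancel₀ _ ha.ne']; linarith
  set M := 2 * K * max 1 (Real.exp (K * B)) with hM
  have hm1 : 1 ≤ max 1 (Real.exp (K * B)) := le_max_left _ _
  have hM2 : 2 * K ≤ M := by rw [hM]; nlinarith
  have hM0 : 0 < M := by linarith
  set r₀ := 1 / (2 * K) with hr₀
  have hr₀0 : 0 < r₀ := by positivity
  have hr₀1 : r₀ ≤ 1 := by rw [hr₀, div_le_one (by positivity)]; linarith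
  have hψr₀ : B ≤ K⁻¹ * Real.log (1 + M * r₀) := by
    have e : M * r₀ = max 1 (Real.exp (K * B)) := by rw [hM, hr₀]; field_simp
    rw [e, inv_mul_eq_div, le_div_iff₀ hK0, Real.le_log_iff_exp_le (by positivity), mul_comm]
    have := le_max_right 1 (Real.exp (K * B))
    linarith
  have main : ∀ x y, ‖y - x‖ ≤ r₀ → v x - v y ≤ K⁻¹ * Real.log (1 + M * ‖y - x‖) := by
    by_contra! hcon
    obtain ⟨xs, ys, hxy, hlt⟩ := hcon
    set gap := v xs - v ys - K⁻¹ * Real.log (1 + M * ‖ys - xs‖) with hgap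
    have hgap0 : 0 < gap := by rw [hgap]; linarith
    set ε := min (gap / (2 * smoothNorm xs)) (1 / (100 * (A + a + C + 1) * (M + 1))) with hε
    have hS1 := one_le_smoothNorm xs
    have hε0 : 0 < ε := by positivity
    have hεgap : ε * smoothNorm xs < gap := by
      have : ε ≤ gap / (2 * smoothNorm xs) := min_le_left _ _
      rw [le_div_iff₀ (by positivity)] at this
      linarith
    set Φ : E × E → ℝ := fun z =>
      v z.2 - v z.1 + K⁻¹ * Real.log (1 + M * ‖z.2 - z.1‖) + ε * smoothNorm z.1 with hΦ
    have hΦc : Continuous Φ := by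
      have h1 : Continuous fun z : E × E => Real.log (1 + M * ‖z.2 - z.1‖) :=
        Continuous.log (by fun_prop) fun z => by positivity
      have h2 := continuous_smoothNorm (E := E)
      simp only [hΦ]
      fun_prop
    set S : Set (E × E) := {z | ‖z.2 - z.1‖ ≤ r₀} with hS
    have hScl : IsClosed S := isClosed_le (by fun_prop) continuous_const
    have hlogpos : ∀ z : E × E, 0 ≤ K⁻¹ * Real.log (1 + M * ‖z.2 - z.1‖) := fun z =>
      mul_nonneg (inv_pos.2 hK0).le (Real.log_nonneg (by
        have : 0 ≤ M * ‖z.2 - z.1‖ := by positivity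
        linarith))
    have hΦs : Φ (xs, ys) < 0 := by simp only [hΦ]; linarith
    obtain ⟨⟨x₀, y₀⟩, hzS, hz0, hzmin⟩ := exists_min_of_bounded_sublevel hΦc hScl
      (z₀ := (xs, ys)) hxy (isBounded_pairs (R := B / ε) (R' := B / ε + r₀) (by
        rintro ⟨x, y⟩ ⟨hz, hz'⟩
        have h1 := hB x y (le_trans hz hr₀1)
        have h2 := hlogpos (x, y)
        have h3 : ‖x‖ ≤ B / ε := by
          rw [le_div_iff₀ hε0]
          have := mul_le_mul_of_nonneg_left (norm_le_smoothNorm x) hε0.le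
          simp only [hΦ] at hz' hΦs h2
          linarith
        refine ⟨h3, ?_⟩
        have e : y = (y - x) + x := by abel
        have := norm_add_le (y - x) x
        rw [← e] at this
        have hz2 : ‖y - x‖ ≤ r₀ := hz
        simp only
        linarith))
    have hneg : Φ (x₀, y₀) < 0 := lt_of_le_of_lt hz0 hΦs
    have hx0S := one_le_smoothNorm x₀
    have hne : y₀ - x₀ ≠ 0 := by
      intro h0
      have : y₀ = x₀ := sub_eq_zero.1 h0
      rw [this] at hneg
      simp [hΦ] at hneg
      have h2 : 0 ≤ ε * smoothNorm x₀ := mul_nonneg hε0.le (by linarith)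
      linarith
    have hlt' : ‖y₀ - x₀‖ < r₀ := by
      refine lt_of_le_of_ne hzS fun h0 => ?_
      have h1 := hB x₀ y₀ (by rw [h0]; exact hr₀1)
      simp only [hΦ, h0] at hneg
      have h2 : 0 ≤ ε * smoothNorm x₀ := mul_nonneg hε0.le (by linarith)
      linarith
    set h := y₀ - x₀ with hh
    have hr : 0 < ‖h‖ := norm_pos_iff.2 hne
    obtain ⟨Ψ, hΨ, hΨe⟩ := exists_subJet_neg_log hK0 hM0 hne
    obtain ⟨b, D, hD, hb, hDk⟩ := exists_subJet_neg_smoothNorm x₀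
    set σ := M / (K * (1 + M * ‖h‖)) with hσ
    have hσ1 : 1 ≤ σ := by
      rw [hσ, one_le_div (by positivity)]
      have : M * ‖h‖ ≤ M * r₀ := by gcongr
      have e : K * (M * r₀) = M / 2 := by rw [hr₀]; field_simp
      have e2 := mul_le_mul_of_nonneg_left this hK0.le
      linarith
    have hσM : σ ≤ M := by
      rw [hσ, div_le_iff₀ (by positivity)]
      have : 1 ≤ K * (1 + M * ‖h‖) := by
        have : 0 ≤ M * ‖h‖ := by positivity
        exact one_le_mul_of_one_le_of_one_le hK1 (by linarith)
      exact le_mul_of_one_le_right hM0.le this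
    have hβ := (hD.const_mul hε0.le).const_add (Φ (x₀, y₀))
    have hcont := contact_of_lower (v := v) hΨ hβ
      (by simp only [hΦ]; ring)
      (by
        have : {z : E × E | ‖z.2 - z.1‖ < r₀} ∈ 𝓝 (x₀, y₀) :=
          (isOpen_lt (by fun_prop) continuous_const).mem_nhds hlt'
        filter_upwards [this] with z hz
        have h1 := hzmin z (le_of_lt hz)
        have h2 : Φ z = v z.2 - v z.1 + K⁻¹ * Real.log (1 + M * ‖z.2 - z.1‖)
          + ε * smoothNorm z.1 := rfl
        linarith)
    obtain ⟨x, y, p, q, X, Y, -, -, hp, hq, hX, hY, hXY⟩ := exists_jets_of_contact hv hcont hε0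
    set P := -(σ * ‖h‖⁻¹) • h with hP
    have hPn : ‖P‖ = σ := by
      rw [hP, norm_smul, norm_neg, norm_mul, norm_inv, norm_norm, Real.norm_eq_abs,
        abs_of_pos (by linarith)]
      field_simp
    have hεM : ε * (100 * (A + a + C + 1) * (M + 1)) ≤ 1 := by
      have : ε ≤ 1 / (100 * (A + a + C + 1) * (M + 1)) := min_le_right _ _
      rwa [le_div_iff₀ (by positivity)] at this
    have hACa : 1 ≤ A + a + C + 1 := by linarith
    have hε100 : ε * 100 * (M + 1) ≤ 1 := by
      refine le_trans ?_ hεM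
      have : 0 ≤ ε * 100 * (M + 1) := by positivity
      have := le_mul_of_one_le_right this hACa
      linarith
    have hε1 : ε ≤ 1 / 100 := by
      have : 0 ≤ ε * M := by positivity
      linarith
    have hq1 : σ - ε ≤ ‖q‖ ∧ ‖q‖ ≤ σ + ε := by
      have h1 := norm_sub_norm_le P q
      have h2 := norm_sub_norm_le q P
      rw [norm_sub_rev] at h1
      constructor <;> linarith
    have hp1 : σ - 2 * ε ≤ ‖p‖ ∧ ‖p‖ ≤ σ + 2 * ε := by
      have h0 : ‖p - P‖ ≤ 2 * ε := by
        have e : p - P = (p - (P - ε • b)) + -(ε • b) := by abel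
        rw [e]
        refine (norm_add_le _ _).trans ?_
        rw [norm_neg, norm_smul, Real.norm_eq_abs, abs_of_pos hε0]
        have := mul_le_of_le_one_right hε0.le hb
        linarith
      have h1 := norm_sub_norm_le P p
      have h2 := norm_sub_norm_le p P
      rw [norm_sub_rev] at h1
      constructor <;> linarith
    have hGX := (hjet x p X (by linarith [hp1.1])).1 hX
    have hGY := (hjet y q Y (by linarith [hq1.1])).2 hY
    set e := ‖h‖⁻¹ • h with he
    have hen : ‖e‖ = 1 := by
      rw [he, norm_smul, norm_inv, norm_norm, inv_mul_cancel₀ hr.ne']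
    have hgain := hG.gain X Y (3 * ε) (4 * (K * σ ^ 2) - 3 * ε) e (by positivity) hen
      (fun k => by
        have h4 := hXY k k
        have h5 := mul_le_mul_of_nonneg_left (hDk k) hε0.le
        rw [inner_smul_clm] at h4
        simp only [sub_self, map_zero, inner_zero_left] at h4
        have h6 : 0 ≤ ε * ‖k‖ ^ 2 := by positivity
        linarith)
      (by
        have h4 := hXY e (-e)
        have h5 : e - -e = (2:ℝ) • e := by rw [two_smul]; abel
        rw [inner_smul_clm] at h4
        simp only [h5, map_smul, map_neg, inner_neg_neg, real_inner_smul_left,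
          real_inner_smul_right, norm_neg, hen] at h4
        have h6 := mul_le_mul_of_nonneg_left (hDk e) hε0.le
        rw [hen] at h6
        rw [hΨe] at h4
        linarith)
    exact false_of_lipschitz_gain ha hA hC haK hσ1 hσM hε0 hεM (norm_nonneg p) hp1.2
      (norm_nonneg q) hq1.2 hGX hGY hgain
  refine ⟨K⁻¹ * M, mul_nonneg (inv_pos.2 hK0).le hM0.le,
    lipschitz_of_local hr₀0 fun x y hxy => ?_⟩
  refine (main x y hxy).trans ?_
  rw [mul_assoc K⁻¹ M]
  refine mul_le_mul_of_nonneg_left ?_ (inv_pos.2 hK0).le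
  have hM' : 0 ≤ M * ‖y - x‖ := mul_nonneg hM0.le (norm_nonneg _)
  have := Real.log_le_sub_one_of_pos (x := 1 + M * ‖y - x‖) (by linarith)
  linarith

end Lipschitz

section Barrier
variable {E : Type*} [NormedAddCommGroup E] [InnerProductSpace ℝ E]

theorem exists_subJet_gaussian {l : ℝ} (hl : 0 ≤ l) (c x : E) : ∃ D : E →L[ℝ] E,
    SubJet (fun y => Real.exp (l * -‖y - c‖ ^ 2)) x
      ((l * Real.exp (l * -‖x - c‖ ^ 2)) • (-(2:ℝ) • (x - c))) D ∧
    ∀ k, ⟪D k, k⟫ =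
      Real.exp (l * -‖x - c‖ ^ 2) * (4 * l ^ 2 * ⟪x - c, k⟫ ^ 2 - 2 * l * ‖k‖ ^ 2) := by
  have hd : ∀ t, HasDerivAt (fun t => Real.exp (l * t)) (l * Real.exp (l * t)) t := fun t => by
    have := ((hasDerivAt_id t).const_mul l).exp
    simpa [mul_comm] using this
  have h2 : HasDerivAt (fun t => l * Real.exp (l * t))
      (l * (l * Real.exp (l * -‖x - c‖ ^ 2))) (-‖x - c‖ ^ 2) := (hd _).const_mul l
  have h3 := lowerPeano_of_deriv (χ := fun t => Real.exp (l * t)) (s := -‖x - c‖ ^ 2)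
    (Eventually.of_forall hd) h2
  have hmono : MonotoneOn (fun t => Real.exp (l * t)) Set.univ := by
    intro s _ t _ hst
    exact Real.exp_le_exp.2 (mul_le_mul_of_nonneg_left hst hl)
  refine ⟨_, SubJet.comp (subJet_neg_normSq c x) (by fun_prop) univ_mem hmono
    (by positivity) h3, fun k => ?_⟩
  rw [inner_add_clm, inner_smul_clm, inner_smul_clm, inner_smul_clm, inner_rankOneSelf,
    real_inner_smul_left]
  simp only [ContinuousLinearMap.id_apply, real_inner_self_eq_norm_sq]
  ring

theorem exists_gaussian_rate {a A L L' r R : ℝ} (ha : 0 < a) (hA : 0 ≤ A) (hL : 0 ≤ L)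
    (hL' : 0 ≤ L') (hr : 0 < r) (hrR : r < R) :
    ∃ l > 0, ∀ s, r ≤ s → s ≤ R →
      A * (2 * l) + L * (L' + 2 * l * s) < a * (4 * l ^ 2 * s ^ 2 - 2 * l) := by
  set T := 2 * a + 2 * A + L * L' + 2 * L * R with hT
  have hR : 0 < R := hr.trans hrR
  have hT0 : 0 < T := by positivity
  refine ⟨T / (4 * a * r ^ 2) + 1, by positivity, fun s h1 h2 => ?_⟩
  set l := T / (4 * a * r ^ 2) + 1 with hl
  have hl1 : 1 ≤ l := by
    have : 0 ≤ T / (4 * a * r ^ 2) := by positivity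
    linarith
  have h3 : T < l * (4 * a * r ^ 2) := by
    rw [hl, add_mul, div_mul_cancel₀ _ (by positivity)]
    have : 0 < 4 * a * r ^ 2 := by positivity
    linarith
  have h4 : l * T < l * (l * (4 * a * r ^ 2)) := mul_lt_mul_of_pos_left h3 (by linarith)
  have h5 : r ^ 2 ≤ s ^ 2 := pow_le_pow_left₀ hr.le h1 2
  have h6 : l ^ 2 * a * r ^ 2 ≤ l ^ 2 * a * s ^ 2 := by gcongr
  have h7 : L * L' * 1 ≤ L * L' * l := by gcongr
  have h8 : L * l * s ≤ L * l * R := by gcongr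
  have h9 : l * T = l * (2 * a + 2 * A + L * L' + 2 * L * R) := rfl
  linarith

variable [FiniteDimensional ℝ E]
local notation "E₂" => WithLp 2 (E × E)

set_option maxHeartbeats 1000000 in
theorem exists_barrier_bound {a A L r d R : ℝ} (ha : 0 < a) (hA : 0 ≤ A) (hL : 0 ≤ L)
    (hr : 0 < r) (hrd : r ≤ d) (hdR : d < R) :
    ∃ κ > 0, ∃ β > 0, ∀ {Q : E → Prop} {𝒢 : ℝ → E → (E →L[ℝ] E) → ℝ},
      StructCond a A L Q 𝒢 → ∀ {v : E → ℝ}, Continuous v → ∀ {Ω : Set E}, IsOpen Ω →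
      JetSol Q 𝒢 Ω v → ∀ {y g : E} {ψ : E → ℝ}, Continuous ψ → ∀ {θ ρ : ℝ}, 0 < θ → 0 < ρ →
      (∀ x, ‖x - y‖ ≤ R → x ∈ Ω) → (∀ x h, ‖x - y‖ ≤ R → ‖h - g‖ ≤ ρ → x + h ∈ Ω) →
      (∀ x h, ‖x - y‖ ≤ R → ‖h - g‖ ≤ ρ → ψ h ≤ v (x + h) - v x) →
      (∀ x h, ‖x - y‖ ≤ R → ‖h - g‖ = ρ → ψ h + θ ≤ v (x + h) - v x) →
      (∀ x h t, ‖x - y‖ ≤ R → ‖h - g‖ ≤ ρ → 0 ≤ t → t ≤ 1 → v (x + h) - v x ≤ ψ h + θ * t →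
        -(κ * θ) ≤ v (x + h) - v x ∧ v (x + h) - v x ≤ 2 * θ * t + κ * θ) →
      -(κ * θ) ≤ ψ g →
      (∀ x h, ‖x - y‖ = r → ‖h - g‖ ≤ ρ → ψ h + θ ≤ v (x + h) - v x) →
      (∀ x h, ‖x - y‖ ≤ R → ‖h - g‖ < ρ → v (x + h) - v x ≤ ψ h + θ → ∃ P Ψ, SubJet ψ h P Ψ ∧
        ∃ r' > 0, ∀ z ∈ Ω, ∀ p X, ‖p - P‖ ≤ β * θ + r' → (SuperJet v z p X ∨ SubJet v z p X) →
          Q p) →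
      ∀ x, r ≤ ‖x - y‖ → ‖x - y‖ ≤ d → κ * θ ≤ v (x + g) - v x := by
  have hrR : r < R := lt_of_le_of_lt hrd hdR
  have hR : 0 < R := hr.trans hrR
  have hd0 : 0 < d := hr.trans_le hrd
  obtain ⟨l, hl, hrate⟩ := exists_gaussian_rate (L' := 3) ha hA hL (by norm_num) hr hrR
  set eR := Real.exp (l * -R ^ 2) with heR
  set ed := Real.exp (l * -d ^ 2) with hed
  have heRd : eR < ed := by
    apply Real.exp_lt_exp.2
    have : d ^ 2 < R ^ 2 := by gcongr
    nlinarith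
  have heR0 : 0 < eR := Real.exp_pos _
  have hed0 : ed ≤ 1 := by
    rw [hed, Real.exp_le_one_iff]
    have : 0 ≤ l * d ^ 2 := by positivity
    linarith
  set κ := min eR ((ed - eR) / 3) with hκ
  have hκ1 : κ ≤ eR := min_le_left _ _
  have hκ2 : κ ≤ (ed - eR) / 3 := min_le_right _ _
  have hκ0 : 0 < κ := lt_min heR0 (by linarith)
  refine ⟨κ, hκ0, 2 * l * R, by positivity, ?_⟩
  intro Q 𝒢 hS v hv Ω hΩ hsol y g ψ hψ θ ρ hθ hρ hΩ₁ hΩ₂ hψ₁ hψ₂ hψ₃ hψ₄ hψ₅ hψ₆ xb hxb₁ hxb₂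
  by_contra! hcon
  set B : E → ℝ := fun x => Real.exp (l * -‖x - y‖ ^ 2) - eR with hB
  have hB0 : ∀ x, ‖x - y‖ ≤ R → 0 ≤ B x := fun x hx => by
    simp only [hB, heR, sub_nonneg]
    apply Real.exp_le_exp.2
    have : ‖x - y‖ ^ 2 ≤ R ^ 2 := by gcongr
    nlinarith
  have hBe : ∀ x, B x ≤ 1 := fun x => by
    have : Real.exp (l * -‖x - y‖ ^ 2) ≤ 1 := by
      rw [Real.exp_le_one_iff]
      have : 0 ≤ l * ‖x - y‖ ^ 2 := by positivity
      linarith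
    simp only [hB]; linarith
  have hBxb : ed - eR ≤ B xb := by
    simp only [hB, hed]
    have : Real.exp (l * -d ^ 2) ≤ Real.exp (l * -‖xb - y‖ ^ 2) := by
      apply Real.exp_le_exp.2
      have : ‖xb - y‖ ^ 2 ≤ d ^ 2 := by gcongr
      nlinarith
    linarith
  have hBc : Continuous B := by simp only [hB]; fun_prop
  set Φ : E × E → ℝ := fun z => v (z.1 + z.2) - v z.1 - ψ z.2 - θ * B z.1 with hΦ
  have hΦc : Continuous Φ := by simp only [hΦ]; fun_prop
  set S : Set (E × E) := {z | r ≤ ‖z.1 - y‖ ∧ ‖z.1 - y‖ ≤ R ∧ ‖z.2 - g‖ ≤ ρ} with hSdef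
  have hScl : IsClosed S := by
    refine IsClosed.and ?_ (IsClosed.and ?_ ?_)
    · exact isClosed_le continuous_const (by fun_prop)
    · exact isClosed_le (by fun_prop) continuous_const
    · exact isClosed_le (by fun_prop) continuous_const
  have hmemS : (xb, g) ∈ S := ⟨hxb₁, hxb₂.trans hdR.le, by simpa using hρ.le⟩
  have hΦb : Φ (xb, g) < 0 := by
    simp only [hΦ]
    have h1 := mul_le_mul_of_nonneg_left hBxb hθ.le
    have h2 := mul_le_mul_of_nonneg_left hκ2 hθ.le
    have h3 : 0 < κ * θ := by positivity
    linarith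
  obtain ⟨⟨x₀, h₀⟩, hzS, hz0, hzmin⟩ := exists_min_of_bounded_sublevel hΦc hScl hmemS
    (isBounded_pairs (R := R + ‖y‖) (R' := ρ + ‖g‖) (by
      rintro ⟨x, h⟩ ⟨⟨-, h2, h3⟩, -⟩
      have e1 := norm_sub_norm_le x y
      have e2 := norm_sub_norm_le h g
      simp only at h2 h3 ⊢
      constructor <;> linarith))
  have hneg : Φ (x₀, h₀) < 0 := hz0.trans_lt hΦb
  obtain ⟨hx1, hx2, hh⟩ := hzS
  simp only at hx1 hx2 hh
  have hτ : v (x₀ + h₀) - v x₀ < ψ h₀ + θ * B x₀ := by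
    simp only [hΦ] at hneg; linarith
  have hθB : θ * B x₀ ≤ θ := mul_le_of_le_one_right hθ.le (hBe x₀)
  have hx1' : r < ‖x₀ - y‖ := lt_of_le_of_ne hx1 fun h => by
    have := hψ₅ x₀ h₀ h.symm hh
    linarith
  have hx2' : ‖x₀ - y‖ < R := lt_of_le_of_ne hx2 fun h => by
    have h1 := hψ₁ x₀ h₀ hx2 hh
    have h2 : B x₀ = 0 := by simp only [hB, h, heR, sub_self]
    rw [h2] at hτ
    linarith
  have hh' : ‖h₀ - g‖ < ρ := lt_of_le_of_ne hh fun h => by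
    have := hψ₂ x₀ h₀ hx2 h
    linarith
  obtain ⟨P, Ψ, hPΨ, r', hr', hQ⟩ := hψ₆ x₀ h₀ hx2 hh' (by linarith)
  obtain ⟨hτ1, hτ2⟩ := hψ₃ x₀ h₀ (B x₀) hx2 hh (hB0 x₀ hx2) (hBe x₀) hτ.le
  obtain ⟨D, hD, hDk⟩ := exists_subJet_gaussian hl.le y x₀
  set s := ‖x₀ - y‖ with hs
  set ex := Real.exp (l * -s ^ 2) with hex
  have hex0 : 0 < ex := Real.exp_pos _
  have hex1 : ex ≤ 1 := by
    have : ex = B x₀ + eR := by simp only [hB]; ring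
    rw [hex, Real.exp_le_one_iff]
    have : 0 ≤ l * s ^ 2 := by positivity
    linarith
  have heRx : eR ≤ ex := by
    have := hB0 x₀ hx2
    simp only [hB] at this
    linarith
  have hBx : B x₀ ≤ ex := by simp only [hB]; linarith
  have hs0 : 0 < s := hr.trans hx1'
  have hβ := ((hD.const_add (-eR)).const_mul hθ.le).const_add (Φ (x₀, h₀))
  set b := θ • ((l * ex) • (-(2:ℝ) • (x₀ - y))) with hb
  have hbn : ‖b‖ = θ * (ex * (2 * l * s)) := by
    rw [hb, norm_smul, norm_smul, norm_smul, Real.norm_eq_abs, Real.norm_eq_abs, Real.norm_eq_abs,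
      abs_of_pos hθ, abs_of_pos (by positivity), abs_neg, abs_of_pos two_pos]
    ring
  have hbn' : ‖b‖ ≤ 2 * l * R * θ := by
    rw [hbn]
    have e1 : ex * (2 * l * s) ≤ 1 * (2 * l * R) := by gcongr
    have e2 := mul_le_mul_of_nonneg_left e1 hθ.le
    linarith
  have hcont := contact_of_lower (v := v) (x₀ := x₀) (y₀ := x₀ + h₀) (ψ := ψ)
    (by rw [add_sub_cancel_left]; exact hPΨ) hβ
    (by simp only [hΦ, hB, add_sub_cancel_left]; ring)
    (by
      have hm : {z : E × E | r < ‖z.1 - y‖ ∧ ‖z.1 - y‖ < R ∧ ‖(z.2 - z.1) - g‖ < ρ} ∈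
          𝓝 (x₀, x₀ + h₀) := by
        refine IsOpen.mem_nhds (IsOpen.and ?_ (IsOpen.and ?_ ?_)) ⟨hx1', hx2', by simpa using hh'⟩
        · exact isOpen_lt continuous_const (by fun_prop)
        · exact isOpen_lt (by fun_prop) continuous_const
        · exact isOpen_lt (by fun_prop) continuous_const
      filter_upwards [hm] with z hz
      have h1 := hzmin (z.1, z.2 - z.1) ⟨hz.1.le, hz.2.1.le, hz.2.2.le⟩
      have h2 : Φ (z.1, z.2 - z.1) =
          v (z.1 + (z.2 - z.1)) - v z.1 - ψ (z.2 - z.1) - θ * B z.1 := rfl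
      rw [add_sub_cancel] at h2
      have h3 : B z.1 = Real.exp (l * -‖z.1 - y‖ ^ 2) - eR := rfl
      rw [h3] at h2
      linarith)
  have hx₀Ω := hΩ₁ x₀ hx2
  have hy₀Ω := hΩ₂ x₀ h₀ hx2 hh
  obtain ⟨r₁, hr₁, hball₁⟩ := Metric.isOpen_iff.1 hΩ _ hx₀Ω
  obtain ⟨r₂, hr₂, hball₂⟩ := Metric.isOpen_iff.1 hΩ _ hy₀Ω
  have hrm : 0 < min r' (min (r₁ / 2) (r₂ / 2)) := by positivity
  set rm := min r' (min (r₁ / 2) (r₂ / 2)) with hrmd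
  have hrm1 : rm ≤ r' := min_le_left _ _
  have hrm2 : rm ≤ r₁ / 2 := (min_le_right _ _).trans (min_le_left _ _)
  have hrm3 : rm ≤ r₂ / 2 := (min_le_right _ _).trans (min_le_right _ _)
  have hest := contact_estimate hS ha.le hA hL hv hΩ hsol hx₀Ω hy₀Ω hcont hrm
    (fun x p X h1 h2 h3 => hQ x (hball₁ (by rw [mem_ball, dist_eq_norm]; linarith)) p X (by
      have e : p - P = (p - (P - b)) + -b := by abel
      rw [e]
      refine (norm_add_le _ _).trans ?_
      rw [norm_neg]; linarith) (Or.inl h3))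
    (fun x p X h1 h2 h3 => hQ x (hball₂ (by rw [mem_ball, dist_eq_norm]; linarith)) p X (by
      have := norm_nonneg b
      linarith) (Or.inr h3))
    (c₁ := θ * ex * (2 * l)) (c₃ := θ * ex * (4 * l ^ 2 * s ^ 2 - 2 * l)) (by positivity)
    (fun k => by
      rw [inner_smul_clm, hDk]
      have : 0 ≤ θ * (ex * (4 * l ^ 2 * ⟪x₀ - y, k⟫ ^ 2)) := by positivity
      linarith) (e := s⁻¹ • (x₀ - y))
    (by rw [norm_smul, norm_inv, hs, norm_norm, inv_mul_cancel₀ hs0.ne'])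
    (Or.inl (by
      rw [inner_smul_clm, hDk, real_inner_smul_right, real_inner_self_eq_norm_sq, norm_smul,
        norm_inv, norm_norm, ← hs]
      apply le_of_eq
      field_simp))
  rw [hbn] at hest
  have hτabs : |v (x₀ + h₀) - v x₀| ≤ θ * ex * 3 := by
    have e1 : κ * θ ≤ ex * θ := by gcongr; linarith
    have e2 : θ * B x₀ ≤ θ * ex := by gcongr
    have e3 : 0 ≤ θ * ex := by positivity
    rw [abs_le]; constructor <;> linarith
  have h1 := hrate s hx1 hx2
  have h2 : 0 < θ * ex := by positivity
  have h3 := mul_lt_mul_of_pos_left h1 h2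
  have h4 := mul_le_mul_of_nonneg_left hτabs hL
  linarith

end Barrier

theorem le_of_forall_mul_sub {c d K : ℝ} (h : ∀ η > 0, c - K * η ≤ d) : c ≤ d := by
  have h1 : Tendsto (fun η => c - K * η) (𝓝[>] 0) (𝓝 (c - K * 0)) :=
    ((continuous_const.sub (continuous_const.mul continuous_id)).tendsto 0).mono_left
      nhdsWithin_le_nhds
  rw [mul_zero, sub_zero] at h1
  exact le_of_tendsto h1 (eventually_nhdsWithin_of_forall fun η hη => h η hη)

section Visc
variable {N : ℕ} {a A α : ℝ} {Ftil : Matrix (Fin N) (Fin N) ℝ → ℝ}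

theorem ViscSuper.le_of_subJet {g : ESp N → ℝ → ℝ} {Ω : Set (ESp N)} {v : ESp N → ℝ}
    (hv : ViscSuper α Ftil g Ω v)
    (hG : EllipticOp a A (fun X : ESp N →L[ℝ] ESp N => Ftil (opMat X)))
    {x p : ESp N} {X : ESp N →L[ℝ] ESp N} (hx : x ∈ Ω) (hp : p ≠ 0) (h : SubJet v x p X) :
    ‖p‖ ^ α * Ftil (opMat X) ≤ g x (v x) := by
  rcases hv x hx with ⟨δ, hδ, c, -, hc, -⟩ | hv
  · exact absurd (h.eq_zero_of_const (eventually_of_mem (ball_mem_nhds x hδ) hc)) hp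
  have he : ‖‖p‖⁻¹ • p‖ = 1 := by
    rw [norm_smul, norm_inv, norm_norm, inv_mul_cancel₀ (norm_ne_zero_iff.2 hp)]
  refine le_of_forall_mul_sub (K := ‖p‖ ^ α * ((a + A) * 2)) fun η hη => ?_
  have h1 := hv _ (contDiff_quadTest x p _) (h.isLocalMin hη) (by rwa [gradient_quadTest])
  rw [gradient_quadTest, hessianMatrix_quadTest] at h1
  refine le_trans ?_ h1
  have h2 := (hG.add_id_le X he (η := 2 * η) (by positivity)).2
  have h3 := mul_le_mul_of_nonneg_left h2 (Real.rpow_nonneg (norm_nonneg p) α)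
  linarith

theorem ViscSub.le_of_superJet {g : ESp N → ℝ → ℝ} {Ω : Set (ESp N)} {v : ESp N → ℝ}
    (hv : ViscSub α Ftil g Ω v)
    (hG : EllipticOp a A (fun X : ESp N →L[ℝ] ESp N => Ftil (opMat X)))
    {x p : ESp N} {X : ESp N →L[ℝ] ESp N} (hx : x ∈ Ω) (hp : p ≠ 0) (h : SuperJet v x p X) :
    g x (v x) ≤ ‖p‖ ^ α * Ftil (opMat X) := by
  rcases hv x hx with ⟨δ, hδ, c, -, hc, -⟩ | hv
  · exact absurd (h.eq_zero_of_const (eventually_of_mem (ball_mem_nhds x hδ) hc)) hp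
  have he : ‖‖p‖⁻¹ • p‖ = 1 := by
    rw [norm_smul, norm_inv, norm_norm, inv_mul_cancel₀ (norm_ne_zero_iff.2 hp)]
  refine le_of_forall_mul_sub (K := ‖p‖ ^ α * ((a + A) * 2)) fun η hη => ?_
  have h1 := hv _ (contDiff_quadTest x p _) (h.isLocalMax hη) (by rwa [gradient_quadTest])
  rw [gradient_quadTest, hessianMatrix_quadTest] at h1
  have h2 := (hG.add_id_le X he (η := 2 * η) (by positivity)).1
  have h3 := mul_le_mul_of_nonneg_left h2 (Real.rpow_nonneg (norm_nonneg p) α)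
  linarith

end Visc

/-- The extension of `f` from `[-1, 1]` to `ℝ` which is constant outside the interval. -/
def clipExt (f : ℝ → ℝ) (s : ℝ) : ℝ := f (max (-1) (min 1 s))

theorem clip_mem (s : ℝ) : max (-1) (min 1 s) ∈ Set.Icc (-1 : ℝ) 1 :=
  ⟨le_max_left _ _, max_le (by norm_num) (min_le_left _ _)⟩

theorem clip_eq {s : ℝ} (hs : s ∈ Set.Icc (-1 : ℝ) 1) : max (-1) (min 1 s) = s := by
  rw [min_eq_right hs.2, max_eq_right hs.1]

theorem clipExt_eq {f : ℝ → ℝ} {s : ℝ} (hs : s ∈ Set.Icc (-1 : ℝ) 1) : clipExt f s = f s := by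
  rw [clipExt, clip_eq hs]

theorem exists_clipExt_bounds {f : ℝ → ℝ} (hf : ContDiffOn ℝ 1 f (Set.Icc (-1) 1)) :
    ∃ L, 0 ≤ L ∧ (∀ s t, |clipExt f s - clipExt f t| ≤ L * |s - t|) ∧
      ∀ s, |clipExt f s| ≤ L := by
  obtain ⟨K, hK⟩ := hf.exists_lipschitzOnWith one_ne_zero (convex_Icc _ _) isCompact_Icc
  obtain ⟨C, hC⟩ := (isCompact_Icc (a := (-1:ℝ)) (b := 1)).exists_bound_of_continuousOn
    hf.continuousOn
  refine ⟨max K C, le_max_of_le_left K.2, fun s t => ?_, fun s => ?_⟩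
  · have h1 := hK.dist_le_mul _ (clip_mem s) _ (clip_mem t)
    rw [Real.dist_eq, Real.dist_eq] at h1
    refine h1.trans (mul_le_mul (le_max_left _ _) ?_ (abs_nonneg _) (le_max_of_le_left K.2))
    rw [max_comm (-1), max_comm (-1)]
    exact (abs_max_sub_max_le_abs _ _ _).trans ((abs_min_sub_min_le_max 1 s 1 t).trans (by simp))
  · exact (hC _ (clip_mem s)).trans (le_max_right _ _)

section StructPower
variable {E : Type*} [NormedAddCommGroup E] [InnerProductSpace ℝ E]

theorem exists_rpow_bounds {m Λ : ℝ} (hm : 0 < m) (α : ℝ) : ∃ L, 0 ≤ L ∧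
    (∀ s ∈ Set.Icc m Λ, ∀ t ∈ Set.Icc m Λ, |s ^ α - t ^ α| ≤ L * |s - t|) ∧
      ∀ s ∈ Set.Icc m Λ, |s ^ α| ≤ L := by
  have hc : ContDiffOn ℝ 1 (fun s : ℝ => s ^ α) (Set.Icc m Λ) := fun s hs =>
    (contDiffAt_id.rpow_const_of_ne (hm.trans_le hs.1).ne').contDiffWithinAt
  obtain ⟨K, hK⟩ := hc.exists_lipschitzOnWith one_ne_zero (convex_Icc _ _) isCompact_Icc
  obtain ⟨C, hC⟩ := (isCompact_Icc (a := m) (b := Λ)).exists_bound_of_continuousOn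
    hc.continuousOn
  refine ⟨max K C, le_max_of_le_left K.2, fun s hs t ht => ?_, fun s hs => ?_⟩
  · have h1 := hK.dist_le_mul _ hs _ ht
    rw [Real.dist_eq, Real.dist_eq] at h1
    exact h1.trans (mul_le_mul_of_nonneg_right (le_max_left _ _) (abs_nonneg _))
  · exact (hC s hs).trans (le_max_right _ _)

theorem exists_structCond_rpow {a A : ℝ} {G : (E →L[ℝ] E) → ℝ} (hG : EllipticOp a A G)
    {g : ℝ → ℝ} {Lg : ℝ} (hLg : 0 ≤ Lg) (hg : ∀ s t, |g s - g t| ≤ Lg * |s - t|)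
    (hgb : ∀ s, |g s| ≤ Lg) {m Λ : ℝ} (hm : 0 < m) (α : ℝ) :
    ∃ L, 0 ≤ L ∧ StructCond a A L (fun p => m ≤ ‖p‖ ∧ ‖p‖ ≤ Λ)
      (fun s p X => G X + g s * ‖p‖ ^ α) := by
  obtain ⟨L, hL, h1, h2⟩ := exists_rpow_bounds (Λ := Λ) hm α
  refine ⟨Lg * L, by positivity, ?_⟩
  intro s s' p p' X Y c₁ c₃ e hp hp' hc he hk hke
  have h3 := hG.gain X Y c₁ c₃ e hc he hk hke
  have h4 : |g s' * ‖p'‖ ^ α - g s * ‖p‖ ^ α| ≤ Lg * L * (|s - s'| + ‖p - p'‖) := by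
    have e1 : g s' * ‖p'‖ ^ α - g s * ‖p‖ ^ α =
      (g s' - g s) * ‖p'‖ ^ α + g s * (‖p'‖ ^ α - ‖p‖ ^ α) := by ring
    rw [e1]
    refine (abs_add_le _ _).trans ?_
    rw [abs_mul, abs_mul]
    have e2 : |g s' - g s| * |‖p'‖ ^ α| ≤ Lg * |s - s'| * L := by
      rw [abs_sub_comm s s']
      exact mul_le_mul (hg _ _) (h2 _ hp') (abs_nonneg _) (by positivity)
    have e3 : |g s| * |‖p'‖ ^ α - ‖p‖ ^ α| ≤ Lg * (L * ‖p - p'‖) := by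
      refine mul_le_mul (hgb s) ((h1 _ hp' _ hp).trans ?_) (abs_nonneg _) hLg
      gcongr
      rw [norm_sub_rev]
      exact abs_norm_sub_norm_le _ _
    linarith
  have h5 := neg_le_of_abs_le h4
  linarith

end StructPower

section GradientCase
variable {E : Type*} [NormedAddCommGroup E] [InnerProductSpace ℝ E]

theorem SubJet.norm_le {v : E → ℝ} {x p : E} {X : E →L[ℝ] E} (h : SubJet v x p X) {Λ : ℝ}
    (hΛ : 0 ≤ Λ) (hv : ∀ x y, |v x - v y| ≤ Λ * ‖x - y‖) : ‖p‖ ≤ Λ := by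
  rcases eq_or_ne p 0 with rfl | hp
  · rwa [norm_zero]
  · have hp0 := norm_pos_iff.2 hp
    have ht : Tendsto (fun t : ℝ => t • p) (𝓝[>] 0) (𝓝 0) := by
      have : Continuous fun t : ℝ => t • p := by fun_prop
      simpa using (this.tendsto 0).mono_left (nhdsWithin_le_nhds (s := Set.Ioi 0))
    have h1 := (ht.eventually (h 1 one_pos)).and self_mem_nhdsWithin
    have h2 : ∀ᶠ t in 𝓝[>] (0:ℝ), ‖p‖ ^ 2 - t * (‖p‖ ^ 2 - 1 / 2 * ⟪X p, p⟫) ≤ Λ * ‖p‖ := by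
      filter_upwards [h1] with t ⟨ht1, ht0⟩
      have ht0' : 0 < t := ht0
      have h3 := (le_abs_self _).trans (hv (x + t • p) x)
      rw [add_sub_cancel_left, norm_smul, Real.norm_eq_abs, abs_of_pos ht0'] at h3
      rw [map_smul, norm_smul, real_inner_smul_left, real_inner_smul_right, real_inner_smul_right,
        real_inner_self_eq_norm_sq, Real.norm_eq_abs, abs_of_pos ht0'] at ht1
      have h4 : t * (‖p‖ ^ 2 - t * (‖p‖ ^ 2 - 1 / 2 * ⟪X p, p⟫)) ≤ t * (Λ * ‖p‖) := by linarith
      exact le_of_mul_le_mul_left h4 ht0'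
    have h5 : ‖p‖ ^ 2 ≤ Λ * ‖p‖ := by
      refine le_of_tendsto ?_ h2
      have : Continuous fun t : ℝ => ‖p‖ ^ 2 - t * (‖p‖ ^ 2 - 1 / 2 * ⟪X p, p⟫) := by fun_prop
      simpa using (this.tendsto 0).mono_left (nhdsWithin_le_nhds (s := Set.Ioi 0))
    rw [sq] at h5
    exact le_of_mul_le_mul_right h5 hp0

theorem SuperJet.norm_le {v : E → ℝ} {x p : E} {X : E →L[ℝ] E} (h : SuperJet v x p X) {Λ : ℝ}
    (hΛ : 0 ≤ Λ) (hv : ∀ x y, |v x - v y| ≤ Λ * ‖x - y‖) : ‖p‖ ≤ Λ := by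
  rw [← norm_neg]
  refine h.subJet_neg.norm_le hΛ fun x y => ?_
  rw [← abs_neg]
  convert hv x y using 2
  ring

theorem exists_structCondMod_rpow {a A : ℝ} {G : (E →L[ℝ] E) → ℝ} (hG : EllipticOp a A G)
    {g : ℝ → ℝ} {Lg : ℝ} (hLg : 0 ≤ Lg) (hgb : ∀ s, |g s| ≤ Lg) {m Λ : ℝ} (hm : 0 < m) (α : ℝ) :
    ∃ L, 0 ≤ L ∧ StructCondMod a A L (fun s s' => L * max (g s - g s') 0)
      (fun p => m ≤ ‖p‖ ∧ ‖p‖ ≤ Λ) (fun s p X => G X + g s * ‖p‖ ^ α) := by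
  obtain ⟨L, hL, h1, h2⟩ := exists_rpow_bounds (Λ := Λ) hm α
  refine ⟨max L (Lg * L), le_max_of_le_left hL, ?_⟩
  intro s s' p p' X Y c₁ c₃ e hp hp' hc he hk hke
  have h3 := hG.gain X Y c₁ c₃ e hc he hk hke
  have e3 : |g s * (‖p'‖ ^ α - ‖p‖ ^ α)| ≤ Lg * (L * ‖p - p'‖) := by
    rw [abs_mul]
    refine mul_le_mul (hgb s) ((h1 _ hp' _ hp).trans ?_) (abs_nonneg _) hLg
    gcongr
    rw [norm_sub_rev]
    exact abs_norm_sub_norm_le _ _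
  have e4 : (g s - g s') * ‖p'‖ ^ α ≤ max L (Lg * L) * max (g s - g s') 0 := by
    have h5 := (le_abs_self _).trans (h2 _ hp')
    have h6 : 0 ≤ ‖p'‖ ^ α := Real.rpow_nonneg (norm_nonneg _) _
    calc (g s - g s') * ‖p'‖ ^ α ≤ max (g s - g s') 0 * ‖p'‖ ^ α :=
          mul_le_mul_of_nonneg_right (le_max_left _ _) h6
      _ ≤ max (g s - g s') 0 * max L (Lg * L) :=
          mul_le_mul_of_nonneg_left (h5.trans (le_max_left _ _)) (le_max_right _ _)
      _ = _ := mul_comm _ _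
  have e5 : Lg * (L * ‖p - p'‖) ≤ max L (Lg * L) * ‖p - p'‖ := by
    rw [← mul_assoc]
    exact mul_le_mul_of_nonneg_right (le_max_right _ _) (norm_nonneg _)
  have h5 := neg_le_of_abs_le e3
  have e6 : g s' * ‖p'‖ ^ α - g s * ‖p‖ ^ α =
      g s * (‖p'‖ ^ α - ‖p‖ ^ α) - (g s - g s') * ‖p'‖ ^ α := by ring
  show _ ≤ (G Y + g s' * ‖p'‖ ^ α) - (G X + g s * ‖p‖ ^ α)
  linarith

end GradientCase

section SlabSolutions
variable {E : Type*} [NormedAddCommGroup E] [InnerProductSpace ℝ E]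

theorem subJet_inner (e x : E) : SubJet (fun y => ⟪e, y⟫) x e 0 := by
  refine SubJet.of_le (Eventually.of_forall fun d => ?_)
  simp [inner_add_right]

theorem subJet_exp_inner {l : ℝ} (hl : 0 ≤ l) (e x : E) :
    SubJet (fun y => Real.exp (l * ⟪e, y⟫)) x ((l * Real.exp (l * ⟪e, x⟫)) • e)
      ((l ^ 2 * Real.exp (l * ⟪e, x⟫)) • rankOneSelf e) := by
  have h1 : ∀ t : ℝ, HasDerivAt (fun t => Real.exp (l * t)) (l * Real.exp (l * t)) t := fun t => by
    have := ((hasDerivAt_id t).const_mul l).exp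
    simpa [mul_comm] using this
  have h2 : ∀ t : ℝ, HasDerivAt (fun t => l * Real.exp (l * t)) (l ^ 2 * Real.exp (l * t)) t :=
    fun t => by
      have := (h1 t).const_mul l
      rwa [← mul_assoc, ← sq] at this
  have h3 := (subJet_inner e x).comp (g := fun y => ⟪e, y⟫) (U := Set.univ)
    (χ := fun t => Real.exp (l * t)) (by fun_prop) univ_mem
    (fun s _ t _ hst => Real.exp_le_exp.2 (mul_le_mul_of_nonneg_left hst hl))
    (by positivity) (lowerPeano_of_deriv (Eventually.of_forall h1) (h2 _))
  simpa using h3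

/-- Globally Lipschitz solutions with values in `[-1, 1]` of `G(D²v) + g(v)|∇v|^γ = 0` with a
positive lower bound for the gradient on each slab `|⟨e, x⟩| < R`, in terms of jets. -/
structure SlabSol (a A Lg Λ γ : ℝ) (G : (E →L[ℝ] E) → ℝ) (g : ℝ → ℝ) (e : E) (v : E → ℝ) :
    Prop where
  a_pos : 0 < a
  A_nonneg : 0 ≤ A
  elliptic : EllipticOp a A G
  Lg_nonneg : 0 ≤ Lg
  lip_g : ∀ s t, |g s - g t| ≤ Lg * |s - t|
  bound_g : ∀ s, |g s| ≤ Lg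
  norm_e : ‖e‖ = 1
  continuous : Continuous v
  bound : ∀ x, |v x| ≤ 1
  Λ_pos : 0 < Λ
  lip : ∀ x y, |v x - v y| ≤ Λ * ‖x - y‖
  jets : ∀ R, ∃ m > 0, ∀ z, |⟪e, z⟫| < R → ∀ p X,
    (SuperJet v z p X → m ≤ ‖p‖ ∧ 0 ≤ G X + g (v z) * ‖p‖ ^ γ) ∧
    (SubJet v z p X → m ≤ ‖p‖ ∧ G X + g (v z) * ‖p‖ ^ γ ≤ 0)

theorem abs_inner_le_norm_of_unit {e x : E} (he : ‖e‖ = 1) : |⟪e, x⟫| ≤ ‖x‖ := by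
  have := abs_real_inner_le_norm e x
  rwa [he, one_mul] at this

variable {a A Lg Λ γ : ℝ} {G : (E →L[ℝ] E) → ℝ} {g : ℝ → ℝ} {e : E} {v : E → ℝ}

theorem SlabSol.exists_jetSol (S : SlabSol a A Lg Λ γ G g e v) (R : ℝ) : ∃ m > 0,
    JetSol (fun p => m ≤ ‖p‖ ∧ ‖p‖ ≤ Λ) (fun s p X => G X + g s * ‖p‖ ^ γ)
      {z | |⟪e, z⟫| < R} v ∧ ∀ z ∈ {z | |⟪e, z⟫| < R}, ∀ p X, (SuperJet v z p X ∨ SubJet v z p X) →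
      m ≤ ‖p‖ ∧ ‖p‖ ≤ Λ := by
  obtain ⟨m, hm, h⟩ := S.jets R
  refine ⟨m, hm, fun x hx p X _ => ⟨fun h' => ((h x hx p X).1 h').2,
    fun h' => ((h x hx p X).2 h').2⟩, ?_⟩
  rintro z hz p X (h' | h')
  · exact ⟨((h z hz p X).1 h').1, h'.norm_le S.Λ_pos.le S.lip⟩
  · exact ⟨((h z hz p X).2 h').1, h'.norm_le S.Λ_pos.le S.lip⟩

theorem isOpen_slab (e : E) (R : ℝ) : IsOpen {z : E | |⟪e, z⟫| < R} :=
  isOpen_lt (by fun_prop) continuous_const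

theorem neg_sq_div_le {Λ j t : ℝ} (hj : 0 < j) : -(Λ ^ 2 / (4 * j)) ≤ j * t ^ 2 - Λ * t := by
  have h1 : 0 ≤ (2 * j * t - Λ) ^ 2 / (4 * j) := by positivity
  have h2 : (2 * j * t - Λ) ^ 2 / (4 * j) = j * t ^ 2 - Λ * t + Λ ^ 2 / (4 * j) := by
    field_simp; ring
  linarith

variable [FiniteDimensional ℝ E]

set_option maxHeartbeats 1000000 in
/-- A comparison principle for `v` and its translates: it is enough that the zero order term has
the right monotonicity at points where `v(y) < v(x)` and `y` is close to `x + g`. -/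
theorem SlabSol.le_translate_of_zone (S : SlabSol a A Lg Λ γ G g e v) {h : E}
    (hdecay : ∀ μ > 0, ∃ R, ∀ x, R ≤ |⟪e, x⟫| → |v (x + h) - v x| ≤ μ)
    (hzone : ∀ μ > 0, ∃ ρ > 0, ∀ x y, ‖y - x - h‖ ≤ ρ → v y ≤ v x - μ → g (v x) ≤ g (v y)) :
    ∀ x, v x ≤ v (x + h) := by
  by_contra! hcon
  obtain ⟨xb, hxb⟩ := hcon
  obtain ⟨μ, hμ0, hμ⟩ : ∃ μ > 0, v (xb + h) - v xb = -(3 * μ) :=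
    ⟨(v xb - v (xb + h)) / 3, by linarith, by ring⟩
  obtain ⟨ρ, hρ, hzone⟩ := hzone μ hμ0
  obtain ⟨R, hR⟩ := hdecay μ hμ0
  have hxR : |⟪e, xb⟫| < R := by
    by_contra! hc
    have := hR xb hc
    rw [hμ, abs_neg, abs_of_pos (by positivity)] at this
    linarith
  have ha := S.a_pos
  have hA := S.A_nonneg
  have hΛ := S.Λ_pos
  obtain ⟨m, hm, hsol, hQ⟩ := S.exists_jetSol (R + ‖h‖ + ρ + 1)
  obtain ⟨L, hL, hstr⟩ := exists_structCondMod_rpow (Λ := Λ) S.elliptic S.Lg_nonneg S.bound_g hm γ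
  obtain ⟨l, hl⟩ : ∃ l, l = L / a + 1 := ⟨_, rfl⟩
  have hl0 : 0 < l := by rw [hl]; positivity
  have hla : a * l = L + a := by rw [hl]; field_simp
  obtain ⟨j, hj⟩ : ∃ j, j = 3 / ρ ^ 2 + Λ ^ 2 / μ := ⟨_, rfl⟩
  have hj0 : 0 < j := by rw [hj]; positivity
  have hj1 : 3 ≤ j * ρ ^ 2 := by
    have : 3 / ρ ^ 2 * ρ ^ 2 = 3 := by field_simp
    have h2 : 0 ≤ Λ ^ 2 / μ * ρ ^ 2 := by positivity
    rw [hj, add_mul]; linarith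
  have hj2 : Λ ^ 2 / (4 * j) ≤ μ / 4 := by
    rw [div_le_div_iff₀ (by positivity) (by positivity)]
    have h1 : Λ ^ 2 / μ * μ = Λ ^ 2 := by field_simp
    have h2 : 0 ≤ 3 / ρ ^ 2 * μ := by positivity
    have h3 : j * μ = 3 / ρ ^ 2 * μ + Λ ^ 2 / μ * μ := by rw [hj]; ring
    linarith
  obtain ⟨ε, hε⟩ : ∃ ε, ε = μ / 4 * Real.exp (-(l * R)) := ⟨_, rfl⟩
  have hε0 : 0 < ε := by rw [hε]; positivity
  have hεR : ε * Real.exp (l * R) = μ / 4 := by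
    rw [hε, mul_assoc, ← Real.exp_add]; simp
  obtain ⟨δ, hδ⟩ : ∃ δ, δ = min (μ / 4 / smoothNorm xb)
    (a * ε * l * Real.exp (-(l * R)) / (2 * (a + A + L + 1))) := ⟨_, rfl⟩
  have hs1 := one_le_smoothNorm xb
  have hδ0 : 0 < δ := by
    rw [hδ]
    refine lt_min (by positivity) (by positivity)
  have hδ1 : δ * smoothNorm xb ≤ μ / 4 := by
    rw [← le_div_iff₀ (by positivity), hδ]
    exact min_le_left _ _
  have hδ2 : (a + A + L) * δ < a * ε * l * Real.exp (-(l * R)) := by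
    have h1 : δ ≤ a * ε * l * Real.exp (-(l * R)) / (2 * (a + A + L + 1)) := by
      rw [hδ]; exact min_le_right _ _
    rw [le_div_iff₀ (by positivity)] at h1
    have h2 : 0 < (a + A + L) * δ := by positivity
    linarith
  obtain ⟨Φ, hΦ⟩ : ∃ Φ : E × E → ℝ, Φ = fun z => v (z.1 + z.2) - v z.1 + j * ‖z.2 - h‖ ^ 2
    - ε * Real.exp (l * ⟪e, z.1⟫) + δ * smoothNorm z.1 := ⟨_, rfl⟩
  have hΦc : Continuous Φ := by
    have := S.continuous
    have := continuous_smoothNorm (E := E)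
    rw [hΦ]; fun_prop
  obtain ⟨T, hT⟩ : ∃ T : Set (E × E), T = {z | |⟪e, z.1⟫| ≤ R ∧ ‖z.2 - h‖ ≤ ρ} := ⟨_, rfl⟩
  have hTcl : IsClosed T := by
    rw [hT]
    refine IsClosed.and ?_ ?_
    · exact isClosed_le (by fun_prop) continuous_const
    · exact isClosed_le (by fun_prop) continuous_const
  have hbT : (xb, h) ∈ T := by
    rw [hT]; exact ⟨hxR.le, by simpa using hρ.le⟩
  have hexpR : ∀ x, |⟪e, x⟫| ≤ R → ε * Real.exp (l * ⟪e, x⟫) ≤ μ / 4 := fun x hx => by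
    rw [← hεR]
    have := (le_abs_self _).trans hx
    gcongr
  have hbound : ∀ x y, -2 ≤ v y - v x := fun x y => by
    have h1 := abs_le.1 (S.bound x)
    have h2 := abs_le.1 (S.bound y)
    linarith
  obtain ⟨⟨x₀, h₀⟩, hzT, hz0, hzmin⟩ := exists_min_of_bounded_sublevel hΦc hTcl hbT
    (isBounded_pairs (R := (Φ (xb, h) + 2 + μ / 4) / δ) (R' := ρ + ‖h‖) (by
      rintro ⟨x, k⟩ ⟨h1, h2⟩
      rw [hT] at h1
      obtain ⟨h3, h4⟩ := h1
      have e2 := norm_sub_norm_le k h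
      simp only at h3 h4 ⊢
      refine ⟨?_, by linarith⟩
      rw [le_div_iff₀ hδ0]
      have e3 := hexpR x h3
      have e4 := hbound x (x + k)
      have e5 := mul_le_mul_of_nonneg_left (norm_le_smoothNorm x) hδ0.le
      have e6 : 0 ≤ j * ‖k - h‖ ^ 2 := by positivity
      rw [hΦ] at h2 ⊢
      simp only at h2 ⊢
      linarith))
  rw [hT] at hzT
  obtain ⟨hx1, hh1⟩ := hzT
  simp only at hx1 hh1
  have hexb := hexpR x₀ hx1
  have hs0 := one_le_smoothNorm x₀
  have hτ : v (x₀ + h₀) - v x₀ + j * ‖h₀ - h‖ ^ 2 ≤ -(5 / 2 * μ) := by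
    have e1 : Φ (x₀, h₀) = v (x₀ + h₀) - v x₀ + j * ‖h₀ - h‖ ^ 2
      - ε * Real.exp (l * ⟪e, x₀⟫) + δ * smoothNorm x₀ := by rw [hΦ]
    have e2 : Φ (xb, h) = v (xb + h) - v xb + j * ‖h - h‖ ^ 2
      - ε * Real.exp (l * ⟪e, xb⟫) + δ * smoothNorm xb := by rw [hΦ]
    rw [sub_self, norm_zero] at e2
    have e3 : 0 ≤ ε * Real.exp (l * ⟪e, xb⟫) := by positivity
    have e4 : 0 ≤ δ * smoothNorm x₀ := by positivity
    linarith
  have hx1' : |⟪e, x₀⟫| < R := lt_of_le_of_ne hx1 fun hc => by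
    have e1 := neg_le_of_abs_le (hR x₀ hc.ge)
    have e2 := neg_le_of_abs_le (S.lip (x₀ + h₀) (x₀ + h))
    rw [add_sub_add_left_eq_sub] at e2
    have e3 := neg_sq_div_le (Λ := Λ) (t := ‖h₀ - h‖) hj0
    linarith
  have hh1' : ‖h₀ - h‖ < ρ := lt_of_le_of_ne hh1 fun hc => by
    rw [hc] at hτ
    have := hbound x₀ (x₀ + h₀)
    linarith
  have hτ' : v (x₀ + h₀) ≤ v x₀ - μ := by
    have : 0 ≤ j * ‖h₀ - h‖ ^ 2 := by positivity
    linarith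
  have hω := hzone x₀ (x₀ + h₀) (by rw [add_sub_cancel_left]; exact hh1) hτ'
  obtain ⟨b, D, hbD, hb1, hDk⟩ := exists_subJet_neg_smoothNorm x₀
  obtain ⟨ex, hex⟩ : ∃ ex, ex = Real.exp (l * ⟪e, x₀⟫) := ⟨_, rfl⟩
  have hexl : Real.exp (-(l * R)) ≤ ex := by
    rw [hex]
    apply Real.exp_le_exp.2
    have := mul_le_mul_of_nonneg_left (neg_le_of_abs_le hx1) hl0.le
    linarith
  have hex0 : 0 < ex := (Real.exp_pos _).trans_le hexl
  have hψ := ((subJet_neg_normSq h h₀).const_mul hj0.le)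
  have hβ := (((subJet_exp_inner hl0.le e x₀).const_mul hε0.le).add
    (hbD.const_mul hδ0.le)).const_add (Φ (x₀, h₀))
  rw [← hex] at hβ
  have hcont := contact_of_lower (v := v) (x₀ := x₀) (y₀ := x₀ + h₀)
    (by rw [add_sub_cancel_left]; exact hψ) hβ
    (by rw [hΦ]; simp only [add_sub_cancel_left]; ring)
    (by
      have hm : {z : E × E | |⟪e, z.1⟫| < R ∧ ‖(z.2 - z.1) - h‖ < ρ} ∈ 𝓝 (x₀, x₀ + h₀) := by
        refine IsOpen.mem_nhds (IsOpen.and ?_ ?_) ⟨hx1', by simpa using hh1'⟩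
        · exact isOpen_lt (by fun_prop) continuous_const
        · exact isOpen_lt (by fun_prop) continuous_const
      filter_upwards [hm] with z hz
      have h1 := hzmin (z.1, z.2 - z.1) (by rw [hT]; exact ⟨hz.1.le, hz.2.le⟩)
      have h2 : Φ (z.1, z.2 - z.1) = v (z.1 + (z.2 - z.1)) - v z.1 + j * ‖z.2 - z.1 - h‖ ^ 2
        - ε * Real.exp (l * ⟪e, z.1⟫) + δ * smoothNorm z.1 := by rw [hΦ]
      rw [add_sub_cancel] at h2
      linarith)
  have hΩ := isOpen_slab e (R + ‖h‖ + ρ + 1)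
  have hslab : ∀ x y, ‖x - y‖ ≤ 1 → |⟪e, y⟫| < R + ‖h‖ + ρ → |⟪e, x⟫| < R + ‖h‖ + ρ + 1 := by
    intro x y hxy hy
    have e1 := (abs_inner_le_norm_of_unit (x := x - y) S.norm_e).trans hxy
    have e2 : ⟪e, x⟫ = ⟪e, x - y⟫ + ⟪e, y⟫ := by rw [← inner_add_right, sub_add_cancel]
    rw [e2]
    exact (abs_add_le _ _).trans_lt (by linarith)
  have hn := norm_nonneg h
  have hxs : |⟪e, x₀⟫| < R + ‖h‖ + ρ := by linarith
  have hys : |⟪e, x₀ + h₀⟫| < R + ‖h‖ + ρ := by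
    have e1 := abs_inner_le_norm_of_unit (x := h₀) S.norm_e
    have e2 := norm_sub_norm_le h₀ h
    rw [inner_add_right]
    exact (abs_add_le _ _).trans_lt (by linarith)
  have hgc : Continuous g := by
    have : LipschitzWith ⟨Lg, S.Lg_nonneg⟩ g := LipschitzWith.of_dist_le_mul fun s t => by
      rw [Real.dist_eq, Real.dist_eq]; exact S.lip_g s t
    exact this.continuous
  have hest := contact_estimate_mod (by fun_prop) hstr ha.le hA hL S.continuous hΩ hsol
    (by simpa using hslab x₀ x₀ (by simp) hxs) (by simpa using hslab _ (x₀ + h₀) (by simp) hys)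
    hcont one_pos
    (fun x p X h1 _ h3 => hQ x (hslab _ _ h1 hxs) p X (Or.inl h3))
    (fun x p X h1 _ h3 => hQ x (hslab _ _ h1 hys) p X (Or.inr h3))
    (c₁ := δ) (c₃ := ε * (l ^ 2 * ex) - δ) hδ0.le
    (fun k => by
      rw [inner_add_clm, inner_smul_clm, inner_smul_clm, inner_smul_clm, inner_rankOneSelf]
      have e1 : 0 ≤ ε * (l ^ 2 * ex * ⟪e, k⟫ ^ 2) := by positivity
      have e2 := mul_le_mul_of_nonneg_left (hDk k) hδ0.le
      linarith) S.norm_e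
    (Or.inl (by
      rw [inner_add_clm, inner_smul_clm, inner_smul_clm, inner_smul_clm, inner_rankOneSelf,
        real_inner_self_eq_norm_sq, S.norm_e]
      have e2 := mul_le_mul_of_nonneg_left (hDk e) hδ0.le
      rw [S.norm_e] at e2
      linarith))
  have hb : ‖ε • (l * ex) • e + δ • b‖ ≤ ε * (l * ex) + δ := by
    refine (norm_add_le _ _).trans ?_
    rw [norm_smul, norm_smul, norm_smul, S.norm_e, Real.norm_eq_abs, Real.norm_eq_abs,
      Real.norm_eq_abs, abs_of_pos hε0, abs_of_pos hδ0, abs_of_pos (by positivity)]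
    have := mul_le_mul_of_nonneg_left hb1 hδ0.le
    linarith
  rw [max_eq_right (by linarith), mul_zero, add_zero] at hest
  have e1 := mul_le_mul_of_nonneg_left hb hL
  have e2 : a * (ε * (l ^ 2 * ex)) = (a * l) * (ε * (l * ex)) := by ring
  rw [hla] at e2
  have e3 : a * ε * l * Real.exp (-(l * R)) ≤ a * ε * l * ex :=
    mul_le_mul_of_nonneg_left hexl (by positivity)
  have e4 : a * (ε * (l ^ 2 * ex) - δ) = L * (ε * (l * ex)) + a * ε * l * ex - a * δ := by
    rw [mul_sub, e2]; ring
  linarith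

end SlabSolutions

section StrongMax
variable {E : Type*} [NormedAddCommGroup E] [InnerProductSpace ℝ E] [FiniteDimensional ℝ E]
variable {a A Lg Λ γ : ℝ} {G : (E →L[ℝ] E) → ℝ} {g : ℝ → ℝ} {e : E} {v : E → ℝ}

theorem lt_quadratic_of_lt {Λ θ σ j s : ℝ} (hΛ : 0 ≤ Λ) (hθ : 0 < θ) (hσ : 0 < σ)
    (hj : 2 * Λ / σ + 2 * θ / σ ^ 2 ≤ j) (hs : σ ≤ s) : θ + Λ * s < j * s ^ 2 := by
  have hs0 : 0 < s := hσ.trans_le hs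
  have h1 : 2 * Λ * s ≤ 2 * Λ / σ * s ^ 2 := by
    rw [div_mul_eq_mul_div, le_div_iff₀ hσ]
    have : 2 * Λ * s * σ ≤ 2 * Λ * s * s := by gcongr
    linarith
  have h2 : 2 * θ ≤ 2 * θ / σ ^ 2 * s ^ 2 := by
    rw [div_mul_eq_mul_div, le_div_iff₀ (by positivity)]
    gcongr
  have h3 := mul_le_mul_of_nonneg_right hj (sq_nonneg s)
  have h4 : 0 ≤ Λ * s := by positivity
  linarith

set_option maxHeartbeats 1000000 in
/-- Strong maximum principle in quantitative form, for the nonnegative difference of `v` and a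
translate of `v`. -/
theorem SlabSol.strong_max (S : SlabSol a A Lg Λ γ G g e v) (R H : ℝ) {D η : ℝ} (hD : 0 < D)
    (hη : 0 < η) : ∃ ε > 0, ∀ h y x, ‖h‖ ≤ H → |⟪e, y⟫| ≤ R → (∀ z, v z ≤ v (z + h)) →
      ‖x - y‖ ≤ D → v (x + h) - v x < ε → v (y + h) - v y < η := by
  have hΛ := S.Λ_pos
  obtain ⟨m, hm, hsol, hQ⟩ := S.exists_jetSol (R + H + D + 3)
  obtain ⟨L, hL, hstr⟩ := exists_structCond_rpow (Λ := Λ) S.elliptic S.Lg_nonneg S.lip_g S.bound_g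
    hm γ
  obtain ⟨r, hr⟩ : ∃ r, r = min (η / (8 * Λ)) D := ⟨_, rfl⟩
  have hr0 : 0 < r := by rw [hr]; exact lt_min (by positivity) hD
  have hrD : r ≤ D := by rw [hr]; exact min_le_right _ _
  have hrη : Λ * r ≤ η / 8 := by
    have h1 : r ≤ η / (8 * Λ) := by rw [hr]; exact min_le_left _ _
    rw [le_div_iff₀ (by positivity)] at h1
    linarith
  obtain ⟨κ, hκ, β, hβ, hbar⟩ := exists_barrier_bound (E := E) S.a_pos S.A_nonneg hL hr0 hrD
    (lt_add_one D)
  refine ⟨min (κ * (η / 8)) (η / 2), by positivity, ?_⟩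
  intro h y x hh hy hle hxy hwx
  by_contra! hwy
  have hlipw : ∀ x y, v (y + h) - v y - 2 * (Λ * ‖x - y‖) ≤ v (x + h) - v x := fun x y => by
    have h1 := neg_le_of_abs_le (S.lip (x + h) (y + h))
    have h2 := le_of_abs_le (S.lip x y)
    rw [add_sub_add_right_eq_sub] at h1
    linarith
  have hlip2 : ∀ x h', v (x + h) - v x - Λ * ‖h' - h‖ ≤ v (x + h') - v x := fun x h' => by
    have h1 := neg_le_of_abs_le (S.lip (x + h') (x + h))
    rw [add_sub_add_left_eq_sub] at h1
    linarith
  have hlt1 := hwx.trans_le (min_le_left _ _)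
  have hlt2 := hwx.trans_le (min_le_right _ _)
  rcases le_or_gt r ‖x - y‖ with hrx | hrx
  swap
  · have h1 := hlipw x y
    have h2 : Λ * ‖x - y‖ ≤ Λ * r := by gcongr
    linarith
  obtain ⟨θ, hθ⟩ : ∃ θ, θ = η / 8 := ⟨_, rfl⟩
  have hθ0 : 0 < θ := by rw [hθ]; positivity
  obtain ⟨ρ, hρ⟩ : ∃ ρ, ρ = min 1 (η / (8 * Λ)) := ⟨_, rfl⟩
  have hρ0 : 0 < ρ := by rw [hρ]; positivity
  have hρ1 : ρ ≤ 1 := by rw [hρ]; exact min_le_left _ _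
  have hρη : Λ * ρ ≤ η / 8 := by
    have h1 : ρ ≤ η / (8 * Λ) := by rw [hρ]; exact min_le_right _ _
    rw [le_div_iff₀ (by positivity)] at h1
    linarith
  obtain ⟨σ, hσ⟩ : ∃ σ, σ = κ * θ / Λ := ⟨_, rfl⟩
  have hσ0 : 0 < σ := by rw [hσ]; positivity
  have hσΛ : Λ * σ = κ * θ := by rw [hσ]; field_simp
  obtain ⟨j, hj⟩ : ∃ j, j = (2 * Λ / σ + 2 * θ / σ ^ 2) + (2 * Λ / ρ + 2 * θ / ρ ^ 2) := ⟨_, rfl⟩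
  have hj1 : 2 * Λ / σ + 2 * θ / σ ^ 2 ≤ j := by
    have : 0 < 2 * Λ / ρ + 2 * θ / ρ ^ 2 := by positivity
    linarith
  have hj2 : 2 * Λ / ρ + 2 * θ / ρ ^ 2 ≤ j := by
    have : 0 < 2 * Λ / σ + 2 * θ / σ ^ 2 := by positivity
    linarith
  have hj0 : 0 < j := lt_of_lt_of_le (by positivity) hj1
  have hjΛ : Λ ^ 2 / (4 * j) ≤ κ * θ := by
    rw [← hσΛ, div_le_iff₀ (by positivity)]
    have h1 := lt_quadratic_of_lt hΛ.le hθ0 hσ0 hj1 le_rfl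
    have h2 : Λ * σ ≤ j * σ ^ 2 := by linarith
    have h3 : Λ ≤ j * σ := by
      have : Λ * σ ≤ (j * σ) * σ := by linarith
      exact le_of_mul_le_mul_right this hσ0
    have h4 := mul_le_mul_of_nonneg_left h3 hΛ.le
    have h5 : 0 ≤ Λ * (j * σ) := by positivity
    linarith
  obtain ⟨ψ, hψ⟩ : ∃ ψ : E → ℝ, ψ = fun h' => -(Λ ^ 2 / (4 * j)) + j * -‖h' - h‖ ^ 2 := ⟨_, rfl⟩
  have hψe : ∀ h', ψ h' = -(Λ ^ 2 / (4 * j)) - j * ‖h' - h‖ ^ 2 := fun h' => by rw [hψ]; ring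
  have hψc : Continuous ψ := by rw [hψ]; fun_prop
  have hpos : 0 < Λ ^ 2 / (4 * j) := by positivity
  have hψ0 : ∀ h', ψ h' ≤ 0 := fun h' => by
    have : 0 ≤ j * ‖h' - h‖ ^ 2 := by positivity
    rw [hψe]; linarith
  have hΩ : ∀ z, |⟪e, z⟫| < R + H + D + 3 ↔ z ∈ {z | |⟪e, z⟫| < R + H + D + 3} := fun z => Iff.rfl
  have hH : 0 ≤ H := (norm_nonneg h).trans hh
  have hin : ∀ x, ‖x - y‖ ≤ D + 1 → |⟪e, x⟫| ≤ R + D + 1 := fun x hx => by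
    have e1 := (abs_inner_le_norm_of_unit (x := x - y) S.norm_e).trans hx
    have e2 : ⟪e, x⟫ = ⟪e, x - y⟫ + ⟪e, y⟫ := by rw [← inner_add_right, sub_add_cancel]
    rw [e2]
    exact (abs_add_le _ _).trans (by linarith)
  have := hbar hstr S.continuous (isOpen_slab e _) hsol hψc hθ0 hρ0 (y := y) (g := h)
    (fun x hx => (hΩ x).1 (by linarith [hin x hx]))
    (fun x h' hx hh' => by
      rw [← hΩ, inner_add_right]
      have e1 := abs_inner_le_norm_of_unit (x := h') S.norm_e
      have e2 := norm_sub_norm_le h' h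
      have e3 := hin x hx
      exact (abs_add_le _ _).trans_lt (by linarith))
    (fun x h' _ _ => by
      have e1 := hlip2 x h'
      have e2 := hle x
      have e3 := neg_sq_div_le (Λ := Λ) (t := ‖h' - h‖) hj0
      rw [hψe]
      linarith)
    (fun x h' _ hh' => by
      have e1 := hlip2 x h'
      have e2 := hle x
      have e3 := lt_quadratic_of_lt hΛ.le hθ0 hρ0 hj2 le_rfl
      rw [hψe, hh']
      rw [hh'] at e1
      linarith)
    (fun x h' t _ _ ht0 ht1 hv => by
      have e4 : θ * t ≤ θ := mul_le_of_le_one_right hθ0.le ht1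
      have e5 : 0 ≤ θ * t := by positivity
      have e6 := hψ0 h'
      have e7 : 0 < κ * θ := by positivity
      refine ⟨?_, by linarith⟩
      have e1 := hlip2 x h'
      have e2 := hle x
      have e3 : ‖h' - h‖ ≤ σ := by
        by_contra! hc
        have e3 := lt_quadratic_of_lt hΛ.le hθ0 hσ0 hj1 hc.le
        rw [hψe] at hv
        linarith
      have e8 : Λ * ‖h' - h‖ ≤ Λ * σ := by gcongr
      linarith)
    (by rw [hψe, sub_self, norm_zero]; linarith)
    (fun x h' hx hh' => by
      have e1 := hlip2 x h'
      have e2 := hlipw x y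
      rw [hx] at e2
      have e3 : Λ * ‖h' - h‖ ≤ Λ * ρ := by gcongr
      have e4 := hψ0 h'
      linarith)
    (fun x h' _ _ _ => ⟨_, _, by
        rw [hψ]
        exact ((subJet_neg_normSq h h').const_mul hj0.le).const_add _, 1, one_pos,
      fun z hz p X _ hpX => hQ z hz p X hpX⟩) x hrx hxy
  rw [← hθ] at hlt1
  linarith

end StrongMax

section GradientSliding
variable {E : Type*} [NormedAddCommGroup E] [InnerProductSpace ℝ E] [FiniteDimensional ℝ E]
variable {a A Lg Λ γ : ℝ} {G : (E →L[ℝ] E) → ℝ} {g : ℝ → ℝ} {e : E} {v : E → ℝ}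

theorem le_inner_of_norm_sub_le {e x y h : E} (he : ‖e‖ = 1) {ρ : ℝ} (h1 : ‖y - x - h‖ ≤ ρ) :
    ⟪e, x⟫ + ⟪e, h⟫ - ρ ≤ ⟪e, y⟫ := by
  have h2 := neg_le_of_abs_le ((abs_inner_le_norm_of_unit (x := y - x - h) he).trans h1)
  rw [inner_sub_right, inner_sub_right] at h2
  linarith

set_option maxHeartbeats 1000000 in
theorem SlabSol.le_translate (S : SlabSol a A Lg Λ γ G g e v) {δ₀ : ℝ} (hδ₀ : 0 < δ₀)
    (hneg : AntitoneOn g (Set.Icc (-1) (-1 + δ₀))) (hpos : AntitoneOn g (Set.Icc (1 - δ₀) 1))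
    (hlimPos : ∀ ε > (0:ℝ), ∃ R : ℝ, ∀ x, R ≤ ⟪e, x⟫ → |v x - 1| < ε)
    (hlimNeg : ∀ ε > (0:ℝ), ∃ R : ℝ, ∀ x, ⟪e, x⟫ ≤ R → |v x + 1| < ε)
    {h : E} (hh : 0 < ⟪e, h⟫) (x : E) : v x ≤ v (x + h) := by
  have hlim : ∀ ε > (0:ℝ), ∃ R ≥ (0:ℝ), (∀ x, R ≤ ⟪e, x⟫ → |v x - 1| < ε) ∧
      ∀ x, ⟪e, x⟫ ≤ -R → |v x + 1| < ε := by
    intro ε hε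
    obtain ⟨R, hR⟩ := hlimPos ε hε
    obtain ⟨R', hR'⟩ := hlimNeg ε hε
    have e1 : R ≤ max 0 (max R (-R')) := (le_max_left _ _).trans (le_max_right _ _)
    have e2 : -R' ≤ max 0 (max R (-R')) := (le_max_right _ _).trans (le_max_right _ _)
    exact ⟨max 0 (max R (-R')), le_max_left _ _, fun x hx => hR x (e1.trans hx),
      fun x hx => hR' x (by linarith)⟩
  have hdecay : ∀ h : E, ∀ μ > 0, ∃ R, ∀ x, R ≤ |⟪e, x⟫| → |v (x + h) - v x| ≤ μ := by
    intro h μ hμ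
    obtain ⟨R, hR0, hR1, hR2⟩ := hlim (μ / 2) (by positivity)
    have e1 := abs_le.1 (abs_inner_le_norm_of_unit (x := h) S.norm_e)
    have hn := norm_nonneg h
    refine ⟨R + ‖h‖, fun x hx => ?_⟩
    rcases le_abs'.1 hx with h1 | h1
    · have h2 := abs_lt.1 (hR2 x (by linarith))
      have h3 := abs_lt.1 (hR2 (x + h) (by rw [inner_add_right]; linarith))
      rw [abs_le]; constructor <;> linarith
    · have h2 := abs_lt.1 (hR1 x (by linarith))
      have h3 := abs_lt.1 (hR1 (x + h) (by rw [inner_add_right]; linarith))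
      rw [abs_le]; constructor <;> linarith
  obtain ⟨R₁, hR₁, hRp, hRn⟩ := hlim δ₀ hδ₀
  have hzone : ∀ x y, v y ≤ v x → (⟪e, x⟫ ≤ -R₁ ∨ R₁ ≤ ⟪e, y⟫) → g (v x) ≤ g (v y) := by
    intro x y hxy h1
    have hx := abs_le.1 (S.bound x)
    have hy := abs_le.1 (S.bound y)
    rcases h1 with h1 | h1
    · have h2 := abs_lt.1 (hRn x h1)
      exact hneg ⟨hy.1, by linarith⟩ ⟨hx.1, by linarith⟩ hxy
    · have h2 := abs_lt.1 (hRp y h1)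
      exact hpos ⟨by linarith, hy.2⟩ ⟨by linarith, hx.2⟩ hxy
  have hfar : ∀ h : E, 2 * (R₁ + 1) ≤ ⟪e, h⟫ → ∀ x, v x ≤ v (x + h) := by
    intro h hh
    refine S.le_translate_of_zone (hdecay h) fun μ hμ => ⟨1, one_pos, fun x y hxy hv =>
      hzone x y (by linarith) ?_⟩
    have h1 := le_inner_of_norm_sub_le S.norm_e hxy
    by_contra! hc
    linarith [hc.1, hc.2]
  have hΛ := S.Λ_pos
  have hnear : ∀ h : E, 0 ≤ ⟪e, h⟫ → (∀ x, |⟪e, x⟫| ≤ R₁ + 1 → v x ≤ v (x + h)) →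
      ∀ x, v x ≤ v (x + h) := by
    intro h hh hle
    refine S.le_translate_of_zone (hdecay h) fun μ hμ => ⟨min 1 (μ / (2 * Λ)), by positivity,
      fun x y hxy hv => hzone x y (by linarith) ?_⟩
    have h1 := le_inner_of_norm_sub_le S.norm_e (hxy.trans (min_le_left _ _))
    by_contra! hc
    have h2 := hle x (by rw [abs_le]; constructor <;> linarith [hc.1, hc.2])
    have h3 := neg_le_of_abs_le (S.lip y (x + h))
    rw [sub_add_eq_sub_sub] at h3
    have h4 : Λ * ‖y - x - h‖ ≤ Λ * (μ / (2 * Λ)) := by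
      gcongr
      exact hxy.trans (min_le_right _ _)
    have h5 : Λ * (μ / (2 * Λ)) = μ / 2 := by field_simp
    linarith
  by_contra! hcon
  have hee : ⟪e, e⟫ = 1 := by rw [real_inner_self_eq_norm_sq, S.norm_e]; norm_num
  obtain ⟨T, hT⟩ : ∃ T : Set ℝ, T = {t | 0 ≤ t ∧ ∃ x, v (x + (h + t • e)) < v x} := ⟨_, rfl⟩
  have hT0 : (0:ℝ) ∈ T := by rw [hT]; exact ⟨le_rfl, x, by simpa using hcon⟩
  have hTb : BddAbove T := by
    refine ⟨2 * (R₁ + 1), fun t ht => ?_⟩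
    rw [hT] at ht
    obtain ⟨-, x, hx⟩ := ht
    by_contra! hc
    refine absurd (hfar (h + t • e) ?_ x) (not_le.2 hx)
    rw [inner_add_right, real_inner_smul_right, hee]
    linarith
  obtain ⟨s, hs⟩ : ∃ s, s = sSup T := ⟨_, rfl⟩
  have hs0 : 0 ≤ s := by rw [hs]; exact le_csSup hTb hT0
  obtain ⟨k, hk⟩ : ∃ k, k = h + s • e := ⟨_, rfl⟩
  have hk0 : 0 < ⟪e, k⟫ := by
    rw [hk, inner_add_right, real_inner_smul_right, hee]; linarith
  have hkle : ∀ z, v z ≤ v (z + k) := by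
    intro z
    have hc : Continuous fun t : ℝ => v (z + (h + t • e)) := by
      have := S.continuous
      fun_prop
    have h1 : Tendsto (fun t : ℝ => v (z + (h + t • e))) (𝓝[>] s) (𝓝 (v (z + k))) := by
      rw [hk]
      exact (hc.tendsto s).mono_left nhdsWithin_le_nhds
    refine ge_of_tendsto h1 (eventually_nhdsWithin_of_forall fun t ht => ?_)
    have ht' : s < t := ht
    by_contra! hc
    have h2 : t ∈ T := by rw [hT]; exact ⟨by linarith, z, hc⟩
    have h3 := le_csSup hTb h2
    rw [← hs] at h3
    linarith
  obtain ⟨R₂, hR₂, hQp, hQn⟩ := hlim (1 / 2) (by norm_num)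
  obtain ⟨n, hn⟩ := exists_nat_ge ((R₂ + R₁ + 1) / ⟪e, k⟫ + 1)
  have hn1 : (R₂ + R₁ + 1) / ⟪e, k⟫ ≤ n := by linarith
  have hn0 : (0:ℝ) < n := by
    have : 0 ≤ (R₂ + R₁ + 1) / ⟪e, k⟫ := by positivity
    linarith
  rw [div_le_iff₀ hk0] at hn1
  obtain ⟨ε, hε, hsmp⟩ := S.strong_max (R₁ + 1 + n * ‖k‖) ‖k‖ (D := n * ‖k‖ + 1)
    (η := 1 / (2 * n)) (by positivity) (by positivity)
  obtain ⟨t, htT, hts⟩ := exists_lt_of_lt_csSup ⟨0, hT0⟩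
    (show s - ε / Λ < sSup T by rw [← hs]; linarith [div_pos hε hΛ])
  have hts' : t ≤ s := by rw [hs]; exact le_csSup hTb htT
  rw [hT] at htT
  obtain ⟨ht0, z, hz⟩ := htT
  obtain ⟨x₀, hx₀, hwx₀⟩ : ∃ x, |⟪e, x⟫| ≤ R₁ + 1 ∧ v (x + (h + t • e)) < v x := by
    by_contra! hc
    refine absurd (hnear (h + t • e) ?_ hc z) (not_le.2 hz)
    rw [inner_add_right, real_inner_smul_right, hee]
    linarith
  have hw : v (x₀ + k) - v x₀ < ε := by
    have h1 := le_of_abs_le (S.lip (x₀ + k) (x₀ + (h + t • e)))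
    have h2 : x₀ + k - (x₀ + (h + t • e)) = (s - t) • e := by rw [hk, sub_smul]; abel
    rw [h2, norm_smul, S.norm_e, Real.norm_eq_abs, abs_of_nonneg (by linarith), mul_one] at h1
    have h3 : Λ * (s - t) < Λ * (ε / Λ) := mul_lt_mul_of_pos_left (by linarith) hΛ
    rw [mul_div_cancel₀ _ hΛ.ne'] at h3
    linarith
  obtain ⟨y, hy⟩ : ∃ y : ℕ → E, y = fun i : ℕ => x₀ + ((i:ℝ) - n) • k := ⟨_, rfl⟩
  have hysucc : ∀ i, y (i + 1) = y i + k := fun i => by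
    rw [hy]; push_cast; module
  have hsum : ∑ i ∈ Finset.range (2 * n), (v (y (i + 1)) - v (y i)) = v (y (2 * n)) - v (y 0) :=
    Finset.sum_range_sub (fun i => v (y i)) (2 * n)
  have hx₀' := abs_le.1 hx₀
  have hlt : ∑ i ∈ Finset.range (2 * n), (v (y (i + 1)) - v (y i)) <
      ∑ _i ∈ Finset.range (2 * n), 1 / (2 * (n:ℝ)) := by
    apply Finset.sum_lt_sum_of_nonempty
    · rw [Finset.nonempty_range_iff]
      have : n ≠ 0 := by rintro rfl; simp at hn0
      omega
    · intro i hi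
      rw [Finset.mem_range] at hi
      have hi' : (i:ℝ) ≤ 2 * n := by exact_mod_cast hi.le
      have hin : |(i:ℝ) - n| ≤ n := by
        rw [abs_le]; constructor <;> linarith [(Nat.cast_nonneg i : (0:ℝ) ≤ i)]
      have hnk : ‖((i:ℝ) - n) • k‖ ≤ n * ‖k‖ := by
        rw [norm_smul, Real.norm_eq_abs]; gcongr
      rw [hysucc]
      refine hsmp k (y i) x₀ le_rfl ?_ hkle ?_ hw
      · rw [hy]
        simp only [inner_add_right]
        refine (abs_add_le _ _).trans (add_le_add hx₀ ?_)
        exact (abs_inner_le_norm_of_unit S.norm_e).trans hnk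
      · rw [hy]
        simp only [sub_add_cancel_left, norm_neg]
        linarith
  rw [hsum, Finset.sum_const, Finset.card_range, nsmul_eq_mul] at hlt
  have h1 : ((2 * n : ℕ) : ℝ) * (1 / (2 * n)) = 1 := by push_cast; field_simp
  rw [h1] at hlt
  have h2 : ⟪e, y (2 * n)⟫ = ⟪e, x₀⟫ + n * ⟪e, k⟫ := by
    rw [hy]; simp only [inner_add_right, real_inner_smul_right]; push_cast; ring
  have h3 : ⟪e, y 0⟫ = ⟪e, x₀⟫ - n * ⟪e, k⟫ := by
    rw [hy]; simp only [inner_add_right, real_inner_smul_right]; push_cast; ring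
  have h4 := abs_lt.1 (hQp (y (2 * n)) (by rw [h2]; linarith))
  have h5 := abs_lt.1 (hQn (y 0) (by rw [h3]; linarith))
  linarith

end GradientSliding

section GradientBound

theorem exists_rpow_neg_le {α : ℝ} (hα : -1 < α) : ∃ C, 0 ≤ C ∧ ∀ s : ℝ, 1 / 2 ≤ s →
    s ^ (-α) ≤ C * (1 + s ^ 2) := by
  refine ⟨max 1 ((1 / 2 : ℝ) ^ (-α)), by positivity, fun s hs => ?_⟩
  have hs0 : 0 < s := by linarith
  have h0 : 1 ≤ 1 + s ^ 2 := by nlinarith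
  have h1 : (1:ℝ) ≤ max 1 ((1 / 2 : ℝ) ^ (-α)) := le_max_left _ _
  have h2 : s ^ (-α) ≤ max 1 ((1 / 2 : ℝ) ^ (-α)) ∨ s ^ (-α) ≤ s ^ 2 := by
    rcases le_or_gt 0 α with h | h
    · exact Or.inl ((Real.rpow_le_rpow_of_nonpos (by norm_num) hs (by linarith)).trans
        (le_max_right _ _))
    · rcases le_or_gt s 1 with h' | h'
      · exact Or.inl ((Real.rpow_le_one hs0.le h' (by linarith)).trans h1)
      · right
        rw [← Real.rpow_natCast]
        exact Real.rpow_le_rpow_of_exponent_le h'.le (by push_cast; linarith)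
  have h3 : 0 ≤ (max 1 ((1 / 2 : ℝ) ^ (-α)) - 1) * s ^ 2 :=
    mul_nonneg (by linarith) (sq_nonneg s)
  rcases h2 with h2 | h2
  · have : 0 ≤ max 1 ((1 / 2 : ℝ) ^ (-α)) * s ^ 2 := by positivity
    linarith
  · linarith

theorem inner_single_zero {N : ℕ} [NeZero N] (x : ESp N) :
    ⟪EuclideanSpace.single (0 : Fin N) (1 : ℝ), x⟫ = x 0 := by
  simp [EuclideanSpace.inner_single_left]

variable {N : ℕ} {a A α : ℝ} {Ftil : Matrix (Fin N) (Fin N) ℝ → ℝ} {f : ℝ → ℝ} {u : ESp N → ℝ}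

theorem jets_of_viscSol (hG : EllipticOp a A (fun X : ESp N →L[ℝ] ESp N => Ftil (opMat X)))
    (hrange : ∀ x, u x ∈ Set.Icc (-1 : ℝ) 1)
    (hsol : ViscSol α Ftil (fun _ s => -f s) Set.univ u) {x p : ESp N}
    {X : ESp N →L[ℝ] ESp N} (hp : p ≠ 0) :
    (SuperJet u x p X → 0 ≤ Ftil (opMat X) + clipExt f (u x) * ‖p‖ ^ (-α)) ∧
    (SubJet u x p X → Ftil (opMat X) + clipExt f (u x) * ‖p‖ ^ (-α) ≤ 0) := by
  rw [clipExt_eq (hrange x)]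
  have hp0 := norm_pos_iff.2 hp
  have hpow : 0 < ‖p‖ ^ (-α) := Real.rpow_pos_of_pos hp0 _
  have hmul : ‖p‖ ^ (-α) * ‖p‖ ^ α = 1 := by
    rw [← Real.rpow_add hp0, neg_add_cancel, Real.rpow_zero]
  have hmul' : ‖p‖ ^ (-α) * (‖p‖ ^ α * Ftil (opMat X)) = Ftil (opMat X) := by
    rw [← mul_assoc, hmul, one_mul]
  constructor
  · intro h
    have h1 := mul_le_mul_of_nonneg_left
      (hsol.1.le_of_superJet hG (Set.mem_univ x) hp h) hpow.le
    rw [hmul'] at h1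
    linarith
  · intro h
    have h1 := mul_le_mul_of_nonneg_left
      (hsol.2.le_of_subJet hG (Set.mem_univ x) hp h) hpow.le
    rw [hmul'] at h1
    linarith

theorem le_translate_of_gradGE [NeZero N] (ha : 0 < a) (haA : a ≤ A) (hα : -1 < α)
    (hF : UniformlyElliptic N a A Ftil) (hf : ContDiffOn ℝ 1 f (Set.Icc (-1) 1))
    {δ₀ : ℝ} (hδ₀ : δ₀ ∈ Set.Ioo (0:ℝ) 1)
    (hmonoNeg : AntitoneOn f (Set.Icc (-1) (-1 + δ₀)))
    (hmonoPos : AntitoneOn f (Set.Icc (1 - δ₀) 1)) (hu : Continuous u)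
    (hrange : ∀ x, u x ∈ Set.Icc (-1 : ℝ) 1)
    (hsol : ViscSol α Ftil (fun _ s => -f s) Set.univ u)
    (hlimPos : ∀ ε > (0:ℝ), ∃ R : ℝ, ∀ x : ESp N, R ≤ x 0 → |u x - 1| < ε)
    (hlimNeg : ∀ ε > (0:ℝ), ∃ R : ℝ, ∀ x : ESp N, x 0 ≤ R → |u x + 1| < ε)
    (hgrad : ∀ b c : ℝ, b < c →
      ∃ m > (0:ℝ), GradGE m {x : ESp N | x 0 ∈ Set.Icc b c} u)
    {h : ESp N} (hh : 0 < h 0) (x : ESp N) : u x ≤ u (x + h) := by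
  have hG := hF.ellipticOp ha
  have hA : 0 ≤ A * N := mul_nonneg (ha.le.trans haA) (Nat.cast_nonneg N)
  obtain ⟨Lg, hLg, hg1, hg2⟩ := exists_clipExt_bounds hf
  obtain ⟨C, hC, hCs⟩ := exists_rpow_neg_le hα
  have hub : ∀ x, |u x| ≤ 1 := fun x => abs_le.2 (hrange x)
  obtain ⟨Λ, hΛ, hlip⟩ := exists_lipschitz_of_jets hG ha hA hu (B := 2) (C := Lg * C)
    (by positivity)
    (fun x y _ => by linarith [(hrange x).2, (hrange y).1])
    (fun x p X hp => by
      have hp0 : p ≠ 0 := norm_pos_iff.1 (by linarith)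
      have h1 := jets_of_viscSol hG hrange hsol (x := x) (X := X) hp0
      have h2 : |clipExt f (u x) * ‖p‖ ^ (-α)| ≤ Lg * C * (1 + ‖p‖ ^ 2) := by
        rw [abs_mul, mul_assoc]
        refine mul_le_mul (hg2 _) ?_ (abs_nonneg _) hLg
        rw [abs_of_nonneg (Real.rpow_nonneg (norm_nonneg p) _)]
        exact hCs _ hp
      have h3 := abs_le.1 h2
      exact ⟨fun h => by linarith [h1.1 h, h3.2], fun h => by linarith [h1.2 h, h3.1]⟩)
  have hS : SlabSol a (A * N) Lg (Λ + 1) (-α) (fun X : ESp N →L[ℝ] ESp N => Ftil (opMat X))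
      (clipExt f) (EuclideanSpace.single (0 : Fin N) (1 : ℝ)) u :=
    { a_pos := ha
      A_nonneg := hA
      elliptic := hG
      Lg_nonneg := hLg
      lip_g := hg1
      bound_g := hg2
      norm_e := by simp
      continuous := hu
      bound := hub
      Λ_pos := by positivity
      lip := fun x y => (hlip x y).trans (by gcongr; linarith)
      jets := fun R => by
        obtain ⟨m, hm, hgm⟩ := hgrad (-(|R| + 1)) (|R| + 1) (by linarith [abs_nonneg R])
        refine ⟨m, hm, fun z hz p X => ?_⟩
        rw [inner_single_zero] at hz
        have hz' : z ∈ {x : ESp N | x 0 ∈ Set.Icc (-(|R| + 1)) (|R| + 1)} := by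
          have h1 := abs_lt.1 hz
          have h2 := le_abs_self R
          constructor <;> linarith
        refine ⟨fun h => ?_, fun h => ?_⟩
        · have h1 := hgm.le_of_superJet hz' h
          exact ⟨h1, (jets_of_viscSol hG hrange hsol
            (norm_pos_iff.1 (hm.trans_le h1))).1 h⟩
        · have h1 := hgm.le_of_subJet hz' h
          exact ⟨h1, (jets_of_viscSol hG hrange hsol
            (norm_pos_iff.1 (hm.trans_le h1))).2 h⟩ }
  have hδ := hδ₀.1
  have hδ' := hδ₀.2
  refine hS.le_translate hδ ?_ ?_ ?_ ?_ (by rwa [inner_single_zero]) x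
  · intro s hs t ht hst
    rw [clipExt_eq ⟨hs.1, by linarith [hs.2]⟩, clipExt_eq ⟨ht.1, by linarith [ht.2]⟩]
    exact hmonoNeg hs ht hst
  · intro s hs t ht hst
    rw [clipExt_eq ⟨by linarith [hs.1], hs.2⟩, clipExt_eq ⟨by linarith [ht.1], ht.2⟩]
    exact hmonoPos hs ht hst
  · simpa only [inner_single_zero] using hlimPos
  · simpa only [inner_single_zero] using hlimNeg

end GradientBound

section Profiles

theorem strictMonoOn_Ioo_of_hasDerivAt {Z Z' : ℝ → ℝ} {l r : ℝ}
    (hZ : ∀ s ∈ Set.Ioo l r, HasDerivAt Z (Z' s) s) (hpos : ∀ s ∈ Set.Ioo l r, 0 < Z' s) :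
    StrictMonoOn Z (Set.Ioo l r) := by
  refine strictMonoOn_of_deriv_pos (convex_Ioo l r)
    (fun s hs => (hZ s hs).continuousAt.continuousWithinAt) fun s hs => ?_
  rw [interior_Ioo] at hs
  rw [(hZ s hs).deriv]
  exact hpos s hs

/-- The inverse of a function with positive derivative on an interval. -/
theorem exists_inverse_of_hasDerivAt {Z Z' : ℝ → ℝ} {l r : ℝ}
    (hZ : ∀ s ∈ Set.Ioo l r, HasDerivAt Z (Z' s) s) (hpos : ∀ s ∈ Set.Ioo l r, 0 < Z' s) :
    ∃ χ : ℝ → ℝ, (∀ s ∈ Set.Ioo l r, χ (Z s) = s) ∧ ∀ s ∈ Set.Ioo l r,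
      ∀ᶠ t in 𝓝 (Z s), t ∈ Z '' Set.Ioo l r ∧ HasDerivAt χ (Z' (χ t))⁻¹ t := by
  have hmono := strictMonoOn_Ioo_of_hasDerivAt hZ hpos
  have hleft : ∀ s ∈ Set.Ioo l r, Function.invFunOn Z (Set.Ioo l r) (Z s) = s :=
    fun s hs => hmono.injOn.leftInvOn_invFunOn hs
  have hopen : ∀ s ∈ Set.Ioo l r, ∀ U ∈ 𝓝 s, Z '' (U ∩ Set.Ioo l r) ∈ 𝓝 (Z s) := by
    intro s hs U hU
    have hU' : U ∩ Set.Ioo l r ∈ 𝓝 s := inter_mem hU (Ioo_mem_nhds hs.1 hs.2)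
    obtain ⟨ε, hε, hball⟩ := Metric.mem_nhds_iff.1 hU'
    have hsub : Set.Icc (s - ε / 2) (s + ε / 2) ⊆ U ∩ Set.Ioo l r := fun t ht => hball (by
      rw [mem_ball, Real.dist_eq, abs_lt]; constructor <;> linarith [ht.1, ht.2])
    have h1 : s - ε / 2 ∈ Set.Ioo l r := (hsub ⟨le_rfl, by linarith⟩).2
    have h2 : s + ε / 2 ∈ Set.Ioo l r := (hsub ⟨by linarith, le_rfl⟩).2
    have h3 : Z (s - ε / 2) < Z s := hmono h1 hs (by linarith)
    have h4 : Z s < Z (s + ε / 2) := hmono hs h2 (by linarith)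
    refine mem_of_superset (Icc_mem_nhds h3 h4) ?_
    refine (intermediate_value_Icc (by linarith) ?_).trans (Set.image_mono hsub)
    exact fun t ht => (hZ t (hsub ht).2).continuousAt.continuousWithinAt
  refine ⟨Function.invFunOn Z (Set.Ioo l r), hleft, fun s hs => ?_⟩
  have h5 := hopen s hs Set.univ univ_mem
  rw [Set.univ_inter] at h5
  filter_upwards [eventually_mem_nhds_iff.2 h5] with t ht
  refine ⟨mem_of_mem_nhds ht, ?_⟩
  obtain ⟨σ, hσ, rfl⟩ := mem_of_mem_nhds ht
  rw [hleft σ hσ]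
  refine HasDerivAt.of_local_left_inverse ?_ (by rw [hleft σ hσ]; exact hZ σ hσ) (hpos σ hσ).ne' ?_
  · intro V hV
    rw [hleft σ hσ] at hV
    refine Filter.mem_map.2 (mem_of_superset (hopen σ hσ V hV) ?_)
    rintro _ ⟨τ, ⟨hτV, hτ⟩, rfl⟩
    rw [Set.mem_preimage, hleft τ hτ]
    exact hτV
  · filter_upwards [ht] with τ hτ
    exact Function.invFunOn_eq hτ

/-- `Z` is an antiderivative of `1/√(2P)` on `(l, r)`, where `P` is positive with derivative
`P'`. The inverse of `Z` then solves `φ'' = P'(φ)` and `φ'² = 2P(φ)`. -/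
structure ArcLength (l r : ℝ) (P P' Z : ℝ → ℝ) : Prop where
  pos : ∀ s ∈ Set.Ioo l r, 0 < P s
  hasDerivAt_P : ∀ s ∈ Set.Ioo l r, HasDerivAt P (P' s) s
  hasDerivAt_Z : ∀ s ∈ Set.Ioo l r, HasDerivAt Z (√(2 * P s))⁻¹ s

variable {l r : ℝ} {P P' Z : ℝ → ℝ}

theorem ArcLength.sqrt_pos (h : ArcLength l r P P' Z) {s : ℝ} (hs : s ∈ Set.Ioo l r) :
    0 < √(2 * P s) := Real.sqrt_pos.2 (by linarith [h.pos s hs])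

theorem ArcLength.strictMonoOn (h : ArcLength l r P P' Z) : StrictMonoOn Z (Set.Ioo l r) :=
  strictMonoOn_Ioo_of_hasDerivAt h.hasDerivAt_Z fun _ hs => inv_pos.2 (h.sqrt_pos hs)

theorem ArcLength.exists_inverse (h : ArcLength l r P P' Z) :
    ∃ χ : ℝ → ℝ, (∀ s ∈ Set.Ioo l r, χ (Z s) = s) ∧ ∀ s ∈ Set.Ioo l r,
      (∀ᶠ t in 𝓝 (Z s), t ∈ Z '' Set.Ioo l r ∧ HasDerivAt χ (√(2 * P (χ t))) t) ∧
      HasDerivAt (fun t => √(2 * P (χ t))) (P' s) (Z s) := by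
  obtain ⟨χ, h1, h2⟩ := exists_inverse_of_hasDerivAt h.hasDerivAt_Z
    fun s hs => inv_pos.2 (h.sqrt_pos hs)
  simp only [inv_inv] at h2
  refine ⟨χ, h1, fun s hs => ⟨h2 s hs, ?_⟩⟩
  have h3 := (h2 s hs).self_of_nhds.2
  have h4 := h.hasDerivAt_P s hs
  have h5 : HasDerivAt (fun t => 2 * P (χ t)) (2 * (P' s * √(2 * P s))) (Z s) := by
    have := (HasDerivAt.comp (Z s) (by rw [h1 s hs]; exact h4) h3).const_mul 2
    rwa [h1 s hs] at this
  have h6 := h5.sqrt (by rw [h1 s hs]; linarith [h.pos s hs])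
  convert h6 using 1
  rw [h1 s hs]
  have := h.sqrt_pos hs
  field_simp

variable {E : Type*} [NormedAddCommGroup E] [InnerProductSpace ℝ E]

theorem SubJet.congr {v w : E → ℝ} {x p : E} {X : E →L[ℝ] E} (h : SubJet v x p X)
    (hvw : v =ᶠ[𝓝 x] w) : SubJet w x p X := by
  intro η hη
  have ht : Tendsto (fun d => x + d) (𝓝 0) (𝓝 x) := by
    have : Continuous fun d => x + d := by fun_prop
    simpa using this.tendsto 0
  filter_upwards [h η hη, ht.eventually hvw] with d h1 h2
  rwa [← h2, ← hvw.self_of_nhds]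

theorem ArcLength.subJet (h : ArcLength l r P P' Z) {u : E → ℝ} {x p : E} {X : E →L[ℝ] E}
    (hu : ContinuousAt u x) (hx : u x ∈ Set.Ioo l r) (hj : SubJet (fun y => Z (u y)) x p X) :
    SubJet u x (√(2 * P (u x)) • p) (√(2 * P (u x)) • X + P' (u x) • rankOneSelf p) := by
  obtain ⟨χ, h1, h2⟩ := h.exists_inverse
  obtain ⟨h3, h4⟩ := h2 _ hx
  have h5 := lowerPeano_of_deriv (h3.mono fun t ht => ht.2) h4
  have h6 := hj.comp (χ := χ) (U := Z '' Set.Ioo l r)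
    ((h.hasDerivAt_Z _ hx).continuousAt.comp (f := u) hu)
    (h3.mono fun t ht => ht.1)
    (by
      rintro _ ⟨s, hs, rfl⟩ _ ⟨t, ht, rfl⟩ hst
      rw [h1 s hs, h1 t ht]
      exact (h.strictMonoOn.le_iff_le hs ht).1 hst)
    (Real.sqrt_nonneg _) h5
  rw [h1 _ hx] at h6
  refine h6.congr ?_
  filter_upwards [hu (Ioo_mem_nhds hx.1 hx.2)] with y hy
  exact h1 _ hy

theorem ArcLength.superJet (h : ArcLength l r P P' Z) {u : E → ℝ} {x p : E} {X : E →L[ℝ] E}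
    (hu : ContinuousAt u x) (hx : u x ∈ Set.Ioo l r) (hj : SuperJet (fun y => Z (u y)) x p X) :
    SuperJet u x (√(2 * P (u x)) • p) (√(2 * P (u x)) • X + P' (u x) • rankOneSelf p) := by
  have hmem : ∀ {s}, s ∈ Set.Ioo (-r) (-l) → -s ∈ Set.Ioo l r := fun hs =>
    ⟨by linarith [hs.2], by linarith [hs.1]⟩
  have h' : ArcLength (-r) (-l) (fun s => P (-s)) (fun s => -P' (-s)) (fun s => -Z (-s)) :=
    { pos := fun s hs => h.pos _ (hmem hs)
      hasDerivAt_P := fun s hs => by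
        have := HasDerivAt.comp s (h.hasDerivAt_P (-s) (hmem hs)) (hasDerivAt_neg s)
        rwa [mul_neg_one] at this
      hasDerivAt_Z := fun s hs => by
        have := (HasDerivAt.comp s (h.hasDerivAt_Z (-s) (hmem hs)) (hasDerivAt_neg s)).neg
        rwa [mul_neg_one, neg_neg] at this }
  have h1 := h'.subJet (u := fun y => -u y) (x := x) (p := -p) (X := -X) hu.neg
    ⟨by linarith [hx.2], by linarith [hx.1]⟩ (by simpa using hj.subJet_neg)
  have h2 := h1.superJet_neg
  have h3 : rankOneSelf (-p) = rankOneSelf p := by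
    ext k; simp [rankOneSelf]
  simp only [neg_neg, h3] at h2
  convert h2 using 1
  · module
  · module

end Profiles

section FlatSolution

theorem exists_antideriv_Ioo {l r : ℝ} {w : ℝ → ℝ} (hw : ContinuousOn w (Set.Ioo l r)) :
    ∃ Z : ℝ → ℝ, ∀ s ∈ Set.Ioo l r, HasDerivAt Z (w s) s := by
  by_cases hlr : l < r
  swap
  · exact ⟨0, fun s hs => absurd (hs.1.trans hs.2) hlr⟩
  have hm : (l + r) / 2 ∈ Set.Ioo l r := ⟨by linarith, by linarith⟩
  refine ⟨fun s => ∫ t in ((l + r) / 2)..s, w t, fun s hs => ?_⟩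
  have hcont : ContinuousAt w s := hw.continuousAt (Ioo_mem_nhds hs.1 hs.2)
  refine intervalIntegral.integral_hasDerivAt_right ?_ ?_ hcont
  · refine (hw.mono ?_).intervalIntegrable
    exact Set.OrdConnected.uIcc_subset Set.ordConnected_Ioo hm hs
  · exact hw.stronglyMeasurableAtFilter isOpen_Ioo s hs

theorem exists_arcLength {l r : ℝ} {P P' : ℝ → ℝ} (hpos : ∀ s ∈ Set.Ioo l r, 0 < P s)
    (hP : ∀ s ∈ Set.Ioo l r, HasDerivAt P (P' s) s) : ∃ Z, ArcLength l r P P' Z := by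
  have hc : ContinuousOn (fun s => (√(2 * P s))⁻¹) (Set.Ioo l r) := by
    refine ContinuousOn.inv₀ ?_ fun s hs => (Real.sqrt_pos.2 (by linarith [hpos s hs])).ne'
    exact (continuousOn_const.mul fun s hs => (hP s hs).continuousAt.continuousWithinAt).sqrt
  obtain ⟨Z, hZ⟩ := exists_antideriv_Ioo hc
  exact ⟨Z, hpos, hP, hZ⟩

variable {E : Type*} [NormedAddCommGroup E] [InnerProductSpace ℝ E]

/-- A solution, in the sense of second order jets with nonzero gradient, of
`G(D²u) = G(-k(u) e ⊗ e)` that tends to `±1` as `⟪e, x⟫ → ±∞`. -/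
structure FlatSol (a A L δ₀ : ℝ) (G : (E →L[ℝ] E) → ℝ) (k : ℝ → ℝ) (e : E) (u : E → ℝ) :
    Prop where
  a_pos : 0 < a
  A_nonneg : 0 ≤ A
  elliptic : EllipticOp a A G
  L_nonneg : 0 ≤ L
  lip : ∀ s t, |k s - k t| ≤ L * |s - t|
  zero : ∀ s, 1 ≤ |s| → k s = 0
  δ₀_mem : δ₀ ∈ Set.Ioo (0 : ℝ) 1
  antitone_neg : AntitoneOn k (Set.Icc (-1) (-1 + δ₀))
  antitone_pos : AntitoneOn k (Set.Icc (1 - δ₀) 1)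
  norm_e : ‖e‖ = 1
  continuous : Continuous u
  range : ∀ x, u x ∈ Set.Icc (-1 : ℝ) 1
  superJet : ∀ x p X, p ≠ 0 → SuperJet u x p X → G (-k (u x) • rankOneSelf e) ≤ G X
  subJet : ∀ x p X, p ≠ 0 → SubJet u x p X → G X ≤ G (-k (u x) • rankOneSelf e)
  lim_pos : ∀ ε > 0, ∃ R, ∀ x, R ≤ ⟪e, x⟫ → 1 - ε < u x
  lim_neg : ∀ ε > 0, ∃ R, ∀ x, ⟪e, x⟫ ≤ R → u x < -1 + ε

variable {a A L δ₀ : ℝ} {G : (E →L[ℝ] E) → ℝ} {k : ℝ → ℝ} {e : E} {u : E → ℝ}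

theorem EllipticOp.flip (h : EllipticOp a A G) : EllipticOp a A fun X => -G (-X) where
  homog t ht X := by
    rw [← smul_neg, h.homog t ht]
    ring
  gain X Y c₁ c₃ e hc he hk hke := by
    have := h.gain (-Y) (-X) c₁ c₃ e hc he (fun k => by
      have := hk k
      simp only [neg_apply, inner_neg_left]
      linarith) (by
      simp only [neg_apply, inner_neg_left]
      linarith)
    linarith

/-- The symmetry `(u, x) ↦ (-u, -x)`. -/
theorem FlatSol.flip (S : FlatSol a A L δ₀ G k e u) :
    FlatSol a A L δ₀ (fun X => -G (-X)) (fun s => -k (-s)) e (fun x => -u (-x)) where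
  a_pos := S.a_pos
  A_nonneg := S.A_nonneg
  elliptic := S.elliptic.flip
  L_nonneg := S.L_nonneg
  lip s t := by
    have := S.lip (-t) (-s)
    rwa [show -t - -s = s - t by ring, show k (-t) - k (-s) = -k (-s) - -k (-t) by ring] at this
  zero s hs := by rw [S.zero (-s) (by rwa [abs_neg]), neg_zero]
  δ₀_mem := S.δ₀_mem
  antitone_neg s hs t ht hst := neg_le_neg (S.antitone_pos
    (show -t ∈ _ from ⟨by linarith [ht.2], by linarith [ht.1]⟩)
    (show -s ∈ _ from ⟨by linarith [hs.2], by linarith [hs.1]⟩) (by linarith))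
  antitone_pos s hs t ht hst := neg_le_neg (S.antitone_neg
    (show -t ∈ _ from ⟨by linarith [ht.2], by linarith [ht.1]⟩)
    (show -s ∈ _ from ⟨by linarith [hs.2], by linarith [hs.1]⟩) (by linarith))
  norm_e := S.norm_e
  continuous := (S.continuous.comp continuous_neg).neg
  range x := ⟨by linarith [(S.range (-x)).2], by linarith [(S.range (-x)).1]⟩
  superJet x p X hp h := by
    have h2 : SubJet u (-x) p (-X) := by
      intro η hη
      have ht : Tendsto (fun d : E => -d) (𝓝 0) (𝓝 0) := by
        simpa using (continuous_neg (G := E)).tendsto 0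
      filter_upwards [ht.eventually (h η hη)] with d hd
      simp only [neg_add, neg_neg, map_neg, inner_neg_left, inner_neg_right, norm_neg,
        neg_apply] at hd ⊢
      linarith
    have := S.subJet _ _ _ hp h2
    simp only [neg_neg, neg_smul] at this ⊢
    linarith
  subJet x p X hp h := by
    have h2 : SuperJet u (-x) p (-X) := by
      intro η hη
      have ht : Tendsto (fun d : E => -d) (𝓝 0) (𝓝 0) := by
        simpa using (continuous_neg (G := E)).tendsto 0
      filter_upwards [ht.eventually (h η hη)] with d hd
      simp only [neg_add, neg_neg, map_neg, inner_neg_left, inner_neg_right, norm_neg,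
        neg_apply] at hd ⊢
      linarith
    have := S.superJet _ _ _ hp h2
    simp only [neg_neg, neg_smul] at this ⊢
    linarith
  lim_pos ε hε := by
    obtain ⟨R, hR⟩ := S.lim_neg ε hε
    exact ⟨-R, fun x hx => by
      have := hR (-x) (by rw [inner_neg_right]; linarith)
      linarith⟩
  lim_neg ε hε := by
    obtain ⟨R, hR⟩ := S.lim_pos ε hε
    exact ⟨-R, fun x hx => by
      have := hR (-x) (by rw [inner_neg_right]; linarith)
      linarith⟩

theorem abs_inner_add_smul_sq_sub_le {b : E} (he : ‖e‖ = 1) (hb : ‖b‖ ≤ 1) {δ : ℝ} (hδ : 0 ≤ δ)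
    (hδ1 : δ ≤ 1) (y : E) : |⟪e + δ • b, y⟫ ^ 2 - ⟪e, y⟫ ^ 2| ≤ 3 * δ * ‖y‖ ^ 2 := by
  have h1 : |⟪e, y⟫| ≤ ‖y‖ := abs_inner_le_norm_of_unit he
  have h2 : |⟪b, y⟫| ≤ ‖y‖ := (abs_real_inner_le_norm b y).trans
    (mul_le_of_le_one_left (norm_nonneg _) hb)
  have h3 : ⟪e + δ • b, y⟫ ^ 2 - ⟪e, y⟫ ^ 2 = δ * ((2 * ⟪e, y⟫ + δ * ⟪b, y⟫) * ⟪b, y⟫) := by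
    rw [inner_add_left, real_inner_smul_left]
    ring
  rw [h3, abs_mul, abs_mul, abs_of_nonneg hδ]
  have h4 : |2 * ⟪e, y⟫ + δ * ⟪b, y⟫| ≤ 3 * ‖y‖ := by
    refine (abs_add_le _ _).trans ?_
    rw [abs_mul, abs_mul, abs_of_nonneg hδ, abs_of_pos (two_pos : (0 : ℝ) < 2)]
    have : δ * |⟪b, y⟫| ≤ 1 * ‖y‖ := by gcongr
    linarith
  calc δ * (|2 * ⟪e, y⟫ + δ * ⟪b, y⟫| * |⟪b, y⟫|) ≤ δ * ((3 * ‖y‖) * ‖y‖) := by gcongr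
    _ = 3 * δ * ‖y‖ ^ 2 := by ring

variable [FiniteDimensional ℝ E]

set_option maxHeartbeats 1000000 in
/-- A solution lies to the left of a strict subsolution profile that it dominates near `s₀`. -/
theorem FlatSol.slide_below (S : FlatSol a A L δ₀ G k e u) {P P' Z : ℝ → ℝ}
    (hZ : ArcLength (-2) 2 P P' Z) {s₀ c₀ B : ℝ} (hs₀ : s₀ ∈ Set.Ioo (-1 : ℝ) 1) (hc₀ : 0 < c₀)
    (hPk : ∀ s ∈ Set.Icc (-1) s₀, c₀ ≤ P' s + k s) (hB0 : 0 ≤ B)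
    (hB : ∀ s ∈ Set.Icc (-1) s₀, √(2 * P s) ≤ B ∧ |P' s| ≤ B) {R : ℝ}
    (hR : ∀ x, R ≤ ⟪e, x⟫ → s₀ ≤ u x) {x : E} (hx : ⟪e, x⟫ ≤ R) (hux : u x ≤ s₀) :
    ⟪e, x⟫ - R + Z s₀ ≤ Z (u x) := by
  by_contra! hlt
  have ha := S.a_pos
  have hA := S.A_nonneg
  obtain ⟨μ, hμ⟩ : ∃ μ, μ = ⟪e, x⟫ - R + Z s₀ - Z (u x) := ⟨_, rfl⟩
  have hμ0 : 0 < μ := by rw [hμ]; linarith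
  have hSx := one_le_smoothNorm x
  obtain ⟨C, hC⟩ : ∃ C, C = B + 3 * B := ⟨_, rfl⟩
  have hC0 : 0 ≤ C := by rw [hC]; positivity
  obtain ⟨δ, hδ0, hδ1, hδ2, hδ3⟩ : ∃ δ : ℝ, 0 < δ ∧ δ < 1 ∧ δ * smoothNorm x < μ ∧
      (a + A) * (C * δ) < a * c₀ := by
    have h1 : Tendsto (fun δ : ℝ => δ) (𝓝[>] 0) (𝓝 0) :=
      tendsto_nhdsWithin_of_tendsto_nhds tendsto_id
    have h2 : Tendsto (fun δ : ℝ => δ * smoothNorm x) (𝓝[>] 0) (𝓝 0) := by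
      simpa using h1.mul_const (smoothNorm x)
    have h3 : Tendsto (fun δ : ℝ => (a + A) * (C * δ)) (𝓝[>] 0) (𝓝 0) := by
      simpa using (h1.const_mul C).const_mul (a + A)
    obtain ⟨δ, h4, h5, h6, h7⟩ := (eventually_mem_nhdsWithin.and
      ((h1.eventually_lt_const one_pos).and
      ((h2.eventually_lt_const hμ0).and (h3.eventually_lt_const (mul_pos ha hc₀))))).exists
    exact ⟨δ, h4, h5, h6, h7⟩
  have hmin_mem : ∀ y, min (u y) s₀ ∈ Set.Icc (-1) s₀ := fun y =>
    ⟨le_min (S.range y).1 hs₀.1.le, min_le_right _ _⟩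
  have hsub : Set.Icc (-1) s₀ ⊆ Set.Ioo (-2 : ℝ) 2 := fun s hs =>
    ⟨by linarith [hs.1], by linarith [hs.2, hs₀.2]⟩
  have hZc : Continuous fun y => Z (min (u y) s₀) := by
    have h1 : ContinuousOn Z (Set.Icc (-1) s₀) := fun s hs =>
      (hZ.hasDerivAt_Z s (hsub hs)).continuousAt.continuousWithinAt
    exact h1.comp_continuous (S.continuous.min continuous_const) hmin_mem
  obtain ⟨Φ, hΦ⟩ : ∃ Φ : E → ℝ, Φ = fun y => Z (min (u y) s₀) - ⟪e, y⟫ + R - Z s₀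
    + δ * smoothNorm y := ⟨_, rfl⟩
  have hΦc : Continuous Φ := by
    rw [hΦ]
    exact (((hZc.sub (by fun_prop)).add_const R).sub continuous_const).add
      (continuous_smoothNorm.const_mul δ)
  have hΦx : Φ x < 0 := by
    rw [hΦ]
    simp only [min_eq_left hux]
    linarith
  obtain ⟨y, hy, hyx, hmin⟩ := exists_min_of_bounded_sublevel hΦc
    (S := {y | ⟪e, y⟫ ≤ R}) (isClosed_le (by fun_prop) continuous_const) (z₀ := x) hx (by
      refine (isBounded_closedBall (x := (0 : E)) (r := (Z s₀ - Z (-1)) / δ)).subset ?_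
      rintro z ⟨hz1, hz2⟩
      rw [mem_closedBall_zero_iff, le_div_iff₀ hδ0]
      have h1 : Z (-1) ≤ Z (min (u z) s₀) := (hZ.strictMonoOn.le_iff_le
        (hsub ⟨le_rfl, hs₀.1.le⟩) (hsub (hmin_mem z))).2 (hmin_mem z).1
      have h2 := norm_le_smoothNorm z
      have h3 : ‖z‖ * δ ≤ δ * smoothNorm z := by rw [mul_comm]; gcongr
      have h4 := hz2.trans hΦx.le
      rw [hΦ] at h4
      simp only [Set.mem_ofPred_eq] at h4 hz1
      linarith)
  have hΦy := hyx.trans_lt hΦx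
  have hSy : 0 < δ * smoothNorm y := mul_pos hδ0 (by linarith [one_le_smoothNorm y])
  have huy : u y < s₀ := by
    by_contra! h
    rw [hΦ] at hΦy
    simp only [min_eq_right h] at hΦy
    simp only [Set.mem_ofPred_eq] at hy
    linarith
  have hyR : ⟪e, y⟫ < R := by
    by_contra! h
    exact absurd (hR y h) (not_le.2 huy)
  have huy1 := (S.range y).1
  have hsy : u y ∈ Set.Icc (-1) s₀ := ⟨huy1, huy.le⟩
  obtain ⟨b, D, hbD, hb, hD⟩ := exists_subJet_neg_smoothNorm y
  have hj : SubJet (fun z => Z (u z)) y (e + δ • b) (0 + δ • D) := by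
    have h1 := ((subJet_inner e y).add (hbD.const_mul hδ0.le))
      |>.const_add (Z (u y) - ⟪e, y⟫ + δ * smoothNorm y)
    refine h1.mono_left (by ring) ?_
    have h2 : ∀ᶠ z in 𝓝 y, ⟪e, z⟫ < R :=
      (isOpen_lt (by fun_prop) continuous_const).mem_nhds hyR
    have h3 : ∀ᶠ z in 𝓝 y, u z < s₀ :=
      (isOpen_lt S.continuous continuous_const).mem_nhds huy
    filter_upwards [h2, h3] with z hz1 hz2
    have h4 := hmin z hz1.le
    rw [hΦ] at h4
    simp only [min_eq_left hz2.le, min_eq_left huy.le] at h4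
    linarith
  have hj2 := hZ.subJet S.continuous.continuousAt (hsub hsy) hj
  have hw := hZ.sqrt_pos (hsub hsy)
  have hp : √(2 * P (u y)) • (e + δ • b) ≠ 0 := by
    refine smul_ne_zero hw.ne' fun h => ?_
    have h1 : e = -(δ • b) := eq_neg_of_add_eq_zero_left h
    have h2 : ‖e‖ ≤ δ := by
      rw [h1, norm_neg, norm_smul, Real.norm_of_nonneg hδ0.le]
      exact mul_le_of_le_one_right hδ0.le hb
    rw [S.norm_e] at h2
    linarith
  have h1 := S.subJet _ _ _ hp hj2
  obtain ⟨hBw, hBP⟩ := hB _ hsy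
  have hck := hPk _ hsy
  have hest : ∀ z, -(C * δ * ‖z‖ ^ 2) + (P' (u y) + k (u y)) * ⟪e, z⟫ ^ 2 ≤
      ⟪(√(2 * P (u y)) • (0 + δ • D) + P' (u y) • rankOneSelf (e + δ • b)) z, z⟫
        - ⟪(-k (u y) • rankOneSelf e) z, z⟫ := by
    intro z
    rw [inner_add_clm, inner_smul_clm, zero_add, inner_smul_clm, inner_smul_clm, inner_smul_clm,
      inner_rankOneSelf, inner_rankOneSelf]
    have h2 := abs_inner_add_smul_sq_sub_le S.norm_e hb hδ0.le hδ1.le z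
    have h3 : |P' (u y) * (⟪e + δ • b, z⟫ ^ 2 - ⟪e, z⟫ ^ 2)| ≤ B * (3 * δ * ‖z‖ ^ 2) := by
      rw [abs_mul]
      gcongr
    have h4 := neg_le_of_abs_le h3
    have h5 : √(2 * P (u y)) * (δ * -‖z‖ ^ 2) ≤ √(2 * P (u y)) * (δ * ⟪D z, z⟫) := by
      have := hD z
      gcongr
    have h6 : √(2 * P (u y)) * (δ * ‖z‖ ^ 2) ≤ B * (δ * ‖z‖ ^ 2) := by gcongr
    rw [hC]
    linarith
  have h2 := S.elliptic.gain (-k (u y) • rankOneSelf e)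
    (√(2 * P (u y)) • (0 + δ • D) + P' (u y) • rankOneSelf (e + δ • b)) (C * δ)
    (c₀ - C * δ) e (by positivity) S.norm_e (fun z => by
      have h3 := hest z
      have h4 : 0 ≤ (P' (u y) + k (u y)) * ⟪e, z⟫ ^ 2 := mul_nonneg (by linarith) (sq_nonneg _)
      linarith) (by
      have h3 := hest e
      rw [real_inner_self_eq_norm_sq, S.norm_e] at h3
      linarith)
  linarith

end FlatSolution

section Potential
variable {E : Type*} [NormedAddCommGroup E] [InnerProductSpace ℝ E] [FiniteDimensional ℝ E]
variable {a A L δ₀ : ℝ} {G : (E →L[ℝ] E) → ℝ} {k : ℝ → ℝ} {e : E} {u : E → ℝ}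

theorem monotoneOn_Icc_of_hasDerivAt {T T' : ℝ → ℝ} {l r : ℝ}
    (hT : ∀ s ∈ Set.Icc l r, HasDerivAt T (T' s) s) (hpos : ∀ s ∈ Set.Icc l r, 0 ≤ T' s) :
    MonotoneOn T (Set.Icc l r) := by
  refine monotoneOn_of_deriv_nonneg (convex_Icc l r)
    (fun s hs => (hT s hs).continuousAt.continuousWithinAt)
    (fun s hs => (hT s (interior_subset hs)).differentiableAt.differentiableWithinAt)
    fun s hs => ?_
  rw [(hT s (interior_subset hs)).deriv]
  exact hpos s (interior_subset hs)

set_option maxHeartbeats 1000000 in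
/-- No subsolution profile can vanish to second order at an interior value `s₀`: sliding it
to the left would contradict the limit at `-∞`. -/
theorem FlatSol.false_of_barrier (S : FlatSol a A L δ₀ G k e u) {Q Q' : ℝ → ℝ} {s₀ C : ℝ}
    (hs₀ : s₀ ∈ Set.Ioo (-1 : ℝ) 1) (hQ : ∀ s, HasDerivAt Q (Q' s) s) (hQ0 : ∀ s, 0 ≤ Q s)
    (hC : 0 ≤ C) (hQC : ∀ s ∈ Set.Icc (-1) s₀, Q s ≤ C * (s - s₀) ^ 2)
    (hQ'C : ∀ s ∈ Set.Icc (-1) s₀, |Q' s| ≤ C) (hk : ∀ s ∈ Set.Icc (-1) s₀, 0 ≤ Q' s + k s) :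
    False := by
  obtain ⟨R, hR⟩ := S.lim_pos (1 - s₀) (by linarith [hs₀.2])
  obtain ⟨R₂, hR₂⟩ := S.lim_neg (s₀ + 1) (by linarith [hs₀.1])
  obtain ⟨x, hx⟩ : ∃ x, x = min R R₂ • e := ⟨_, rfl⟩
  have hex : ⟪e, x⟫ = min R R₂ := by
    rw [hx, real_inner_smul_right, real_inner_self_eq_norm_sq, S.norm_e]; ring
  have hxR : ⟪e, x⟫ ≤ R := by rw [hex]; exact min_le_left _ _
  have hux : u x < s₀ := by
    have := hR₂ x (by rw [hex]; exact min_le_right _ _)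
    linarith
  have hux1 := (S.range x).1
  obtain ⟨w, hw⟩ : ∃ w, w = s₀ - u x := ⟨_, rfl⟩
  have hw0 : 0 < w := by rw [hw]; linarith
  obtain ⟨q, hq⟩ : ∃ q, q = √(2 * (C + 5)) := ⟨_, rfl⟩
  have hq0 : 0 < q := by rw [hq]; exact Real.sqrt_pos.2 (by linarith)
  obtain ⟨M, hM⟩ : ∃ M, M = q * (R - ⟪e, x⟫) + 1 := ⟨_, rfl⟩
  obtain ⟨η, hη⟩ : ∃ η, η = w * exp (-M) := ⟨_, rfl⟩
  have hη0 : 0 < η := by rw [hη]; positivity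
  have hη2 : 0 < η ^ 2 := by positivity
  have hpos : ∀ s ∈ Set.Ioo (-2 : ℝ) 2, 0 < Q s + η ^ 2 * (3 + s) := fun s hs => by
    have : 0 < 3 + s := by linarith [hs.1]
    have := hQ0 s
    positivity
  obtain ⟨Z, hZ⟩ := exists_arcLength (P' := fun s => Q' s + η ^ 2) hpos fun s _ => by
    have := (hQ s).add (((hasDerivAt_id s).const_add 3).const_mul (η ^ 2))
    rwa [mul_one] at this
  have hsub : Set.Icc (-1) s₀ ⊆ Set.Ioo (-2 : ℝ) 2 := fun s hs =>
    ⟨by linarith [hs.1], by linarith [hs.2, hs₀.2]⟩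
  have hP : ∀ s ∈ Set.Icc (-1) s₀, √(2 * (Q s + η ^ 2 * (3 + s))) ≤ q * (s₀ - s + η) := by
    intro s hs
    have h0 : 0 ≤ s₀ - s := by linarith [hs.2]
    rw [hq, ← Real.sqrt_sq (by positivity : 0 ≤ s₀ - s + η), ← Real.sqrt_mul (by positivity)]
    refine Real.sqrt_le_sqrt ?_
    have h1 := hQC s hs
    have h2 : η ^ 2 * (3 + s) ≤ η ^ 2 * 5 := by
      have : s ≤ 2 := by linarith [hs.2, hs₀.2]
      gcongr
      linarith
    have h3 : C * (s - s₀) ^ 2 ≤ C * (s₀ - s + η) ^ 2 := by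
      rw [← neg_sub s₀ s, neg_sq]
      gcongr
      linarith
    have h4 : η ^ 2 ≤ (s₀ - s + η) ^ 2 := by
      gcongr
      linarith
    linarith
  have hslide := S.slide_below hZ (c₀ := η ^ 2) (B := q * (2 + η) + C + η ^ 2) hs₀ hη2
    (fun s hs => by linarith [hk s hs]) (by positivity) (fun s hs => by
      constructor
      · have h1 := hP s hs
        have h2 : q * (s₀ - s + η) ≤ q * (2 + η) := by
          gcongr
          linarith [hs.1, hs₀.2]
        linarith
      · have h1 := abs_add_le (Q' s) (η ^ 2)
        have h2 := hQ'C s hs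
        have h3 : 0 ≤ q * (2 + η) := by positivity
        rw [abs_of_pos hη2] at h1
        linarith) (R := R) (fun y hy => by linarith [hR y hy]) hxR hux.le
  have hsub2 : Set.Icc (u x) s₀ ⊆ Set.Icc (-1) s₀ := Set.Icc_subset_Icc hux1 le_rfl
  have hmono : MonotoneOn (fun σ => Z σ + q⁻¹ * log (s₀ - σ + η)) (Set.Icc (u x) s₀) := by
    refine monotoneOn_Icc_of_hasDerivAt (T' := fun σ =>
      (√(2 * (Q σ + η ^ 2 * (3 + σ))))⁻¹ + q⁻¹ * (-1 / (s₀ - σ + η)))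
      (fun σ hσ => ?_) fun σ hσ => ?_
    · have h1 : 0 < s₀ - σ + η := by linarith [hσ.2]
      refine (hZ.hasDerivAt_Z σ (hsub (hsub2 hσ))).add (HasDerivAt.const_mul _ ?_)
      exact (((hasDerivAt_id σ).const_sub s₀).add_const η).log h1.ne'
    · have h1 : 0 < s₀ - σ + η := by linarith [hσ.2]
      have h2 := inv_anti₀ (hZ.sqrt_pos (hsub (hsub2 hσ))) (hP σ (hsub2 hσ))
      rw [mul_inv] at h2
      have h3 : q⁻¹ * (-1 / (s₀ - σ + η)) = -(q⁻¹ * (s₀ - σ + η)⁻¹) := by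
        rw [neg_div, one_div]; ring
      linarith
  have h1 := hmono ⟨le_rfl, hux.le⟩ ⟨hux.le, le_rfl⟩ hux.le
  simp only [sub_self, zero_add, ← hw] at h1
  have h2 : log w ≤ log (w + η) := Real.log_le_log hw0 (by linarith)
  have h3 : log η = log w - M := by
    rw [hη, Real.log_mul hw0.ne' (exp_pos _).ne', Real.log_exp]; ring
  have h4 : q⁻¹ * M ≤ Z s₀ - Z (u x) := by
    have h5 : q⁻¹ * M ≤ q⁻¹ * (log (w + η) - log η) := by
      gcongr
      linarith
    linarith
  have h5 : q⁻¹ * M = (R - ⟪e, x⟫) + q⁻¹ := by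
    rw [hM]; field_simp
  have h6 : 0 < q⁻¹ := by positivity
  linarith

theorem hasDerivAt_max_zero_sq (y : ℝ) :
    HasDerivAt (fun t : ℝ => max 0 t ^ 2) (2 * max 0 y) y := by
  rw [hasDerivAt_iff_isLittleO_nhds_zero]
  have h1 : (fun h : ℝ => h ^ 2) =o[𝓝 0] fun h : ℝ => h := by
    simpa using (Asymptotics.isLittleO_pow_id (𝕜 := ℝ) one_lt_two)
  refine Asymptotics.IsBigO.trans_isLittleO ?_ h1
  refine Asymptotics.IsBigO.of_bound 1 (Eventually.of_forall fun h => ?_)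
  rw [Real.norm_eq_abs, Real.norm_eq_abs, one_mul, abs_of_nonneg (sq_nonneg h), abs_le, smul_eq_mul]
  rcases le_total 0 y with hy | hy <;> rcases le_total 0 (y + h) with hyh | hyh <;>
    simp only [max_eq_left, max_eq_right, hy, hyh] <;> constructor <;> nlinarith

theorem FlatSol.continuous_k (S : FlatSol a A L δ₀ G k e u) : Continuous k :=
  (LipschitzWith.of_dist_le_mul (K := ⟨L, S.L_nonneg⟩) fun s t => by
    rw [Real.dist_eq, Real.dist_eq]; exact S.lip s t).continuous

theorem FlatSol.abs_k_le (S : FlatSol a A L δ₀ G k e u) {s : ℝ} (hs : s ∈ Set.Icc (-1 : ℝ) 1) :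
    |k s| ≤ L * (1 - s) ∧ |k s| ≤ L * (1 + s) := by
  have h1 := S.lip s 1
  have h2 := S.lip s (-1)
  rw [S.zero 1 (by norm_num), sub_zero, abs_of_nonpos (a := s - 1) (by linarith [hs.2])] at h1
  rw [S.zero (-1) (by norm_num), sub_zero, abs_of_nonneg (a := s - -1) (by linarith [hs.1])] at h2
  exact ⟨by linarith, by linarith⟩

theorem FlatSol.exists_potential (S : FlatSol a A L δ₀ G k e u) :
    ∃ K : ℝ → ℝ, ∀ s, HasDerivAt K (-k s) s :=
  ⟨fun s => ∫ t in (0 : ℝ)..s, -k t, fun s => S.continuous_k.neg.integral_hasStrictDerivAt 0 s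
    |>.hasDerivAt⟩

theorem FlatSol.potential_clip (S : FlatSol a A L δ₀ G k e u) {K : ℝ → ℝ}
    (hK : ∀ s, HasDerivAt K (-k s) s) (s : ℝ) : ∃ t ∈ Set.Icc (-1 : ℝ) 1, K s = K t := by
  have hd : ∀ σ, 1 ≤ |σ| → HasDerivWithinAt K 0 (Set.Ici σ) σ := fun σ hσ => by
    have := (hK σ).hasDerivWithinAt (s := Set.Ici σ)
    rwa [S.zero σ hσ, neg_zero] at this
  have hKc : Continuous K := continuous_iff_continuousAt.2 fun s => (hK s).continuousAt
  rcases le_total s (-1) with h | h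
  · refine ⟨-1, by norm_num, (constant_of_has_deriv_right_zero hKc.continuousOn
      (fun σ hσ => hd σ ?_)
      (-1) ⟨h, le_rfl⟩).symm⟩
    rw [abs_of_neg (by linarith [hσ.2])]
    linarith [hσ.2]
  rcases le_total 1 s with h' | h'
  · refine ⟨1, by norm_num, constant_of_has_deriv_right_zero hKc.continuousOn (fun σ hσ => hd σ ?_)
      s ⟨h', le_rfl⟩⟩
    exact hσ.1.trans (le_abs_self σ)
  · exact ⟨s, ⟨h, h'⟩, rfl⟩

theorem abs_sub_le_of_hasDerivAt {K K' : ℝ → ℝ} {C l r : ℝ} 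
    (hK : ∀ s ∈ Set.Icc l r, HasDerivAt K (K' s) s) (hC : ∀ s ∈ Set.Icc l r, |K' s| ≤ C)
    {s t : ℝ} (hs : s ∈ Set.Icc l r) (ht : t ∈ Set.Icc l r) : |K s - K t| ≤ C * |s - t| :=
  (convex_Icc l r).norm_image_sub_le_of_norm_hasDerivWithin_le
    (fun x hx => (hK x hx).hasDerivWithinAt) hC ht hs

/-- A minimum point of the potential is not an interior value. -/
theorem FlatSol.potential_lt_of_mem_Ioo (S : FlatSol a A L δ₀ G k e u) {K : ℝ → ℝ}
    (hK : ∀ s, HasDerivAt K (-k s) s) {s₀ : ℝ} (hs₀ : s₀ ∈ Set.Ioo (-1 : ℝ) 1) :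
    ∃ s ∈ Set.Icc (-1 : ℝ) 1, K s < K s₀ := by
  by_contra! hmin
  have hmin' : ∀ s, K s₀ ≤ K s := fun s => by
    obtain ⟨t, ht, hst⟩ := S.potential_clip hK s
    rw [hst]
    exact hmin t ht
  have hk0 : k s₀ = 0 := by
    have := IsLocalMin.hasDerivAt_eq_zero (Eventually.of_forall hmin') (hK s₀)
    linarith
  have hkb : ∀ s, |k s| ≤ L * |s - s₀| := fun s => by
    have := S.lip s s₀
    rwa [hk0, sub_zero] at this
  refine S.false_of_barrier (Q := fun s => K s - K s₀) (C := 2 * L) hs₀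
    (fun s => (hK s).sub_const _) (fun s => sub_nonneg.2 (hmin' s)) (by linarith [S.L_nonneg])
    (fun s hs => ?_) (fun s hs => ?_) fun s hs => by simp
  · have h1 := abs_sub_le_of_hasDerivAt (K := K) (C := L * (s₀ - s)) (l := s) (r := s₀)
      (fun t _ => hK t) (fun t ht => by
        rw [abs_neg]
        refine (hkb t).trans ?_
        rw [abs_of_nonpos (by linarith [ht.2])]
        have := S.L_nonneg
        have := ht.1
        gcongr
        linarith) (s := s) (t := s₀) ⟨le_rfl, hs.2⟩ ⟨hs.2, le_rfl⟩
    have h2 := (le_abs_self _).trans h1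
    rw [abs_of_nonpos (by linarith [hs.2])] at h2
    have h3 : 0 ≤ L * (s - s₀) ^ 2 := mul_nonneg S.L_nonneg (sq_nonneg _)
    have h4 : L * (s₀ - s) * -(s - s₀) = L * (s - s₀) ^ 2 := by ring
    linarith
  · rw [abs_neg]
    refine (hkb s).trans ?_
    rw [abs_of_nonpos (by linarith [hs.2])]
    have h1 := mul_le_mul_of_nonneg_left (by linarith [hs.1, hs₀.2] : -(s - s₀) ≤ 2) S.L_nonneg
    linarith

set_option maxHeartbeats 1000000 in
/-- The potential attains its minimum at `-1`. -/
theorem FlatSol.potential_neg_one_le (S : FlatSol a A L δ₀ G k e u) {K : ℝ → ℝ}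
    (hK : ∀ s, HasDerivAt K (-k s) s) : ∀ s ∈ Set.Icc (-1 : ℝ) 1, K (-1) ≤ K s := by
  have hKc : Continuous K := continuous_iff_continuousAt.2 fun s => (hK s).continuousAt
  by_contra! hne
  obtain ⟨s₁, hs₁, hlt⟩ := hne
  obtain ⟨σ, hσ, hσmin⟩ := isCompact_Icc.exists_isMinOn (⟨s₁, hs₁⟩ : (Set.Icc (-1 : ℝ) 1).Nonempty)
    hKc.continuousOn
  have hmem : ∀ t ∈ Set.Icc (-1 : ℝ) 1, (∀ s ∈ Set.Icc (-1 : ℝ) 1, K t ≤ K s) → t = 1 := by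
    intro t ht htmin
    by_contra h1
    rcases eq_or_ne t (-1) with rfl | h2
    · exact absurd (htmin s₁ hs₁) (not_le.2 hlt)
    · obtain ⟨s, hs, hlt⟩ := S.potential_lt_of_mem_Ioo hK
        ⟨lt_of_le_of_ne ht.1 h2.symm, lt_of_le_of_ne ht.2 h1⟩
      exact absurd (htmin s hs) (not_le.2 hlt)
  have hσ1 := hmem σ hσ fun s hs => hσmin hs
  subst hσ1
  have hδ := S.δ₀_mem
  obtain ⟨s₂, hs₂, hs₂min⟩ := isCompact_Icc.exists_isMinOn
    (⟨-1, le_rfl, by linarith [hδ.2]⟩ : (Set.Icc (-1 : ℝ) (1 - δ₀)).Nonempty) hKc.continuousOn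
  have h1 : K 1 < K s₂ := by
    have hs₂' : s₂ ∈ Set.Icc (-1 : ℝ) 1 := ⟨hs₂.1, by linarith [hs₂.2, hδ.1]⟩
    refine lt_of_le_of_ne (hσmin hs₂') fun h => ?_
    have := hmem s₂ hs₂' fun s hs => h ▸ hσmin hs
    linarith [hs₂.2, hδ.1]
  obtain ⟨s₀, hs₀lt, hs₀1, hs₀2⟩ : ∃ s₀, K s₀ < K s₂ ∧ 1 - δ₀ < s₀ ∧ s₀ < 1 := by
    have h2 : ∀ᶠ s in 𝓝[<] (1 : ℝ), K s < K s₂ :=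
      (hKc.continuousAt.eventually_lt_const h1).filter_mono nhdsWithin_le_nhds
    have h3 : ∀ᶠ s in 𝓝[<] (1 : ℝ), 1 - δ₀ < s :=
      (lt_mem_nhds (by linarith [hδ.1])).filter_mono nhdsWithin_le_nhds
    obtain ⟨s, h4, h5, h6⟩ := (h2.and (h3.and eventually_mem_nhdsWithin)).exists
    exact ⟨s, h4, h5, h6⟩
  obtain ⟨y₀, hy₀⟩ : ∃ y₀, y₀ = K s₂ - K s₀ := ⟨_, rfl⟩
  have hy₀0 : 0 < y₀ := by rw [hy₀]; linarith
  have hs₀mem : s₀ ∈ Set.Ioo (-1 : ℝ) 1 := ⟨by linarith [hδ.2], hs₀2⟩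
  have hk_nonneg : ∀ s ∈ Set.Icc (1 - δ₀) 1, 0 ≤ k s := fun s hs => by
    have := S.antitone_pos hs ⟨by linarith [hδ.1], le_rfl⟩ hs.2
    rwa [S.zero 1 (by norm_num)] at this
  have hL := S.L_nonneg
  have hkb : ∀ s ∈ Set.Icc (-1 : ℝ) 1, |-k s| ≤ 2 * L := fun s hs => by
    rw [abs_neg]
    refine (S.abs_k_le hs).1.trans ?_
    rw [mul_comm]
    gcongr
    linarith [hs.1]
  have hsub : ∀ s ∈ Set.Icc (-1) s₀, s ∈ Set.Icc (-1 : ℝ) 1 := fun s hs =>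
    ⟨hs.1, hs.2.trans hs₀2.le⟩
  have hclamp : ∀ y, 0 ≤ (max 0 y - max 0 (y - y₀)) / y₀ ∧ (max 0 y - max 0 (y - y₀)) / y₀ ≤ 1 := by
    intro y
    rw [div_le_one hy₀0]
    refine ⟨div_nonneg (sub_nonneg.2 (max_le_max le_rfl (by linarith))) hy₀0.le, ?_⟩
    rcases le_total 0 y with h | h <;> rcases le_total 0 (y - y₀) with h' | h' <;>
      simp only [max_eq_left, max_eq_right, h, h'] <;> linarith
  refine S.false_of_barrier
    (Q := fun s => (max 0 (K s - K s₀) ^ 2 - max 0 (K s - K s₀ - y₀) ^ 2) / (2 * y₀))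
    (Q' := fun s => (max 0 (K s - K s₀) - max 0 (K s - K s₀ - y₀)) / y₀ * -k s)
    (C := (2 * L) ^ 2 / (2 * y₀) + 2 * L) hs₀mem (fun s => ?_) (fun s => ?_) (by positivity)
    (fun s hs => ?_) (fun s hs => ?_) fun s hs => ?_
  · have h2 : HasDerivAt (fun s => max 0 (K s - K s₀) ^ 2) (2 * max 0 (K s - K s₀) * -k s) s :=
      HasDerivAt.comp s (hasDerivAt_max_zero_sq _) ((hK s).sub_const _)
    have h3 : HasDerivAt (fun s => max 0 (K s - K s₀ - y₀) ^ 2)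
        (2 * max 0 (K s - K s₀ - y₀) * -k s) s :=
      HasDerivAt.comp s (hasDerivAt_max_zero_sq _) (((hK s).sub_const _).sub_const _)
    convert! (h2.sub h3).div_const (2 * y₀) using 1
    field_simp
    ring
  · refine div_nonneg (sub_nonneg.2 ?_) (by positivity)
    have : max 0 (K s - K s₀ - y₀) ≤ max 0 (K s - K s₀) := max_le_max le_rfl (by linarith)
    have h0 : 0 ≤ max 0 (K s - K s₀ - y₀) := le_max_left _ _
    gcongr
  · have h2 := abs_sub_le_of_hasDerivAt (fun t _ => hK t) hkb (hsub s hs)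
      ⟨hs₀mem.1.le, hs₀mem.2.le⟩
    have h3 : max 0 (K s - K s₀) ≤ 2 * L * |s - s₀| :=
      max_le (by positivity) ((le_abs_self _).trans h2)
    have h4 : max 0 (K s - K s₀) ^ 2 ≤ (2 * L * |s - s₀|) ^ 2 := by
      have : 0 ≤ max 0 (K s - K s₀) := le_max_left _ _
      gcongr
    rw [mul_pow, sq_abs] at h4
    have h5 : (max 0 (K s - K s₀) ^ 2 - max 0 (K s - K s₀ - y₀) ^ 2) / (2 * y₀) ≤
        ((2 * L) ^ 2 * (s - s₀) ^ 2) / (2 * y₀) := by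
      gcongr
      linarith [sq_nonneg (max 0 (K s - K s₀ - y₀))]
    have h6 : 0 ≤ 2 * L * (s - s₀) ^ 2 := by positivity
    rw [mul_div_right_comm] at h5
    linarith
  · rw [abs_mul, abs_of_nonneg (hclamp _).1]
    have h2 := mul_le_mul (hclamp (K s - K s₀)).2 (hkb s (hsub s hs)) (abs_nonneg _) zero_le_one
    have h3 : 0 ≤ (2 * L) ^ 2 / (2 * y₀) := by positivity
    linarith
  · obtain ⟨h2, h3⟩ := hclamp (K s - K s₀)
    rcases le_total s (1 - δ₀) with h | h
    · have h4 : K s₂ ≤ K s := hs₂min ⟨hs.1, h⟩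
      have h5 : (max 0 (K s - K s₀) - max 0 (K s - K s₀ - y₀)) / y₀ = 1 := by
        rw [max_eq_right (by linarith), max_eq_right (by linarith)]
        field_simp
        ring
      rw [h5]
      linarith
    · have h4 := hk_nonneg s ⟨h, (hsub s hs).2⟩
      have h5 := mul_le_mul_of_nonneg_right h3 h4
      linarith

theorem FlatSol.exists_normalized_potential (S : FlatSol a A L δ₀ G k e u) :
    ∃ K : ℝ → ℝ, (∀ s, HasDerivAt K (-k s) s) ∧ K (-1) = 0 ∧ K 1 = 0 ∧
      ∀ s ∈ Set.Ioo (-1 : ℝ) 1, 0 < K s := by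
  obtain ⟨K, hK⟩ := S.exists_potential
  have h1 := S.potential_neg_one_le hK
  have h2 := S.flip.potential_neg_one_le (K := fun s => K (-s)) fun s => by
    have := HasDerivAt.comp s (hK (-s)) (hasDerivAt_neg s)
    rwa [mul_neg_one] at this
  have h3 : K 1 ≤ K (-1) := by
    have := h2 1 (by norm_num)
    rwa [neg_neg] at this
  have h4 : K (-1) = K 1 := le_antisymm (h1 1 (by norm_num)) h3
  refine ⟨fun s => K s - K (-1), fun s => (hK s).sub_const _, sub_self _, sub_eq_zero.2 h4.symm,
    fun s hs => ?_⟩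
  obtain ⟨t, ht, hlt⟩ := S.potential_lt_of_mem_Ioo hK hs
  have := h1 t ht
  linarith

end Potential

section PlanarBounds
variable {E : Type*} [NormedAddCommGroup E] [InnerProductSpace ℝ E]
variable {a A L δ₀ : ℝ} {G : (E →L[ℝ] E) → ℝ} {k : ℝ → ℝ} {e : E} {u : E → ℝ}

/-- `φ` is a one-dimensional profile: `φ'' = -k(φ)`, `φ'² = 2K(φ)`, and `Z` is its inverse. -/
structure Profile (k K Z φ : ℝ → ℝ) : Prop where
  arc : ArcLength (-1) 1 K (fun s => -k s) Z
  mem : ∀ t, φ t ∈ Set.Ioo (-1 : ℝ) 1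
  right_inv : ∀ t, Z (φ t) = t
  left_inv : ∀ s ∈ Set.Ioo (-1 : ℝ) 1, φ (Z s) = s

variable {K Z φ : ℝ → ℝ}

theorem Profile.hasDerivAt (h : Profile k K Z φ) (t : ℝ) :
    HasDerivAt φ (√(2 * K (φ t))) t ∧ HasDerivAt (fun t => √(2 * K (φ t))) (-k (φ t)) t := by
  obtain ⟨χ, h1, h2⟩ := h.arc.exists_inverse
  have h3 : χ = φ := by
    ext t
    rw [← h1 _ (h.mem t), h.right_inv]
  subst h3
  have h4 := h2 _ (h.mem t)
  rw [h.right_inv] at h4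
  exact ⟨h4.1.self_of_nhds.2, h4.2⟩

theorem Profile.sqrt_pos (h : Profile k K Z φ) (t : ℝ) : 0 < √(2 * K (φ t)) :=
  h.arc.sqrt_pos (h.mem t)

theorem Profile.strictMono (h : Profile k K Z φ) : StrictMono φ := fun s t hst => by
  rw [← h.arc.strictMonoOn.lt_iff_lt (h.mem s) (h.mem t), h.right_inv, h.right_inv]
  exact hst

theorem Profile.flip (h : Profile k K Z φ) :
    Profile (fun s => -k (-s)) (fun s => K (-s)) (fun s => -Z (-s)) (fun t => -φ (-t)) where
  arc :=
    { pos := fun s hs => h.arc.pos _ ⟨by linarith [hs.2], by linarith [hs.1]⟩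
      hasDerivAt_P := fun s hs => by
        have := HasDerivAt.comp s (h.arc.hasDerivAt_P (-s) ⟨by linarith [hs.2], by linarith [hs.1]⟩)
          (hasDerivAt_neg s)
        rwa [mul_neg_one] at this
      hasDerivAt_Z := fun s hs => by
        have := (HasDerivAt.comp s
          (h.arc.hasDerivAt_Z (-s) ⟨by linarith [hs.2], by linarith [hs.1]⟩) (hasDerivAt_neg s)).neg
        rwa [mul_neg_one, neg_neg] at this }
  mem t := ⟨by linarith [(h.mem (-t)).2], by linarith [(h.mem (-t)).1]⟩
  right_inv t := by rw [neg_neg, h.right_inv, neg_neg]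
  left_inv s hs := by
    rw [neg_neg, h.left_inv _ ⟨by linarith [hs.2], by linarith [hs.1]⟩, neg_neg]

theorem ArcLength.exists_le_of_quadratic {K' : ℝ → ℝ} (hZ : ArcLength (-1) 1 K K' Z) {C : ℝ}
    (hC : 0 ≤ C) (hK : ∀ s ∈ Set.Icc (0 : ℝ) 1, K s ≤ C * (1 - s) ^ 2) (t : ℝ) :
    ∃ s ∈ Set.Ioo (-1 : ℝ) 1, t ≤ Z s := by
  obtain ⟨q, hq⟩ : ∃ q, q = √(2 * C + 1) := ⟨_, rfl⟩
  have hq0 : 0 < q := by rw [hq]; exact Real.sqrt_pos.2 (by linarith)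
  obtain ⟨M, hM⟩ : ∃ M, M = |q * (t - Z 0)| := ⟨_, rfl⟩
  have hM0 : 0 ≤ M := by rw [hM]; exact abs_nonneg _
  obtain ⟨s, hs⟩ : ∃ s, s = 1 - exp (-M) := ⟨_, rfl⟩
  have hs0 : 0 ≤ s := by
    have : exp (-M) ≤ 1 := Real.exp_le_one_iff.2 (by linarith)
    linarith
  have hs1 : s < 1 := by linarith [exp_pos (-M)]
  have hmem : ∀ σ ∈ Set.Icc 0 s, σ ∈ Set.Ioo (-1 : ℝ) 1 := fun σ hσ =>
    ⟨by linarith [hσ.1], by linarith [hσ.2]⟩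
  refine ⟨s, hmem s ⟨hs0, le_rfl⟩, ?_⟩
  have hmono : MonotoneOn (fun σ => Z σ + q⁻¹ * log (1 - σ)) (Set.Icc 0 s) := by
    refine monotoneOn_Icc_of_hasDerivAt (T' := fun σ =>
      (√(2 * K σ))⁻¹ + q⁻¹ * (-1 / (1 - σ))) (fun σ hσ => ?_) fun σ hσ => ?_
    · have h1 : 0 < 1 - σ := by linarith [hσ.2]
      refine (hZ.hasDerivAt_Z σ (hmem σ hσ)).add (HasDerivAt.const_mul _ ?_)
      exact ((hasDerivAt_id σ).const_sub 1).log h1.ne'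
    · have h1 : 0 < 1 - σ := by linarith [hσ.2]
      have h3 : √(2 * K σ) ≤ q * (1 - σ) := by
        rw [hq, ← Real.sqrt_sq h1.le, ← Real.sqrt_mul (by positivity)]
        refine Real.sqrt_le_sqrt ?_
        have := hK σ ⟨hσ.1, by linarith⟩
        linarith [sq_nonneg (1 - σ)]
      have h2 := inv_anti₀ (hZ.sqrt_pos (hmem σ hσ)) h3
      rw [mul_inv] at h2
      have h3 : q⁻¹ * (-1 / (1 - σ)) = -(q⁻¹ * (1 - σ)⁻¹) := by
        rw [neg_div, one_div]; ring
      linarith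
  have h1 := hmono ⟨le_rfl, hs0⟩ ⟨hs0, le_rfl⟩ hs0
  have h2 : log (1 - s) = -M := by rw [hs, sub_sub_cancel, Real.log_exp]
  simp only [sub_zero, Real.log_one, mul_zero, add_zero, h2] at h1
  have h3 : q⁻¹ * (q * (t - Z 0)) ≤ q⁻¹ * M := by
    rw [hM]
    gcongr
    exact le_abs_self _
  rw [inv_mul_cancel_left₀ hq0.ne'] at h3
  linarith

theorem LowerPeano.subJet_inner {χ : ℝ → ℝ} {c₁ c₂ : ℝ} {x : E} (he : ‖e‖ = 1)
    (h : LowerPeano χ ⟪e, x⟫ c₁ c₂) :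
    SubJet (fun y => χ ⟪e, y⟫) x (c₁ • e) (c₂ • rankOneSelf e) := by
  intro η hη
  have ht : Tendsto (fun d : E => ⟪e, d⟫) (𝓝 0) (𝓝 0) := by
    have : Continuous fun d : E => ⟪e, d⟫ := by fun_prop
    simpa using this.tendsto 0
  filter_upwards [ht.eventually (h η hη)] with d hd
  rw [inner_smul_clm, inner_rankOneSelf, real_inner_smul_left, inner_add_right]
  have h1 : ⟪e, d⟫ ^ 2 ≤ ‖d‖ ^ 2 := by
    rw [← sq_abs]
    have := abs_inner_le_norm_of_unit (x := d) he
    gcongr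
  have h2 := mul_le_mul_of_nonneg_left h1 hη.le
  linarith

theorem FlatSol.exists_profile [FiniteDimensional ℝ E] (S : FlatSol a A L δ₀ G k e u) :
    ∃ K Z φ : ℝ → ℝ, Profile k K Z φ ∧ ∀ s ∈ Set.Ioo (-1 : ℝ) 1, k s ^ 2 ≤ L * (2 * K s) := by
  obtain ⟨K, hK, hK1, hK2, hpos⟩ := S.exists_normalized_potential
  obtain ⟨Z, hZ⟩ := exists_arcLength (P := K) (P' := fun s => -k s) hpos fun s _ => hK s
  have hL := S.L_nonneg
  have hup : ∀ s ∈ Set.Icc (-1 : ℝ) 1, K s ≤ L * (1 - s) ^ 2 := fun s hs => by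
    have h1 := abs_sub_le_of_hasDerivAt (K := K) (C := L * (1 - s)) (l := s) (r := 1)
      (fun t _ => hK t) (fun t ht => by
        rw [abs_neg]
        refine (S.abs_k_le ⟨hs.1.trans ht.1, ht.2⟩).1.trans ?_
        have := ht.1
        gcongr) (s := s) (t := 1) ⟨le_rfl, hs.2⟩ ⟨hs.2, le_rfl⟩
    rw [hK2, sub_zero, abs_of_nonpos (a := s - 1) (by linarith [hs.2])] at h1
    have := (le_abs_self _).trans h1
    linarith
  have hdown : ∀ s ∈ Set.Icc (-1 : ℝ) 1, K s ≤ L * (1 + s) ^ 2 := fun s hs => by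
    have h1 := abs_sub_le_of_hasDerivAt (K := K) (C := L * (1 + s)) (l := -1) (r := s)
      (fun t _ => hK t) (fun t ht => by
        rw [abs_neg]
        refine (S.abs_k_le ⟨ht.1, ht.2.trans hs.2⟩).2.trans ?_
        have := ht.2
        gcongr) (s := s) (t := -1) ⟨hs.1, le_rfl⟩ ⟨le_rfl, hs.1⟩
    rw [hK1, sub_zero, abs_of_nonneg (a := s - -1) (by linarith [hs.1])] at h1
    have := (le_abs_self _).trans h1
    linarith
  have hsurj : ∀ t, ∃ s ∈ Set.Ioo (-1 : ℝ) 1, Z s = t := by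
    intro t
    obtain ⟨s₁, hs₁, ht₁⟩ := hZ.exists_le_of_quadratic hL
      (fun s hs => hup s ⟨by linarith [hs.1], hs.2⟩) t
    have hZ' : ArcLength (-1) 1 (fun s => K (-s)) (fun s => k (-s)) (fun s => -Z (-s)) :=
      { pos := fun s hs => hpos _ ⟨by linarith [hs.2], by linarith [hs.1]⟩
        hasDerivAt_P := fun s hs => by
          have := HasDerivAt.comp s (hK (-s)) (hasDerivAt_neg s)
          rwa [mul_neg_one, neg_neg] at this
        hasDerivAt_Z := fun s hs => by
          have := (HasDerivAt.comp s
            (hZ.hasDerivAt_Z (-s) ⟨by linarith [hs.2], by linarith [hs.1]⟩) (hasDerivAt_neg s)).neg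
          rwa [mul_neg_one, neg_neg] at this }
    obtain ⟨s₂, hs₂, ht₂⟩ := hZ'.exists_le_of_quadratic hL (fun s hs => by
      have := hdown (-s) ⟨by linarith [hs.2], by linarith [hs.1]⟩
      rwa [← sub_eq_add_neg] at this) (-t)
    have hcont : ContinuousOn Z (Set.Ioo (-1) 1) := fun s hs =>
      (hZ.hasDerivAt_Z s hs).continuousAt.continuousWithinAt
    exact isPreconnected_Ioo.intermediate_value
      (show -s₂ ∈ Set.Ioo (-1 : ℝ) 1 from ⟨by linarith [hs₂.2], by linarith [hs₂.1]⟩) hs₁ hcont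
      ⟨by linarith, ht₁⟩
  choose φ hφ hφZ using hsurj
  refine ⟨K, Z, φ, ⟨hZ, hφ, hφZ, fun s hs => hZ.strictMonoOn.injOn (hφ _) hs (hφZ _)⟩, ?_⟩
  intro s hs
  obtain ⟨h1, h2⟩ := S.abs_k_le ⟨hs.1.le, hs.2.le⟩
  by_contra! hlt
  have h4 := hpos s hs
  rcases hL.eq_or_lt with h0 | h0
  · rw [← h0, zero_mul] at h1
    have : k s = 0 := abs_nonpos_iff.1 h1
    rw [this, ← h0] at hlt
    simp at hlt
  obtain ⟨b, hb⟩ : ∃ b, b = |k s| / L := ⟨_, rfl⟩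
  have hb0 : 0 ≤ b := by rw [hb]; positivity
  have hLb : L * b = |k s| := by rw [hb]; field_simp
  have hb1 : b ≤ 1 - s := by rw [hb, div_le_iff₀ h0]; linarith
  have hb2 : b ≤ 1 + s := by rw [hb, div_le_iff₀ h0]; linarith
  have key : ∀ ε : ℝ, |ε| = 1 → ε * k s = |k s| → K (s + ε * b) ≤ K s - L * b ^ 2 / 2 := by
    intro ε hε hεk
    have hε2 : ε * ε = 1 := by rw [← abs_mul_abs_self, hε]; norm_num
    have hmono : MonotoneOn (fun τ => -K (s + ε * τ) - (L * b * τ - L * τ ^ 2 / 2))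
        (Set.Icc 0 b) := by
      refine monotoneOn_Icc_of_hasDerivAt
        (T' := fun τ => -(-k (s + ε * τ) * (ε * 1)) - (L * b * 1 - L * (2 * τ) / 2))
        (fun τ _ => ?_) fun τ hτ => ?_
      · have h5 : HasDerivAt (fun τ => s + ε * τ) (ε * 1) τ :=
          ((hasDerivAt_id τ).const_mul ε).const_add s
        have h6 : HasDerivAt (fun τ : ℝ => τ ^ 2) (2 * τ) τ := by simpa using hasDerivAt_pow 2 τ
        exact (HasDerivAt.comp τ (hK _) h5).neg.sub
          (((hasDerivAt_id τ).const_mul (L * b)).sub ((h6.const_mul L).div_const 2))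
      · have h5 := S.lip (s + ε * τ) s
        rw [add_sub_cancel_left, abs_mul, hε, one_mul, abs_of_nonneg hτ.1] at h5
        have h6 : |ε * (k (s + ε * τ) - k s)| ≤ L * τ := by rwa [abs_mul, hε, one_mul]
        have h7 := neg_le_of_abs_le h6
        rw [mul_sub, hεk] at h7
        linarith
    have h5 := hmono ⟨le_rfl, hb0⟩ ⟨hb0, le_rfl⟩ hb0
    simp only [mul_zero, add_zero] at h5
    linarith
  have hK0 : ∀ t ∈ Set.Icc (-1 : ℝ) 1, 0 ≤ K t := fun t ht => by
    rcases eq_or_ne t (-1) with rfl | h5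
    · exact hK1.ge
    rcases eq_or_ne t 1 with rfl | h6
    · exact hK2.ge
    exact (hpos t ⟨lt_of_le_of_ne ht.1 h5.symm, lt_of_le_of_ne ht.2 h6⟩).le
  have hfin : 0 ≤ K s - L * b ^ 2 / 2 := by
    rcases le_total 0 (k s) with h5 | h5
    · refine (hK0 _ ⟨?_, ?_⟩).trans (key 1 (by norm_num) (by rw [one_mul, abs_of_nonneg h5])) <;>
        linarith
    · refine (hK0 _ ⟨?_, ?_⟩).trans (key (-1) (by norm_num) (by rw [abs_of_nonpos h5]; ring)) <;>
        linarith
  have h5 : k s ^ 2 = L * (L * b ^ 2) := by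
    rw [← sq_abs, ← hLb]; ring
  have h6 : L * (L * b ^ 2) ≤ L * (2 * K s) := mul_le_mul_of_nonneg_left (by linarith) hL
  linarith

set_option maxHeartbeats 1000000 in
/-- A solution lies below a translate of the profile. -/
theorem FlatSol.exists_le_profile [FiniteDimensional ℝ E] (S : FlatSol a A L δ₀ G k e u)
    (hφ : Profile k K Z φ) : ∃ s, ∀ x, u x ≤ φ (⟪e, x⟫ + s) := by
  have ha := S.a_pos
  have hA := S.A_nonneg
  have hδ := S.δ₀_mem
  obtain ⟨R₁, hR₁⟩ := S.lim_neg δ₀ hδ.1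
  have hs₁ : 1 - δ₀ ∈ Set.Ioo (-1 : ℝ) 1 := ⟨by linarith [hδ.2], by linarith [hδ.1]⟩
  obtain ⟨s, hs⟩ : ∃ s, s = Z (1 - δ₀) - R₁ := ⟨_, rfl⟩
  refine ⟨s, ?_⟩
  by_contra! hne
  obtain ⟨x, hx⟩ := hne
  have hright : ∀ t, R₁ ≤ t → 1 - δ₀ ≤ φ (t + s) := fun t ht => by
    rw [← hφ.left_inv _ hs₁]
    exact hφ.strictMono.monotone (by linarith)
  have hk : ∀ y, φ (⟪e, y⟫ + s) < u y → k (u y) ≤ k (φ (⟪e, y⟫ + s)) := by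
    intro y hy
    have h1 := S.range y
    have h2 := hφ.mem (⟪e, y⟫ + s)
    rcases le_total R₁ ⟪e, y⟫ with h | h
    · have h3 := hright _ h
      exact S.antitone_pos ⟨h3, h2.2.le⟩ ⟨by linarith, h1.2⟩ hy.le
    · have h3 := hR₁ y h
      exact S.antitone_neg ⟨h2.1.le, by linarith⟩ ⟨h1.1, by linarith⟩ hy.le
  obtain ⟨μ, hμ⟩ : ∃ μ, μ = u x - φ (⟪e, x⟫ + s) := ⟨_, rfl⟩
  have hμ0 : 0 < μ := by rw [hμ]; linarith
  obtain ⟨R, hRx, hRout⟩ : ∃ R, |⟪e, x⟫| ≤ R ∧ ∀ y, R ≤ |⟪e, y⟫| →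
      u y - φ (⟪e, y⟫ + s) ≤ μ / 2 := by
    obtain ⟨R₂, hR₂⟩ := S.lim_neg (μ / 2) (by positivity)
    have hμ1 : max 0 (1 - μ / 2) ∈ Set.Ioo (-1 : ℝ) 1 :=
      ⟨lt_of_lt_of_le (by norm_num) (le_max_left _ _), max_lt one_pos (by linarith)⟩
    refine ⟨|⟪e, x⟫| + |R₂| + |Z (max 0 (1 - μ / 2)) - s|, ?_, fun y hy => ?_⟩
    · have := abs_nonneg R₂
      have := abs_nonneg (Z (max 0 (1 - μ / 2)) - s)
      linarith
    have h1 := abs_nonneg ⟪e, x⟫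
    have h2 := hφ.mem (⟪e, y⟫ + s)
    rcases le_total 0 ⟪e, y⟫ with h | h
    · rw [abs_of_nonneg h] at hy
      have h3 : max 0 (1 - μ / 2) ≤ φ (⟪e, y⟫ + s) := by
        rw [← hφ.left_inv _ hμ1]
        refine hφ.strictMono.monotone ?_
        have := le_abs_self (Z (max 0 (1 - μ / 2)) - s)
        have := abs_nonneg R₂
        linarith
      have h4 := (le_max_right _ _).trans h3
      linarith [(S.range y).2]
    · rw [abs_of_nonpos h] at hy
      have h3 := hR₂ y (by
        have := neg_abs_le R₂
        have := abs_nonneg (Z (max 0 (1 - μ / 2)) - s)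
        linarith)
      linarith [h2.1]
  have hφc : Continuous φ := continuous_iff_continuousAt.2 fun t => (hφ.hasDerivAt t).1.continuousAt
  obtain ⟨m, hm0, hm⟩ : ∃ m > 0, ∀ t ∈ Set.Icc (-R) R, m ≤ √(2 * K (φ (t + s))) := by
    have hR0 : 0 ≤ R := (abs_nonneg _).trans hRx
    have hc : Continuous fun t => √(2 * K (φ t)) :=
      continuous_iff_continuousAt.2 fun t => (hφ.hasDerivAt t).2.continuousAt
    obtain ⟨t, ht, hmin⟩ := isCompact_Icc.exists_isMinOn
      (⟨0, by linarith, hR0⟩ : (Set.Icc (-R) R).Nonempty)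
      (f := fun t => √(2 * K (φ (t + s)))) (hc.comp (by fun_prop)).continuousOn
    exact ⟨_, hφ.sqrt_pos _, fun t ht => hmin ht⟩
  obtain ⟨ε, hε⟩ : ∃ ε, ε = min (m / 4) (μ / 8) := ⟨_, rfl⟩
  have hε0 : 0 < ε := by rw [hε]; positivity
  have hεm : ε ≤ m / 4 := by rw [hε]; exact min_le_left _ _
  have hεμ : ε ≤ μ / 8 := by rw [hε]; exact min_le_right _ _
  have hexp : ∀ t ∈ Set.Icc (-R) R, exp (-(2 * R)) ≤ exp (t - R) ∧ exp (t - R) ≤ 1 := fun t ht =>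
    ⟨Real.exp_le_exp.2 (by linarith [ht.1]), Real.exp_le_one_iff.2 (by linarith [ht.2])⟩
  have hSx := one_le_smoothNorm x
  obtain ⟨δ, hδ0, hδ1, hδ2, hδ3⟩ : ∃ δ : ℝ, 0 < δ ∧ δ < m / 4 ∧ δ * smoothNorm x < μ / 8 ∧
      (a + A) * δ < a * (ε * exp (-(2 * R))) := by
    have h1 : Tendsto (fun δ : ℝ => δ) (𝓝[>] 0) (𝓝 0) :=
      tendsto_nhdsWithin_of_tendsto_nhds tendsto_id
    have h2 : Tendsto (fun δ : ℝ => δ * smoothNorm x) (𝓝[>] 0) (𝓝 0) := by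
      simpa using h1.mul_const (smoothNorm x)
    have h3 : Tendsto (fun δ : ℝ => (a + A) * δ) (𝓝[>] 0) (𝓝 0) := by
      simpa using h1.const_mul (a + A)
    obtain ⟨δ, h4, h5, h6, h7⟩ := (eventually_mem_nhdsWithin.and
      ((h1.eventually_lt_const (by positivity : 0 < m / 4)).and
      ((h2.eventually_lt_const (by positivity : 0 < μ / 8)).and
      (h3.eventually_lt_const (by positivity : 0 < a * (ε * exp (-(2 * R)))))))).exists
    exact ⟨δ, h4, h5, h6, h7⟩
  obtain ⟨Φ, hΦ⟩ : ∃ Φ : E → ℝ, Φ = fun y => -u y - (-φ (⟪e, y⟫ + s) + ε * exp (⟪e, y⟫ - R))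
    + δ * smoothNorm y := ⟨_, rfl⟩
  have hΦc : Continuous Φ := by
    rw [hΦ]
    have h1 := S.continuous
    exact ((h1.neg).sub (by fun_prop)).add (continuous_smoothNorm.const_mul δ)
  have hmemS : ∀ y, |⟪e, y⟫| ≤ R → ⟪e, y⟫ ∈ Set.Icc (-R) R := fun y hy => abs_le.1 hy
  obtain ⟨y, hy, hyx, hmin⟩ := exists_min_of_bounded_sublevel hΦc
    (S := {y | |⟪e, y⟫| ≤ R}) (isClosed_le (by fun_prop) continuous_const) (z₀ := x) hRx (by
      refine (isBounded_closedBall (x := (0 : E)) (r := (Φ x + 2 + ε) / δ)).subset ?_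
      rintro z ⟨hz1, hz2⟩
      rw [mem_closedBall_zero_iff, le_div_iff₀ hδ0]
      have h1 := (hexp _ (hmemS z hz1)).2
      have h2 := norm_le_smoothNorm z
      have h3 : ‖z‖ * δ ≤ δ * smoothNorm z := by rw [mul_comm]; gcongr
      have h4 := mul_le_mul_of_nonneg_left h1 hε0.le
      have h5 := (S.range z).2
      have h6 := (hφ.mem (⟪e, z⟫ + s)).1
      have h7 : Φ z = -u z - (-φ (⟪e, z⟫ + s) + ε * exp (⟪e, z⟫ - R)) + δ * smoothNorm z := by
        rw [hΦ]
      linarith)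
  have hEy := hexp _ (hmemS y hy)
  have hdiff : μ / 2 < u y - φ (⟪e, y⟫ + s) := by
    have h1 : 0 < δ * smoothNorm y := mul_pos hδ0 (by linarith [one_le_smoothNorm y])
    have h2 := mul_le_mul_of_nonneg_left hEy.2 hε0.le
    have h3 : 0 < ε * exp (⟪e, x⟫ - R) := by positivity
    rw [hΦ] at hyx
    simp only at hyx
    linarith
  have hyR : |⟪e, y⟫| < R := by
    by_contra! h
    linarith [hRout y h]
  obtain ⟨b, D, hbD, hb, hD⟩ := exists_subJet_neg_smoothNorm y
  have hpeano : LowerPeano (fun t => -φ (t + s) + ε * exp (t - R)) ⟪e, y⟫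
      (-√(2 * K (φ (⟪e, y⟫ + s))) + ε * exp (⟪e, y⟫ - R))
      (k (φ (⟪e, y⟫ + s)) + ε * exp (⟪e, y⟫ - R)) := by
    have hexpd : ∀ t, HasDerivAt (fun t => ε * exp (t - R)) (ε * exp (t - R)) t := fun t => by
      simpa using ((hasDerivAt_id t).sub_const R).exp.const_mul ε
    refine lowerPeano_of_deriv (χ' := fun t => -√(2 * K (φ (t + s))) + ε * exp (t - R))
      (Eventually.of_forall fun t => ?_) ?_
    · exact ((hφ.hasDerivAt (t + s)).1.comp_add_const t s).neg.add (hexpd t)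
    · have := ((hφ.hasDerivAt (⟪e, y⟫ + s)).2.comp_add_const ⟪e, y⟫ s).neg.add (hexpd ⟪e, y⟫)
      rwa [neg_neg] at this
  obtain ⟨c₁, hc₁⟩ : ∃ c₁, c₁ = -√(2 * K (φ (⟪e, y⟫ + s))) + ε * exp (⟪e, y⟫ - R) := ⟨_, rfl⟩
  obtain ⟨c₂, hc₂⟩ : ∃ c₂, c₂ = k (φ (⟪e, y⟫ + s)) + ε * exp (⟪e, y⟫ - R) := ⟨_, rfl⟩
  rw [← hc₁, ← hc₂] at hpeano
  have hj : SubJet (fun z => -u z) y (c₁ • e + δ • b) (c₂ • rankOneSelf e + δ • D) := by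
    have h1 := ((hpeano.subJet_inner S.norm_e).add (hbD.const_mul hδ0.le)).const_add
      (-u y - (-φ (⟪e, y⟫ + s) + ε * exp (⟪e, y⟫ - R)) + δ * smoothNorm y)
    refine h1.mono_left (by ring) ?_
    have h2 : ∀ᶠ z in 𝓝 y, |⟪e, z⟫| < R :=
      (isOpen_lt (by fun_prop) continuous_const).mem_nhds hyR
    filter_upwards [h2] with z hz
    have h4 := hmin z hz.le
    rw [hΦ] at h4
    simp only at h4
    linarith
  have hj2 := hj.superJet_neg
  simp only [neg_neg] at hj2
  have hp : -(c₁ • e + δ • b) ≠ 0 := by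
    refine neg_ne_zero.2 fun h => ?_
    have h1 : c₁ • e = -(δ • b) := eq_neg_of_add_eq_zero_left h
    have h2 : |c₁| ≤ δ := by
      have h3 : ‖c₁ • e‖ ≤ δ := by
        rw [h1, norm_neg, norm_smul, Real.norm_of_nonneg hδ0.le]
        exact mul_le_of_le_one_right hδ0.le hb
      rwa [norm_smul, S.norm_e, mul_one] at h3
    have h3 := neg_le_of_abs_le h2
    have h4 := hm _ (hmemS y hy)
    have h5 := mul_le_mul_of_nonneg_left hEy.2 hε0.le
    linarith
  have h1 := S.superJet _ _ _ hp hj2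
  have h2 := hk y (by linarith)
  have h3 : ε * exp (-(2 * R)) ≤ ε * exp (⟪e, y⟫ - R) := mul_le_mul_of_nonneg_left hEy.1 hε0.le
  have hest : ∀ z, -(δ * ‖z‖ ^ 2) + (c₂ - k (u y)) * ⟪e, z⟫ ^ 2 ≤ ⟪(-k (u y) • rankOneSelf e) z, z⟫
      - ⟪(-(c₂ • rankOneSelf e + δ • D)) z, z⟫ := by
    intro z
    rw [neg_apply, inner_neg_left, inner_add_clm, inner_smul_clm,
      inner_smul_clm, inner_smul_clm, inner_rankOneSelf]
    have h4 : δ * -‖z‖ ^ 2 ≤ δ * ⟪D z, z⟫ := by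
      have := hD z
      gcongr
    linarith
  have hc : ε * exp (-(2 * R)) ≤ c₂ - k (u y) := by linarith
  have hc0 : 0 < ε * exp (-(2 * R)) := by positivity
  have h4 := S.elliptic.gain (-(c₂ • rankOneSelf e + δ • D)) (-k (u y) • rankOneSelf e)
    δ (ε * exp (-(2 * R)) - δ) e hδ0.le S.norm_e (fun z => by
      have h3 := hest z
      have h4 : 0 ≤ (c₂ - k (u y)) * ⟪e, z⟫ ^ 2 := mul_nonneg (by linarith) (sq_nonneg _)
      linarith) (by
      have h3 := hest e
      rw [real_inner_self_eq_norm_sq, S.norm_e] at h3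
      linarith)
  linarith

/-- A solution lies between two translates of the profile. -/
theorem FlatSol.exists_abs_sub_le [FiniteDimensional ℝ E] (S : FlatSol a A L δ₀ G k e u)
    (hφ : Profile k K Z φ) : (∀ x, u x ∈ Set.Ioo (-1 : ℝ) 1) ∧
      ∃ θ, ∀ x, |Z (u x) - ⟪e, x⟫| ≤ θ := by
  obtain ⟨s, hs⟩ := S.exists_le_profile hφ
  obtain ⟨s', hs'⟩ := S.flip.exists_le_profile hφ.flip
  have hlow : ∀ x, φ (⟪e, x⟫ - s') ≤ u x := fun x => by
    have := hs' (-x)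
    rw [neg_neg, inner_neg_right, show -(-⟪e, x⟫ + s') = ⟪e, x⟫ - s' by ring] at this
    linarith
  have hmem : ∀ x, u x ∈ Set.Ioo (-1 : ℝ) 1 := fun x =>
    ⟨(hφ.mem _).1.trans_le (hlow x), (hs x).trans_lt (hφ.mem _).2⟩
  refine ⟨hmem, |s| + |s'|, fun x => ?_⟩
  have h1 := (hφ.arc.strictMonoOn.le_iff_le (hmem x) (hφ.mem _)).2 (hs x)
  have h2 := (hφ.arc.strictMonoOn.le_iff_le (hφ.mem _) (hmem x)).2 (hlow x)
  rw [hφ.right_inv] at h1 h2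
  rw [abs_le]
  constructor <;> linarith [le_abs_self s, le_abs_self s', abs_nonneg s, abs_nonneg s']

end PlanarBounds

section FlattenedEquation
variable {E : Type*} [NormedAddCommGroup E] [InnerProductSpace ℝ E]
variable {a A L δ₀ : ℝ} {G : (E →L[ℝ] E) → ℝ} {k : ℝ → ℝ} {e : E} {u : E → ℝ}
variable {K Z φ : ℝ → ℝ}

theorem EllipticOp.abs_sub_le (hG : EllipticOp a A G) (he : ‖e‖ = 1) {X Y : E →L[ℝ] E} {c : ℝ}
    (hc : 0 ≤ c) (h : ∀ d, |⟪X d, d⟫ - ⟪Y d, d⟫| ≤ c * ‖d‖ ^ 2) :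
    |G X - G Y| ≤ (a + A) * c := by
  have h1 := h e
  rw [he, one_pow, mul_one] at h1
  have h2 := hG.gain X Y c (-c) e hc he
    (fun d => by linarith [le_abs_self (⟪X d, d⟫ - ⟪Y d, d⟫), h d])
    (by linarith [le_abs_self (⟪X e, e⟫ - ⟪Y e, e⟫)])
  have h3 := hG.gain Y X c (-c) e hc he
    (fun d => by linarith [neg_abs_le (⟪X d, d⟫ - ⟪Y d, d⟫), h d])
    (by linarith [neg_abs_le (⟪X e, e⟫ - ⟪Y e, e⟫)])
  rw [abs_le]
  constructor <;> linarith

theorem inner_sq_le_norm_sq (p d : E) : ⟪p, d⟫ ^ 2 ≤ ‖p‖ ^ 2 * ‖d‖ ^ 2 := by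
  rw [← mul_pow, ← sq_abs]
  exact pow_le_pow_left₀ (abs_nonneg _) (abs_real_inner_le_norm p d) 2

theorem abs_inner_sq_sub_le {Λ : ℝ} {p p' : E} (hp : ‖p‖ ≤ Λ) (hp' : ‖p'‖ ≤ Λ) (d : E) :
    |⟪p', d⟫ ^ 2 - ⟪p, d⟫ ^ 2| ≤ 2 * Λ * ‖p - p'‖ * ‖d‖ ^ 2 := by
  have h1 : ⟪p', d⟫ ^ 2 - ⟪p, d⟫ ^ 2 = ⟪p' + p, d⟫ * ⟪p' - p, d⟫ := by
    rw [inner_add_left, inner_sub_left]; ring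
  rw [h1, abs_mul]
  have h2 : |⟪p' + p, d⟫| ≤ 2 * Λ * ‖d‖ := by
    refine (abs_real_inner_le_norm _ _).trans ?_
    have := norm_add_le p' p
    gcongr
    linarith
  have h3 : |⟪p' - p, d⟫| ≤ ‖p - p'‖ * ‖d‖ := by
    rw [norm_sub_rev]
    exact abs_real_inner_le_norm _ _
  calc _ ≤ (2 * Λ * ‖d‖) * (‖p - p'‖ * ‖d‖) :=
        mul_le_mul h2 h3 (abs_nonneg _) ((abs_nonneg _).trans h2)
    _ = _ := by ring

/-- Structure condition for the operator with quadratic gradient term. -/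
theorem EllipticOp.structCond (hG : EllipticOp a A G) (haA : 0 ≤ a + A) (he : ‖e‖ = 1)
    {κ : ℝ → ℝ} {B C Λ : ℝ} (hB : 0 ≤ B) (hC : 0 ≤ C) (hΛ : 0 ≤ Λ) (hκB : ∀ t, |κ t| ≤ B)
    (hκC : ∀ s t, |κ s - κ t| ≤ C * |s - t|) :
    StructCond a A ((a + A) * (C * (Λ ^ 2 + 1) + 2 * B * Λ)) (fun p : E => p ≠ 0 ∧ ‖p‖ ≤ Λ)
      (fun s p X => G (X + κ s • rankOneSelf p) - G (κ s • rankOneSelf e)) := by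
  intro s s' p p' X Y c₁ c₃ e' hp hp' hc he' hk hke
  obtain ⟨m, hm⟩ : ∃ m, m = C * Λ ^ 2 * |s - s'| + 2 * B * Λ * ‖p - p'‖ := ⟨_, rfl⟩
  have hm0 : 0 ≤ m := by rw [hm]; positivity
  have hκ : ∀ d, |κ s' * ⟪p', d⟫ ^ 2 - κ s * ⟪p, d⟫ ^ 2| ≤ m * ‖d‖ ^ 2 := fun d => by
    have h1 : κ s' * ⟪p', d⟫ ^ 2 - κ s * ⟪p, d⟫ ^ 2 =
        (κ s' - κ s) * ⟪p', d⟫ ^ 2 + κ s * (⟪p', d⟫ ^ 2 - ⟪p, d⟫ ^ 2) := by ring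
    rw [h1]
    refine (abs_add_le _ _).trans ?_
    rw [abs_mul, abs_mul, abs_of_nonneg (sq_nonneg ⟪p', d⟫)]
    have h2 : |κ s' - κ s| ≤ C * |s - s'| := by rw [abs_sub_comm]; exact hκC s s'
    have h3 : ⟪p', d⟫ ^ 2 ≤ Λ ^ 2 * ‖d‖ ^ 2 := by
      refine (inner_sq_le_norm_sq p' d).trans ?_
      have := hp'.2
      gcongr
    have h4 := abs_inner_sq_sub_le hp.2 hp'.2 d
    have h5 := mul_le_mul h2 h3 (sq_nonneg _) (by positivity)
    have h6 := mul_le_mul (hκB s) h4 (abs_nonneg _) hB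
    rw [hm]
    linarith
  have h1 := hG.gain (X + κ s • rankOneSelf p) (Y + κ s' • rankOneSelf p') (c₁ + m) (c₃ - m) e'
    (by positivity) he' (fun d => by
      rw [inner_add_clm, inner_add_clm, inner_smul_clm, inner_smul_clm, inner_rankOneSelf,
        inner_rankOneSelf]
      have := neg_abs_le (κ s' * ⟪p', d⟫ ^ 2 - κ s * ⟪p, d⟫ ^ 2)
      linarith [hκ d, hk d])
    (by
      rw [inner_add_clm, inner_add_clm, inner_smul_clm, inner_smul_clm, inner_rankOneSelf,
        inner_rankOneSelf]
      have := neg_abs_le (κ s' * ⟪p', e'⟫ ^ 2 - κ s * ⟪p, e'⟫ ^ 2)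
      have h2 := hκ e'
      rw [he', one_pow, mul_one] at h2
      linarith)
  have h2 := hG.abs_sub_le he (X := κ s' • rankOneSelf e) (Y := κ s • rankOneSelf e)
    (c := C * |s - s'|) (by positivity) (fun d => by
      rw [inner_smul_clm, inner_smul_clm, inner_rankOneSelf, ← sub_mul, abs_mul,
        abs_of_nonneg (sq_nonneg ⟪e, d⟫)]
      have h3 := inner_sq_le_norm_sq e d
      rw [he, one_pow, one_mul] at h3
      have h4 : |κ s' - κ s| ≤ C * |s - s'| := by rw [abs_sub_comm]; exact hκC s s'
      exact mul_le_mul h4 h3 (sq_nonneg _) (by positivity))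
  have h3 := le_abs_self (G (κ s' • rankOneSelf e) - G (κ s • rankOneSelf e))
  have h4 : 0 ≤ (a + A) * (C * (Λ ^ 2 + 1) * ‖p - p'‖ + 2 * B * Λ * |s - s'|) := by positivity
  have h5 : (a + A) * m = (a + A) * (C * Λ ^ 2 * |s - s'| + 2 * B * Λ * ‖p - p'‖) := by rw [hm]
  linarith

theorem Profile.exists_logDeriv_bounds (hφ : Profile k K Z φ) (hL : 0 ≤ L)
    (hk : ∀ s t, |k s - k t| ≤ L * |s - t|)
    (hkK : ∀ s ∈ Set.Ioo (-1 : ℝ) 1, k s ^ 2 ≤ L * (2 * K s)) :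
    ∃ B C : ℝ, 0 ≤ B ∧ 0 ≤ C ∧ (∀ t, |-k (φ t) / √(2 * K (φ t))| ≤ B) ∧
      ∀ s t, |-k (φ s) / √(2 * K (φ s)) - -k (φ t) / √(2 * K (φ t))| ≤ C * |s - t| := by
  obtain ⟨w, hw⟩ : ∃ w : ℝ → ℝ, w = fun t => √(2 * K (φ t)) := ⟨_, rfl⟩
  have hwt : ∀ t, √(2 * K (φ t)) = w t := fun t => by rw [hw]
  have hw0 : ∀ t, 0 < w t := fun t => by rw [← hwt]; exact hφ.sqrt_pos t
  obtain ⟨κ, hκ⟩ : ∃ κ : ℝ → ℝ, κ = fun t => -k (φ t) / w t := ⟨_, rfl⟩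
  have hκt : ∀ t, -k (φ t) / √(2 * K (φ t)) = κ t := fun t => by rw [hκ, hwt]
  simp only [hκt]
  have hκw : ∀ t, -k (φ t) = κ t * w t := fun t => by
    rw [hκ]; exact (div_mul_cancel₀ _ (hw0 t).ne').symm
  obtain ⟨B, hB⟩ : ∃ B, B = L + 1 := ⟨_, rfl⟩
  have hB0 : 0 ≤ B := by linarith
  have hκB : ∀ t, |κ t| ≤ B := fun t => by
    have h1 := hkK _ (hφ.mem t)
    have h2 : w t ^ 2 = 2 * K (φ t) := by
      rw [← hwt]
      exact Real.sq_sqrt (by linarith [hφ.arc.pos _ (hφ.mem t)])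
    have h3 : k (φ t) ^ 2 = (κ t) ^ 2 * w t ^ 2 := by
      rw [← mul_pow, ← hκw, neg_sq]
    rw [h3, ← h2] at h1
    have h4 : (κ t) ^ 2 ≤ L := le_of_mul_le_mul_right h1 (by have := hw0 t; positivity)
    refine abs_le_of_sq_le_sq (h4.trans ?_) hB0
    rw [hB]
    linarith [sq_nonneg L]
  have hdφ : ∀ t, HasDerivAt φ (w t) t := fun t => by rw [← hwt]; exact (hφ.hasDerivAt t).1
  have hdw : ∀ t, HasDerivAt w (κ t * w t) t := fun t => by
    rw [← hκw]; rw [hw]; exact (hφ.hasDerivAt t).2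
  obtain ⟨M, hM⟩ : ∃ M, M = exp B := ⟨_, rfl⟩
  have hM0 : 0 < M := by rw [hM]; exact exp_pos _
  have hgrow : ∀ s t, |s - t| ≤ 1 → w s ≤ w t * M := fun s t hst => by
    obtain ⟨l, hl⟩ : ∃ l, l = min s t := ⟨_, rfl⟩
    obtain ⟨r, hr⟩ : ∃ r, r = max s t := ⟨_, rfl⟩
    have h1 := abs_sub_le_of_hasDerivAt (K := fun τ => log (w τ)) (K' := κ) (C := B) (l := l)
      (r := r) (fun τ _ => by
        have := (hdw τ).log (hw0 τ).ne'
        rwa [mul_div_cancel_right₀ _ (hw0 τ).ne'] at this) (fun τ _ => hκB τ)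
      (s := s) (t := t) ⟨by rw [hl]; exact min_le_left _ _, by rw [hr]; exact le_max_left _ _⟩
      ⟨by rw [hl]; exact min_le_right _ _, by rw [hr]; exact le_max_right _ _⟩
    have h2 : log (w s) ≤ log (w t) + B := by
      have h3 := (le_abs_self _).trans h1
      have h4 : B * |s - t| ≤ B * 1 := by gcongr
      linarith
    calc w s = exp (log (w s)) := (exp_log (hw0 s)).symm
      _ ≤ exp (log (w t) + B) := exp_le_exp.2 h2
      _ = _ := by rw [exp_add, exp_log (hw0 t), hM]
  have hloc : ∀ s t, |s - t| ≤ 1 → |κ s - κ t| ≤ (L * M + B * (B * M)) * |s - t| := by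
    intro s t hst
    have hbd : ∀ τ ∈ Set.Icc (min s t) (max s t), w τ ≤ w s * M := fun τ hτ => by
      refine hgrow τ s (le_trans ?_ hst)
      rcases le_total s t with h | h
      · rw [min_eq_left h, max_eq_right h] at hτ
        rw [abs_of_nonneg (by linarith [hτ.1]), abs_of_nonpos (by linarith)]
        linarith [hτ.2]
      · rw [min_eq_right h, max_eq_left h] at hτ
        rw [abs_of_nonpos (by linarith [hτ.2]), abs_of_nonneg (by linarith)]
        linarith [hτ.1]
    have hsm : s ∈ Set.Icc (min s t) (max s t) := ⟨min_le_left _ _, le_max_left _ _⟩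
    have htm : t ∈ Set.Icc (min s t) (max s t) := ⟨min_le_right _ _, le_max_right _ _⟩
    have h1 := abs_sub_le_of_hasDerivAt (K := φ) (K' := w) (C := w s * M)
      (fun τ _ => hdφ τ) (fun τ hτ => by rw [abs_of_pos (hw0 τ)]; exact hbd τ hτ) hsm htm
    have h2 := abs_sub_le_of_hasDerivAt (K := w) (K' := fun τ => κ τ * w τ) (C := B * (w s * M))
      (fun τ _ => hdw τ) (fun τ hτ => by
        rw [abs_mul, abs_of_pos (hw0 τ)]
        exact mul_le_mul (hκB τ) (hbd τ hτ) (hw0 τ).le hB0) hsm htm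
    have h3 : (κ s - κ t) * w s = (k (φ t) - k (φ s)) - κ t * (w s - w t) := by
      have e1 := hκw s
      have e2 := hκw t
      linarith
    have h4 : |κ s - κ t| * w s ≤ ((L * M + B * (B * M)) * |s - t|) * w s := by
      rw [← abs_of_pos (hw0 s), ← abs_mul, abs_of_pos (hw0 s), h3]
      refine (abs_sub _ _).trans ?_
      rw [abs_mul]
      have h5 := hk (φ t) (φ s)
      rw [abs_sub_comm (φ t)] at h5
      have h6 := mul_le_mul_of_nonneg_left h1 hL
      have h7 := mul_le_mul (hκB t) h2 (abs_nonneg _) hB0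
      linarith
    exact le_of_mul_le_mul_right h4 (hw0 s)
  refine ⟨B, (L * M + B * (B * M)) + 2 * B, hB0, by positivity, hκB, fun s t => ?_⟩
  have hpos : 0 ≤ L * M + B * (B * M) := by positivity
  rcases le_total |s - t| 1 with h | h
  · have := hloc s t h
    have h2 : 0 ≤ 2 * B * |s - t| := by positivity
    linarith
  · have h1 : |κ s - κ t| ≤ 2 * B := (abs_sub _ _).trans (by linarith [hκB s, hκB t])
    have h2 : 2 * B * 1 ≤ 2 * B * |s - t| := by gcongr
    have h3 : 0 ≤ (L * M + B * (B * M)) * |s - t| := by positivity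
    linarith

theorem FlatSol.superJet_flat (S : FlatSol a A L δ₀ G k e u) (hφ : Profile k K Z φ)
    (hu : ∀ x, u x ∈ Set.Ioo (-1 : ℝ) 1) {x p : E} {X : E →L[ℝ] E} (hp : p ≠ 0) :
    (SuperJet (fun y => Z (u y)) x p X →
      G ((-k (u x) / √(2 * K (u x))) • rankOneSelf e) ≤
        G (X + (-k (u x) / √(2 * K (u x))) • rankOneSelf p)) ∧
    (SubJet (fun y => Z (u y)) x p X →
      G (X + (-k (u x) / √(2 * K (u x))) • rankOneSelf p) ≤
        G ((-k (u x) / √(2 * K (u x))) • rankOneSelf e)) := by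
  obtain ⟨w, hw⟩ : ∃ w, w = √(2 * K (u x)) := ⟨_, rfl⟩
  have hw0 : 0 < w := by rw [hw]; exact hφ.arc.sqrt_pos (hu x)
  have h1 : ∀ Y : E →L[ℝ] E, w * G (Y + (-k (u x) / w) • rankOneSelf p) =
      G (w • Y + (-k (u x)) • rankOneSelf p) := fun Y => by
    rw [← S.elliptic.homog _ hw0.le, smul_add, smul_smul, mul_div_cancel₀ _ hw0.ne']
  have h2 : w * G ((-k (u x) / w) • rankOneSelf e) = G ((-k (u x)) • rankOneSelf e) := by
    rw [← S.elliptic.homog _ hw0.le, smul_smul, mul_div_cancel₀ _ hw0.ne']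
  have hwp : w • p ≠ 0 := smul_ne_zero hw0.ne' hp
  rw [← hw]
  constructor <;> intro h <;> refine le_of_mul_le_mul_left ?_ hw0 <;> rw [h1, h2]
  · refine S.superJet x (w • p) _ hwp ?_
    rw [hw]
    exact hφ.arc.superJet S.continuous.continuousAt (hu x) h
  · refine S.subJet x (w • p) _ hwp ?_
    rw [hw]
    exact hφ.arc.subJet S.continuous.continuousAt (hu x) h

theorem FlatSol.exists_flat_equation [FiniteDimensional ℝ E] (S : FlatSol a A L δ₀ G k e u)
    (hφ : Profile k K Z φ) (hkK : ∀ s ∈ Set.Ioo (-1 : ℝ) 1, k s ^ 2 ≤ L * (2 * K s)) :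
    ∃ (θ Λ L' : ℝ) (𝒢 : ℝ → E → (E →L[ℝ] E) → ℝ), 0 < Λ ∧ 0 ≤ L' ∧
      (∀ x, |Z (u x) - ⟪e, x⟫| ≤ θ) ∧ (∀ x y, |Z (u x) - Z (u y)| ≤ Λ * ‖x - y‖) ∧
      StructCond a A L' (fun p => p ≠ 0 ∧ ‖p‖ ≤ Λ) 𝒢 ∧
      JetSol (fun p => p ≠ 0 ∧ ‖p‖ ≤ Λ) 𝒢 Set.univ fun x => Z (u x) := by
  obtain ⟨hu, θ, hθ⟩ := S.exists_abs_sub_le hφ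
  have ha := S.a_pos
  have hA := S.A_nonneg
  have haA : 0 ≤ a + A := by linarith
  obtain ⟨B, C, hB, hC, hκB, hκC⟩ := hφ.exists_logDeriv_bounds S.L_nonneg S.lip hkK
  obtain ⟨κ, hκ⟩ : ∃ κ : ℝ → ℝ, κ = fun t => -k (φ t) / √(2 * K (φ t)) := ⟨_, rfl⟩
  have hκt : ∀ t, -k (φ t) / √(2 * K (φ t)) = κ t := fun t => by rw [hκ]
  simp only [hκt] at hκB hκC
  have hκu : ∀ x, -k (u x) / √(2 * K (u x)) = κ (Z (u x)) := fun x => by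
    rw [hκ]
    simp only [hφ.left_inv _ (hu x)]
  have hjet := fun (x p : E) (X : E →L[ℝ] E) (hp : p ≠ 0) =>
    S.superJet_flat hφ hu (x := x) (X := X) hp
  simp only [hκu] at hjet
  have hcont : Continuous fun x => Z (u x) := continuous_iff_continuousAt.2 fun x =>
    (hφ.arc.hasDerivAt_Z _ (hu x)).continuousAt.comp (f := u) S.continuous.continuousAt
  have hrank : ∀ s (p : E) (X : E →L[ℝ] E), |G (X + κ s • rankOneSelf p) - G X| ≤
      (a + A) * (B * ‖p‖ ^ 2) := fun s p X =>
    S.elliptic.abs_sub_le S.norm_e (by positivity) fun d => by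
      rw [inner_add_clm, inner_smul_clm, inner_rankOneSelf, add_sub_cancel_left, abs_mul,
        abs_of_nonneg (sq_nonneg ⟪p, d⟫)]
      have := mul_le_mul (hκB s) (inner_sq_le_norm_sq p d) (sq_nonneg _) hB
      linarith
  have hG0 : G 0 = 0 := by
    have := S.elliptic.homog 0 le_rfl 0
    rwa [zero_smul, zero_mul] at this
  have hranke : ∀ s, |G (κ s • rankOneSelf e)| ≤ (a + A) * B := fun s => by
    have := hrank s e 0
    rwa [zero_add, hG0, sub_zero, S.norm_e, one_pow, mul_one] at this
  obtain ⟨Λ, hΛ', hlip⟩ := exists_lipschitz_of_jets (C := (a + A) * B) (B := 2 * θ + 1) S.elliptic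
    ha hA hcont (by positivity) (fun x y hxy => by
      have h1 := (le_abs_self _).trans (hθ x)
      have h2 := (neg_le_of_abs_le (hθ y))
      have h3 := abs_inner_le_norm_of_unit (x := y - x) S.norm_e
      have h4 := neg_le_of_abs_le h3
      rw [inner_sub_right] at h4
      linarith) (fun x p X hp => by
      have hp0 : p ≠ 0 := fun h => by rw [h, norm_zero] at hp; linarith
      have h1 := abs_le.1 (hrank (Z (u x)) p X)
      have h2 := abs_le.1 (hranke (Z (u x)))
      refine ⟨fun h => ?_, fun h => ?_⟩
      · have := (hjet x p X hp0).1 h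
        linarith
      · have := (hjet x p X hp0).2 h
        linarith)
  have hΛ : 0 < Λ + 1 := by linarith
  refine ⟨θ, Λ + 1, _, _, hΛ, ?_, hθ, fun x y => (hlip x y).trans (by gcongr; linarith),
    S.elliptic.structCond haA S.norm_e hB hC hΛ.le hκB hκC, fun x _ p X hp => ?_⟩
  · positivity
  · exact ⟨fun h => sub_nonneg.2 ((hjet x p X hp.1).1 h),
      fun h => sub_nonpos.2 ((hjet x p X hp.1).2 h)⟩

end FlattenedEquation

section ShiftInfimum
variable {E : Type*} [NormedAddCommGroup E] [InnerProductSpace ℝ E]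
variable {a A L Λ θ₀ : ℝ} {𝒢 : ℝ → E → (E →L[ℝ] E) → ℝ} {e : E} {v : E → ℝ} {T : E → ℝ}

/-- A Lipschitz solution at bounded distance from the linear function `⟪e, ·⟫`. -/
structure NearLinearSol (a A L Λ θ₀ : ℝ) (𝒢 : ℝ → E → (E →L[ℝ] E) → ℝ) (e : E) (v : E → ℝ) :
    Prop where
  a_pos : 0 < a
  A_nonneg : 0 ≤ A
  L_nonneg : 0 ≤ L
  Λ_pos : 0 < Λ
  norm_e : ‖e‖ = 1
  near : ∀ x, |v x - ⟪e, x⟫| ≤ θ₀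
  lip : ∀ x y, |v x - v y| ≤ Λ * ‖x - y‖
  structCond : StructCond a A L (fun p => p ≠ 0 ∧ ‖p‖ ≤ Λ) 𝒢
  jetSol : JetSol (fun p => p ≠ 0 ∧ ‖p‖ ≤ Λ) 𝒢 Set.univ v

theorem NearLinearSol.continuous (S : NearLinearSol a A L Λ θ₀ 𝒢 e v) : Continuous v := by
  refine (LipschitzWith.of_dist_le_mul (K := Λ.toNNReal) fun x y => ?_).continuous
  rw [Real.dist_eq, dist_eq_norm, Real.coe_toNNReal _ S.Λ_pos.le]
  exact S.lip x y

/-- `T h` is the infimum over `x` of `v (x + h) - v x`. -/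
structure ShiftInf (v T : E → ℝ) : Prop where
  le : ∀ h x, T h ≤ v (x + h) - v x
  exists_lt : ∀ h c, T h < c → ∃ x, v (x + h) - v x < c

theorem NearLinearSol.le_shift (S : NearLinearSol a A L Λ θ₀ 𝒢 e v) (h x : E) :
    ⟪e, h⟫ - 2 * θ₀ ≤ v (x + h) - v x := by
  have h1 := neg_le_of_abs_le (S.near (x + h))
  have h2 := le_of_abs_le (S.near x)
  rw [inner_add_right] at h1
  linarith

theorem NearLinearSol.exists_shiftInf (S : NearLinearSol a A L Λ θ₀ 𝒢 e v) :
    ∃ T, ShiftInf v T := by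
  refine ⟨fun h => ⨅ x, (v (x + h) - v x), fun h x => ciInf_le ?_ x, fun h c hc =>
    exists_lt_of_ciInf_lt hc⟩
  refine ⟨⟪e, h⟫ - 2 * θ₀, ?_⟩
  rintro _ ⟨x, rfl⟩
  exact S.le_shift h x

theorem NearLinearSol.sub_le_shift (S : NearLinearSol a A L Λ θ₀ 𝒢 e v) (x h h' : E) :
    v (x + h) - v x - Λ * ‖h' - h‖ ≤ v (x + h') - v x := by
  have h1 := neg_le_of_abs_le (S.lip (x + h') (x + h))
  rw [add_sub_add_left_eq_sub] at h1
  linarith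

theorem ShiftInf.lip (hT : ShiftInf v T) (S : NearLinearSol a A L Λ θ₀ 𝒢 e v) (h h' : E) :
    T h - Λ * ‖h' - h‖ ≤ T h' := by
  by_contra! hc
  obtain ⟨x, hx⟩ := hT.exists_lt _ _ hc
  have h1 := S.sub_le_shift x h h'
  have h2 := hT.le h x
  linarith

theorem ShiftInf.continuous (hT : ShiftInf v T) (S : NearLinearSol a A L Λ θ₀ 𝒢 e v) :
    Continuous T := by
  refine (LipschitzWith.of_dist_le_mul (K := Λ.toNNReal) fun x y => ?_).continuous
  rw [Real.dist_eq, dist_eq_norm, Real.coe_toNNReal _ S.Λ_pos.le, abs_le]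
  have h1 := hT.lip S x y
  have h2 := hT.lip S y x
  rw [norm_sub_rev] at h1
  constructor <;> linarith

variable [FiniteDimensional ℝ E]

set_option maxHeartbeats 1000000 in
/-- Hopf lemma for the infimum of the shifts. -/
theorem ShiftInf.hopf (hT : ShiftInf v T) (S : NearLinearSol a A L Λ θ₀ 𝒢 e v) {c : E} {d : ℝ}
    (hd : 0 < d) (hpos : ∀ h, ‖h - c‖ < d → 0 < T h) (hnn : ∀ h, ‖h - c‖ ≤ d → 0 ≤ T h) :
    ∃ c₀ > 0, ∀ h, d / 2 ≤ ‖h - c‖ → ‖h - c‖ ≤ d → 2 * c₀ * (d ^ 2 - ‖h - c‖ ^ 2) ≤ T h := by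
  have ha := S.a_pos
  have hA := S.A_nonneg
  have hL := S.L_nonneg
  obtain ⟨μ, hμ, hTμ⟩ : ∃ μ > 0, ∀ h, ‖h - c‖ ≤ d / 2 → μ ≤ T h := by
    obtain ⟨h, hh, hmin⟩ := (isCompact_closedBall c (d / 2)).exists_isMinOn
      ⟨c, mem_closedBall_self (by positivity)⟩ (hT.continuous S).continuousOn
    rw [mem_closedBall, dist_eq_norm] at hh
    exact ⟨T h, hpos h (by linarith), fun h' hh' => hmin (by
      rwa [mem_closedBall, dist_eq_norm])⟩
  obtain ⟨l, hl, hrate⟩ : ∃ l > 0, L + 1 ≤ 4 * a * (l ^ 2 * d ^ 2 - 2 * l) := by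
    obtain ⟨l, hl⟩ : ∃ l, l = (3 + (L + 1) / (4 * a)) / d ^ 2 + 1 := ⟨_, rfl⟩
    have h1 : 0 ≤ (L + 1) / (4 * a) := by positivity
    have h2 : 1 ≤ l := by
      rw [hl]
      have : 0 ≤ (3 + (L + 1) / (4 * a)) / d ^ 2 := by positivity
      linarith
    have h3 : 3 + (L + 1) / (4 * a) ≤ l * d ^ 2 := by
      have : (3 + (L + 1) / (4 * a)) / d ^ 2 ≤ l := by linarith
      rwa [div_le_iff₀ (by positivity)] at this
    have h4 : (L + 1) / (4 * a) ≤ l * (l * d ^ 2 - 2) := by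
      have h5 : 0 ≤ l * d ^ 2 - 2 := by linarith
      have h6 := mul_le_mul_of_nonneg_right h2 h5
      linarith
    rw [div_le_iff₀ (by positivity)] at h4
    refine ⟨l, by linarith, by linarith⟩
  obtain ⟨ed, hed⟩ : ∃ ed, ed = exp (l * -d ^ 2) := ⟨_, rfl⟩
  have hed0 : 0 < ed := by rw [hed]; exact exp_pos _
  suffices hmain : ∀ h, d / 2 ≤ ‖h - c‖ → ‖h - c‖ ≤ d →
      μ * (exp (l * -‖h - c‖ ^ 2) - ed) ≤ T h by
    refine ⟨μ * l * ed / 2, by positivity, fun h h1 h2 => le_trans ?_ (hmain h h1 h2)⟩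
    have h3 : exp (l * -‖h - c‖ ^ 2) = ed * exp (l * (d ^ 2 - ‖h - c‖ ^ 2)) := by
      rw [hed, ← exp_add]; ring_nf
    have h4 := add_one_le_exp (l * (d ^ 2 - ‖h - c‖ ^ 2))
    have h5 := mul_le_mul_of_nonneg_left h4 (show 0 ≤ μ * ed by positivity)
    rw [h3]
    linarith
  by_contra! hcon
  obtain ⟨h₁, hh1, hh2, hlt⟩ := hcon
  obtain ⟨x₁, hx₁⟩ := hT.exists_lt _ _ hlt
  obtain ⟨m, hm⟩ : ∃ m, m = μ * (l * ed * d) := ⟨_, rfl⟩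
  have hm0 : 0 < m := by rw [hm]; positivity
  obtain ⟨δ, hδ⟩ : ∃ δ, δ = μ * (exp (l * -‖h₁ - c‖ ^ 2) - ed) - (v (x₁ + h₁) - v x₁) := ⟨_, rfl⟩
  have hδ0 : 0 < δ := by rw [hδ]; linarith
  have hsm1 := one_le_smoothNorm x₁
  obtain ⟨ε, hε0, hε1, hε2, hε3⟩ : ∃ ε > 0, ε * smoothNorm x₁ < δ ∧ ε ≤ m / 4 ∧
      (a + A + L) * ε < μ * ed := by
    have h1 : ∀ᶠ ε in 𝓝 (0:ℝ), ε * smoothNorm x₁ < δ ∧ ε < m / 4 ∧ (a + A + L) * ε < μ * ed := by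
      refine Filter.Eventually.and ?_ (Filter.Eventually.and ?_ ?_)
      · refine (continuous_id.mul continuous_const).tendsto' 0 0 (by simp)
          |>.eventually_lt_const hδ0
      · exact (continuous_id).tendsto' 0 0 (by simp) |>.eventually_lt_const (by positivity)
      · refine (continuous_const.mul continuous_id).tendsto' 0 0 (by simp)
          |>.eventually_lt_const (by positivity)
    obtain ⟨ε, ⟨h2, h3, h4⟩, h5⟩ := ((h1.filter_mono nhdsWithin_le_nhds).and
      (self_mem_nhdsWithin : ∀ᶠ ε in 𝓝[>] (0:ℝ), ε ∈ Set.Ioi (0:ℝ))).exists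
    exact ⟨ε, h5, h2, h3.le, h4⟩
  obtain ⟨b, hb⟩ : ∃ b : E → ℝ, b = fun h => -(μ * ed) + μ * exp (l * -‖h - c‖ ^ 2) := ⟨_, rfl⟩
  have hbt : ∀ h, b h = μ * (exp (l * -‖h - c‖ ^ 2) - ed) := fun h => by rw [hb]; ring
  have hbc : Continuous b := by rw [hb]; fun_prop
  have hexp1 : ∀ h : E, exp (l * -‖h - c‖ ^ 2) ≤ 1 := fun h => by
    rw [exp_le_one_iff]
    have : 0 ≤ l * ‖h - c‖ ^ 2 := by positivity
    linarith
  have hbμ : ∀ h, b h ≤ μ := fun h => by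
    rw [hbt]
    have := mul_le_mul_of_nonneg_left (hexp1 h) hμ.le
    have : 0 < μ * ed := by positivity
    linarith
  obtain ⟨Φ, hΦ⟩ : ∃ Φ : E × E → ℝ, Φ = fun z =>
    v (z.1 + z.2) - v z.1 - b z.2 + ε * smoothNorm z.1 := ⟨_, rfl⟩
  have hΦt : ∀ x h, Φ (x, h) = v (x + h) - v x - b h + ε * smoothNorm x := fun x h => by rw [hΦ]
  have hvc := S.continuous
  have hsc : Continuous (smoothNorm (E := E)) := continuous_smoothNorm
  have hΦc : Continuous Φ := by rw [hΦ]; fun_prop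
  have hScl : IsClosed {z : E × E | d / 2 ≤ ‖z.2 - c‖ ∧ ‖z.2 - c‖ ≤ d} :=
    (isClosed_le continuous_const (by fun_prop)).and (isClosed_le (by fun_prop) continuous_const)
  have hneg1 : Φ (x₁, h₁) < 0 := by
    rw [hΦt, hbt]; linarith
  obtain ⟨⟨x₀, h₀⟩, ⟨hz1, hz2⟩, hz0, hzmin⟩ := exists_min_of_bounded_sublevel hΦc hScl
    (z₀ := (x₁, h₁)) ⟨hh1, hh2⟩ (isBounded_pairs (R := μ / ε) (R' := d + ‖c‖) (by
      rintro ⟨x, h⟩ ⟨⟨h1, h2⟩, h3⟩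
      simp only at h1 h2 h3 ⊢
      refine ⟨?_, by linarith [norm_sub_norm_le h c]⟩
      rw [le_div_iff₀ hε0]
      have h4 := hT.le h x
      have h5 := hnn h h2
      have h6 := hbμ h
      have h7 := mul_le_mul_of_nonneg_left (norm_le_smoothNorm x) hε0.le
      rw [hΦt] at h3
      linarith))
  simp only at hz1 hz2
  have hneg : Φ (x₀, h₀) < 0 := hz0.trans_lt hneg1
  rw [hΦt] at hneg
  have hTle := hT.le h₀ x₀
  have hnn0 := hnn h₀ hz2
  have hsm0 := one_le_smoothNorm x₀
  have hεsm : 0 < ε * smoothNorm x₀ := by positivity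
  have hτb : v (x₀ + h₀) - v x₀ < b h₀ := by linarith
  have hz1' : d / 2 < ‖h₀ - c‖ := lt_of_le_of_ne hz1 fun h => by
    have h1 := hTμ h₀ h.symm.le
    have h2 := hbμ h₀
    linarith
  have hz2' : ‖h₀ - c‖ < d := lt_of_le_of_ne hz2 fun h => by
    have h1 : b h₀ = 0 := by rw [hbt, h, hed, sub_self, mul_zero]
    linarith
  obtain ⟨D₁, hD₁, hD₁k⟩ := exists_subJet_gaussian hl.le c h₀
  obtain ⟨b₂, D₂, hD₂, hb₂, hD₂k⟩ := exists_subJet_neg_smoothNorm x₀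
  obtain ⟨s, hs⟩ : ∃ s, s = ‖h₀ - c‖ := ⟨_, rfl⟩
  have hs0 : 0 < s := by rw [hs]; linarith
  obtain ⟨ex, hex⟩ : ∃ ex, ex = exp (l * -‖h₀ - c‖ ^ 2) := ⟨_, rfl⟩
  have hedex : ed ≤ ex := by
    rw [hed, hex]
    apply exp_le_exp.2
    have : ‖h₀ - c‖ ^ 2 ≤ d ^ 2 := by gcongr
    have := mul_le_mul_of_nonneg_left this hl.le
    linarith
  have hex0 : 0 < ex := hed0.trans_le hedex
  have hψ : SubJet b h₀ (μ • ((l * ex) • (-(2:ℝ) • (h₀ - c)))) (μ • D₁) := by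
    rw [hb, hex]
    exact (hD₁.const_mul hμ.le).const_add _
  have hβ := (hD₂.const_mul hε0.le).const_add (Φ (x₀, h₀))
  obtain ⟨P, hP⟩ : ∃ P, P = μ • ((l * ex) • (-(2:ℝ) • (h₀ - c))) := ⟨_, rfl⟩
  rw [← hP] at hψ
  have hPn : m ≤ ‖P‖ := by
    rw [hP, norm_smul, norm_smul, norm_smul, Real.norm_eq_abs, Real.norm_eq_abs, Real.norm_eq_abs,
      abs_of_pos hμ, abs_of_pos (by positivity), abs_neg, abs_of_pos two_pos, hm]
    refine mul_le_mul_of_nonneg_left ?_ hμ.le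
    have h1 : d ≤ 2 * ‖h₀ - c‖ := by linarith
    have h2 : l * ed ≤ l * ex := by gcongr
    exact mul_le_mul h2 h1 hd.le (by positivity)
  have hbn : ‖ε • b₂‖ ≤ ε := by
    rw [norm_smul, Real.norm_eq_abs, abs_of_pos hε0]
    exact mul_le_of_le_one_right hε0.le hb₂
  have hcont := contact_of_lower (v := v) (x₀ := x₀) (y₀ := x₀ + h₀) (ψ := b)
    (by rw [add_sub_cancel_left]; exact hψ) hβ
    (by rw [hΦt, add_sub_cancel_left]; ring)
    (by
      have hmem : {z : E × E | d / 2 < ‖(z.2 - z.1) - c‖ ∧ ‖(z.2 - z.1) - c‖ < d} ∈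
          𝓝 (x₀, x₀ + h₀) := by
        refine IsOpen.mem_nhds (IsOpen.and ?_ ?_) ⟨by simpa using hz1', by simpa using hz2'⟩
        · exact isOpen_lt continuous_const (by fun_prop)
        · exact isOpen_lt (by fun_prop) continuous_const
      filter_upwards [hmem] with z hz
      have h1 := hzmin (z.1, z.2 - z.1) ⟨hz.1.le, hz.2.le⟩
      have h2 := hΦt z.1 (z.2 - z.1)
      rw [add_sub_cancel] at h2
      linarith)
  have hest := contact_estimate S.structCond ha.le hA hL hvc isOpen_univ S.jetSol
    (Set.mem_univ _) (Set.mem_univ _) hcont (r := m / 4) (by positivity)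
    (fun x p X _ h2 h3 => ⟨fun h => by
      rw [h, zero_sub, norm_neg] at h2
      have := norm_sub_norm_le P (ε • b₂)
      linarith, h3.norm_le S.Λ_pos.le S.lip⟩)
    (fun x p X _ h2 h3 => ⟨fun h => by
      rw [h, zero_sub, norm_neg] at h2
      linarith, h3.norm_le S.Λ_pos.le S.lip⟩)
    (c₁ := ε) (c₃ := 4 * (μ * (ex * (4 * l ^ 2 * s ^ 2 - 2 * l))) - ε) hε0.le
    (fun k => by
      rw [inner_smul_clm]
      have := mul_le_mul_of_nonneg_left (hD₂k k) hε0.le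
      linarith) (e := s⁻¹ • (h₀ - c))
    (by rw [norm_smul, norm_inv, hs, norm_norm, inv_mul_cancel₀ (by rw [← hs]; exact hs0.ne')])
    (Or.inr (by
      have hn : ‖s⁻¹ • (h₀ - c)‖ = 1 := by
        rw [norm_smul, norm_inv, hs, norm_norm, inv_mul_cancel₀ (by rw [← hs]; exact hs0.ne')]
      have hi : ⟪h₀ - c, s⁻¹ • (h₀ - c)⟫ = s := by
        rw [real_inner_smul_right, real_inner_self_eq_norm_sq, ← hs]
        field_simp
      have h1 := mul_le_mul_of_nonneg_left (hD₂k (s⁻¹ • (h₀ - c))) hε0.le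
      rw [hn] at h1
      rw [inner_smul_clm, inner_smul_clm, hD₁k, hi, hn, ← hex]
      linarith))
  have hτabs : |v (x₀ + h₀) - v x₀| ≤ μ * ex := by
    rw [abs_of_nonneg (by linarith)]
    have h1 : b h₀ = μ * ex - μ * ed := by rw [hbt, hex]; ring
    have h2 : 0 < μ * ed := by positivity
    linarith
  have h1 : L + 1 ≤ 4 * a * (4 * l ^ 2 * s ^ 2 - 2 * l) := by
    have h2 : (d / 2) ^ 2 ≤ s ^ 2 := by rw [hs]; gcongr
    have h3 : 0 ≤ 16 * a * l ^ 2 := by positivity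
    have h4 := mul_le_mul_of_nonneg_left h2 h3
    linarith
  have h2 := mul_le_mul_of_nonneg_left h1 (show 0 ≤ μ * ex by positivity)
  have h3 := mul_le_mul_of_nonneg_left hτabs hL
  have h4 := mul_le_mul_of_nonneg_left hbn hL
  have h5 : μ * ed ≤ μ * ex := by gcongr
  linarith

end ShiftInfimum

section ShiftStrongMax
variable {E : Type*} [NormedAddCommGroup E] [InnerProductSpace ℝ E]
variable {a A L Λ θ₀ : ℝ} {𝒢 : ℝ → E → (E →L[ℝ] E) → ℝ} {e : E} {v : E → ℝ} {T : E → ℝ}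

theorem lowerPeano_kink (c₀ : ℝ) {j : ℝ} (hj : 0 ≤ j) (s : ℝ) :
    LowerPeano (fun s => c₀ * s - j * (min s 0) ^ 2) s (c₀ - 2 * j * min s 0) (-(2 * j)) := by
  intro η hη
  refine Eventually.of_forall fun τ => ?_
  have h1 : (min (s + τ) 0) ^ 2 ≤ (min s 0) ^ 2 + 2 * min s 0 * τ + τ ^ 2 := by
    rcases le_total s 0 with h | h
    · rw [min_eq_left h]
      rcases le_total (s + τ) 0 with h' | h'
      · rw [min_eq_left h']; linarith
      · rw [min_eq_right h']; linarith [sq_nonneg (s + τ)]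
    · rw [min_eq_right h]
      rcases le_total (s + τ) 0 with h' | h'
      · rw [min_eq_left h']
        have : (s + τ) ^ 2 ≤ τ ^ 2 := by
          rw [← neg_sq (s + τ), ← neg_sq τ]
          exact pow_le_pow_left₀ (by linarith) (by linarith) 2
        linarith
      · rw [min_eq_right h']; linarith [sq_nonneg τ]
  have h2 := mul_le_mul_of_nonneg_left h1 hj
  have h3 : 0 ≤ η * τ ^ 2 := by positivity
  linarith

theorem monotone_kink {c₀ j : ℝ} (hc₀ : 0 ≤ c₀) (hj : 0 ≤ j) :
    Monotone fun s : ℝ => c₀ * s - j * (min s 0) ^ 2 := fun s t hst => by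
  have h1 : min s 0 ≤ min t 0 := min_le_min_right 0 hst
  have h2 : (min t 0) ^ 2 ≤ (min s 0) ^ 2 := by
    rw [← neg_sq (min t 0), ← neg_sq (min s 0)]
    have : min t 0 ≤ 0 := min_le_right _ _
    exact pow_le_pow_left₀ (by linarith) (by linarith) 2
  have h3 := mul_le_mul_of_nonneg_left h2 hj
  have h4 := mul_le_mul_of_nonneg_left hst hc₀
  simp only
  linarith

variable [FiniteDimensional ℝ E]

set_option maxHeartbeats 1000000 in
/-- Strong maximum principle for `v (· + g) - v` at a shift `g` where the infimum `T` vanishes and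
which is reached from the interior of a ball where `T` is positive. -/
theorem ShiftInf.strong_max (hT : ShiftInf v T) (S : NearLinearSol a A L Λ θ₀ 𝒢 e v) {c g : E}
    {d : ℝ} (hd : 0 < d) (hg : ‖g - c‖ = d) (hTg : T g = 0) (hnn : ∀ h, ‖h - c‖ ≤ d → 0 ≤ T h)
    {c₀ : ℝ} (hc₀ : 0 < c₀)
    (hopf : ∀ h, d / 2 ≤ ‖h - c‖ → ‖h - c‖ ≤ d → 2 * c₀ * (d ^ 2 - ‖h - c‖ ^ 2) ≤ T h)
    {D η : ℝ} (hD : 0 < D) (hη : 0 < η) : ∃ ε > 0, ∀ x y, ‖x - y‖ ≤ D → v (x + g) - v x < ε →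
      v (y + g) - v y < η := by
  have hΛ := S.Λ_pos
  obtain ⟨r, hr⟩ : ∃ r, r = min (η / (8 * Λ)) D := ⟨_, rfl⟩
  have hr0 : 0 < r := by rw [hr]; exact lt_min (by positivity) hD
  have hrD : r ≤ D := by rw [hr]; exact min_le_right _ _
  have hrη : Λ * r ≤ η / 8 := by
    have h1 : r ≤ η / (8 * Λ) := by rw [hr]; exact min_le_left _ _
    rw [le_div_iff₀ (by positivity)] at h1
    linarith
  obtain ⟨κ, hκ, β, hβ, hbar⟩ := exists_barrier_bound (E := E) S.a_pos S.A_nonneg S.L_nonneg hr0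
    hrD (lt_add_one D)
  obtain ⟨ρ, hρ⟩ : ∃ ρ, ρ = min (d / 2) (η / (8 * Λ)) := ⟨_, rfl⟩
  have hρ0 : 0 < ρ := by rw [hρ]; positivity
  have hρd : ρ ≤ d / 2 := by rw [hρ]; exact min_le_left _ _
  have hρη : Λ * ρ ≤ η / 8 := by
    have h1 : ρ ≤ η / (8 * Λ) := by rw [hρ]; exact min_le_right _ _
    rw [le_div_iff₀ (by positivity)] at h1
    linarith
  obtain ⟨θ, hθ⟩ : ∃ θ, θ = min (η / 8) (min (c₀ * d * ρ / 8) (c₀ * d / (4 * β))) := ⟨_, rfl⟩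
  have hθ0 : 0 < θ := by rw [hθ]; positivity
  have hθ1 : θ ≤ η / 8 := by rw [hθ]; exact min_le_left _ _
  have hθ2 : θ ≤ c₀ * d * ρ / 8 := by
    rw [hθ]; exact (min_le_right _ _).trans (min_le_left _ _)
  have hθ3 : β * θ ≤ c₀ * d / 4 := by
    have h1 : θ ≤ c₀ * d / (4 * β) := by
      rw [hθ]; exact (min_le_right _ _).trans (min_le_right _ _)
    rw [le_div_iff₀ (by positivity)] at h1
    linarith
  refine ⟨min (κ * θ) (η / 2), by positivity, ?_⟩
  intro x y hxy hwx
  by_contra! hwy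
  have hlipw : ∀ x y, v (y + g) - v y - 2 * (Λ * ‖x - y‖) ≤ v (x + g) - v x := fun x y => by
    have h1 := neg_le_of_abs_le (S.lip (x + g) (y + g))
    have h2 := le_of_abs_le (S.lip x y)
    rw [add_sub_add_right_eq_sub] at h1
    linarith
  have hlt1 := hwx.trans_le (min_le_left _ _)
  have hlt2 := hwx.trans_le (min_le_right _ _)
  rcases le_or_gt r ‖x - y‖ with hrx | hrx
  swap
  · have h1 := hlipw x y
    have h2 : Λ * ‖x - y‖ ≤ Λ * r := by gcongr
    linarith
  obtain ⟨Λ₁, hΛ₁⟩ : ∃ Λ₁, Λ₁ = Λ / d := ⟨_, rfl⟩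
  have hΛ₁0 : 0 < Λ₁ := by rw [hΛ₁]; positivity
  obtain ⟨σ, hσ⟩ : ∃ σ, σ = κ * θ / Λ₁ := ⟨_, rfl⟩
  have hσ0 : 0 < σ := by rw [hσ]; positivity
  have hσΛ : Λ₁ * σ = κ * θ := by rw [hσ]; field_simp
  obtain ⟨j, hj⟩ : ∃ j, j = 2 * Λ₁ / σ + 2 * θ / σ ^ 2 := ⟨_, rfl⟩
  have hj0 : 0 < j := by rw [hj]; positivity
  have hjΛ : Λ₁ ^ 2 / (4 * j) ≤ κ * θ := by
    rw [← hσΛ, div_le_iff₀ (by positivity)]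
    have h1 := lt_quadratic_of_lt hΛ₁0.le hθ0 hσ0 hj.symm.le le_rfl
    have h3 : Λ₁ ≤ j * σ := by
      have : Λ₁ * σ ≤ (j * σ) * σ := by linarith
      exact le_of_mul_le_mul_right this hσ0
    have h4 := mul_le_mul_of_nonneg_left h3 hΛ₁0.le
    have h5 : 0 ≤ Λ₁ * (j * σ) := by positivity
    linarith
  obtain ⟨C, hC⟩ : ∃ C, C = Λ₁ ^ 2 / (4 * j) := ⟨_, rfl⟩
  have hC0 : 0 < C := by rw [hC]; positivity
  rw [← hC] at hjΛ
  obtain ⟨B, hB⟩ : ∃ B, B = θ / ρ ^ 2 := ⟨_, rfl⟩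
  have hB0 : 0 < B := by rw [hB]; positivity
  have hBρ : B * ρ ^ 2 = θ := by rw [hB]; field_simp
  have hBρ' : 2 * B * ρ ≤ c₀ * d / 4 := by
    have : (2 * B * ρ) * ρ ≤ (c₀ * d / 4) * ρ := by linarith
    exact le_of_mul_le_mul_right this hρ0
  obtain ⟨χ, hχ⟩ : ∃ χ : ℝ → ℝ, χ = fun s => c₀ * s - j * (min s 0) ^ 2 := ⟨_, rfl⟩
  obtain ⟨q, hq⟩ : ∃ q : E → ℝ, q = fun h => d ^ 2 + -‖h - c‖ ^ 2 := ⟨_, rfl⟩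
  have hqt : ∀ h, q h = d ^ 2 - ‖h - c‖ ^ 2 := fun h => by rw [hq]; ring
  have hqc : Continuous q := by rw [hq]; fun_prop
  obtain ⟨ψ, hψ⟩ : ∃ ψ : E → ℝ, ψ = fun h => -C + (χ (q h) + B * -‖h - g‖ ^ 2) := ⟨_, rfl⟩
  have hψt : ∀ h, ψ h = χ (q h) - B * ‖h - g‖ ^ 2 - C := fun h => by rw [hψ]; ring
  have hχc : Continuous χ := by rw [hχ]; fun_prop
  have hψc : Continuous ψ := by rw [hψ]; fun_prop
  have hχpos : ∀ s, 0 ≤ s → χ s = c₀ * s := fun s hs => by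
    rw [hχ]; simp only [min_eq_right hs]; ring
  have hχneg : ∀ s, s ≤ 0 → χ s ≤ -(j * (-s) ^ 2) := fun s hs => by
    rw [hχ]
    simp only [min_eq_left hs]
    have := mul_nonneg hc₀.le (neg_nonneg.2 hs)
    linarith
  have hdist : ∀ h, ‖h - g‖ ≤ ρ → d / 2 ≤ ‖h - c‖ := fun h hh => by
    have h1 := norm_sub_norm_le (g - c) (g - h)
    rw [show g - c - (g - h) = h - c by abel, hg, norm_sub_rev g h] at h1
    linarith
  have hTpos : ∀ h, ‖h - g‖ ≤ ρ → 0 ≤ q h → 2 * c₀ * q h ≤ T h := fun h hh hq0 => by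
    rw [hqt] at hq0 ⊢
    refine hopf h (hdist h hh) ?_
    exact le_of_sq_le_sq (by linarith) hd.le
  have hTneg : ∀ h, q h ≤ 0 → -(Λ₁ * -q h) ≤ T h := fun h hq0 => by
    rw [hqt] at hq0 ⊢
    have h1 : d ≤ ‖h - c‖ := le_of_sq_le_sq (by linarith) (norm_nonneg _)
    have hs0 : 0 < ‖h - c‖ := hd.trans_le h1
    obtain ⟨h', hh'⟩ : ∃ h', h' = c + (d / ‖h - c‖) • (h - c) := ⟨_, rfl⟩
    have h2 : ‖h' - c‖ = d := by
      rw [hh', add_sub_cancel_left, norm_smul, Real.norm_eq_abs, abs_of_pos (by positivity),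
        div_mul_cancel₀ _ hs0.ne']
    have h3 : ‖h - h'‖ = ‖h - c‖ - d := by
      have : h - h' = (1 - d / ‖h - c‖) • (h - c) := by
        rw [hh', sub_smul, one_smul]; abel
      have h4 : d / ‖h - c‖ ≤ 1 := by rwa [div_le_one hs0]
      rw [this, norm_smul, Real.norm_eq_abs, abs_of_nonneg (by linarith), sub_mul, one_mul,
        div_mul_cancel₀ _ hs0.ne']
    have h4 := hT.lip S h' h
    have h5 := hnn h' h2.le
    have h6 : Λ * (‖h - c‖ - d) ≤ Λ₁ * (‖h - c‖ ^ 2 - d ^ 2) := by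
      have h7 : Λ = Λ₁ * d := by rw [hΛ₁]; field_simp
      have h8 : Λ₁ * (‖h - c‖ ^ 2 - d ^ 2) - Λ * (‖h - c‖ - d) =
          Λ₁ * ((‖h - c‖ - d) * ‖h - c‖) := by rw [h7]; ring
      have h9 : 0 ≤ Λ₁ * ((‖h - c‖ - d) * ‖h - c‖) :=
        mul_nonneg hΛ₁0.le (mul_nonneg (by linarith) hs0.le)
      linarith
    rw [h3] at h4
    linarith
  have hχT : ∀ h, ‖h - g‖ ≤ ρ → χ (q h) - C ≤ T h := fun h hh => by
    rcases le_total 0 (q h) with hq0 | hq0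
    · have h1 := hTpos h hh hq0
      have h2 := mul_nonneg hc₀.le hq0
      rw [hχpos _ hq0]
      linarith
    · have h1 := hTneg h hq0
      have h2 := hχneg _ hq0
      have h3 := neg_sq_div_le (Λ := Λ₁) (t := -q h) hj0
      rw [← hC] at h3
      linarith
  have hψχ : ∀ h, ψ h ≤ χ (q h) - C := fun h => by
    have : 0 ≤ B * ‖h - g‖ ^ 2 := by positivity
    rw [hψt]
    linarith
  have hqg : q g = 0 := by rw [hqt, hg, sub_self]
  have := hbar S.structCond S.continuous isOpen_univ S.jetSol hψc hθ0 hρ0 (y := y) (g := g)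
    (fun x _ => Set.mem_univ _) (fun x h _ _ => Set.mem_univ _)
    (fun x h _ hh => ((hψχ h).trans (hχT h hh)).trans (hT.le h x))
    (fun x h _ hh => by
      have e1 := hχT h hh.le
      have e2 := hT.le h x
      rw [hψt, hh, hBρ]
      linarith)
    (fun x h t _ hh ht0 ht1 hv => by
      have e1 := hψχ h
      have e2 := hT.le h x
      have e3 : θ * t ≤ θ := mul_le_of_le_one_right hθ0.le ht1
      have e4 : 0 ≤ θ * t := by positivity
      have e5 : 0 < κ * θ := by positivity
      rcases le_total 0 (q h) with hq0 | hq0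
      · have e6 := hTpos h hh hq0
        have e7 := mul_nonneg hc₀.le hq0
        rw [hχpos _ hq0] at e1
        constructor <;> linarith
      · have e6 := hTneg h hq0
        have e7 := hχneg _ hq0
        have e8 : 0 ≤ j * (-q h) ^ 2 := by positivity
        refine ⟨?_, by linarith⟩
        have e9 : -q h ≤ σ := by
          by_contra! hcon
          have := lt_quadratic_of_lt hΛ₁0.le hθ0 hσ0 hj.symm.le hcon.le
          linarith
        have e10 : Λ₁ * -q h ≤ Λ₁ * σ := by gcongr
        linarith)
    (by
      rw [hψt, hqg, hχpos _ le_rfl, sub_self, norm_zero]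
      linarith)
    (fun x h hx hh => by
      have e1 := S.sub_le_shift x g h
      have e2 := hlipw x y
      rw [hx] at e2
      have e3 : Λ * ‖h - g‖ ≤ Λ * ρ := by gcongr
      have e4 : χ (q h) ≤ Λ * ρ := by
        rcases le_total 0 (q h) with hq0 | hq0
        · have e6 := hTpos h hh hq0
          have e7 := mul_nonneg hc₀.le hq0
          have e8 := hT.lip S h g
          rw [norm_sub_rev] at e8
          rw [hχpos _ hq0]
          linarith
        · have e7 := hχneg _ hq0
          have e8 : 0 ≤ j * (-q h) ^ 2 := by positivity
          have e9 : 0 < Λ * ρ := by positivity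
          linarith
      have e5 := hψχ h
      linarith)
    (fun x h _ hh _ => by
      have hm : 0 ≤ -min (q h) 0 := neg_nonneg.2 (min_le_right _ _)
      have hc₁ : c₀ ≤ c₀ - 2 * j * min (q h) 0 := by
        have := mul_nonneg (mul_nonneg zero_le_two hj0.le) hm
        linarith
      have hsq : SubJet q h (-(2:ℝ) • (h - c)) (-(2:ℝ) • ContinuousLinearMap.id ℝ E) := by
        rw [hq]
        exact (subJet_neg_normSq c h).const_add (d ^ 2)
      have hsub := ((hsq.comp (χ := χ) (U := Set.univ)
        hqc.continuousAt univ_mem (by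
          rw [hχ]; exact (monotone_kink hc₀.le hj0.le).monotoneOn _) (hc₀.le.trans hc₁) (by
          rw [hχ]; exact lowerPeano_kink c₀ hj0.le (q h))).add
        ((subJet_neg_normSq g h).const_mul hB0.le)).const_add (-C)
      refine ⟨_, _, by rw [hψ]; exact hsub, c₀ * d / 4, by positivity,
        fun z _ p X hp hpX => ⟨fun h0 => ?_, ?_⟩⟩
      · rw [h0, zero_sub, norm_neg] at hp
        have e1 := norm_sub_norm_le ((c₀ - 2 * j * min (q h) 0) • (-(2:ℝ) • (h - c)))
          (-(B • (-(2:ℝ) • (h - g))))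
        rw [sub_neg_eq_add, norm_neg, norm_smul, norm_smul, norm_smul, norm_smul,
          Real.norm_eq_abs, Real.norm_eq_abs, Real.norm_eq_abs,
          abs_of_pos (hc₀.trans_le hc₁), abs_neg, abs_of_pos two_pos, abs_of_pos hB0] at e1
        have e2 := hdist h hh.le
        have e3 := mul_le_mul hc₁ e2 (by positivity) (hc₀.le.trans hc₁)
        have e4 : B * ‖h - g‖ ≤ B * ρ := by gcongr
        have e5 : 0 < c₀ * d := by positivity
        linarith
      · rcases hpX with hpX | hpX
        · exact hpX.norm_le hΛ.le S.lip
        · exact hpX.norm_le hΛ.le S.lip) x hrx hxy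
  linarith

theorem NearLinearSol.le_translate (S : NearLinearSol a A L Λ θ₀ 𝒢 e v) {h : E}
    (hh : 0 < ⟪e, h⟫) (x : E) : v x ≤ v (x + h) := by
  by_contra! hcon
  obtain ⟨T, hT⟩ := S.exists_shiftInf
  have hTc := hT.continuous S
  have hee : ⟪e, e⟫ = (1:ℝ) := by rw [real_inner_self_eq_norm_sq, S.norm_e, one_pow]
  have hθ₀ : 0 ≤ θ₀ := (abs_nonneg _).trans (S.near 0)
  have hTlow : ∀ h, ⟪e, h⟫ - 2 * θ₀ ≤ T h := fun h => by
    by_contra! hc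
    obtain ⟨x, hx⟩ := hT.exists_lt _ _ hc
    linarith [S.le_shift h x]
  obtain ⟨M, hM⟩ : ∃ M, M = 2 * θ₀ + 1 := ⟨_, rfl⟩
  obtain ⟨c, hc⟩ : ∃ c, c = h + M • e := ⟨_, rfl⟩
  have hec : ⟪e, c⟫ = ⟪e, h⟫ + M := by
    rw [hc, inner_add_right, real_inner_smul_right, hee, mul_one]
  have hTcpos : 0 < T c := by
    have := hTlow c
    linarith
  have hcl : IsClosed {h | T h ≤ 0} := isClosed_le hTc continuous_const
  have hTh : T h < 0 := by linarith [hT.le h x]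
  obtain ⟨g, hgT, hgd⟩ := hcl.exists_infDist_eq_dist ⟨h, hTh.le⟩ c
  have hgT' : T g ≤ 0 := hgT
  obtain ⟨d, hd⟩ : ∃ d, d = ‖g - c‖ := ⟨_, rfl⟩
  have hmin : ∀ h', T h' ≤ 0 → d ≤ ‖h' - c‖ := fun h' hh' => by
    have := infDist_le_dist_of_mem (x := c) (show h' ∈ {h | T h ≤ 0} from hh')
    rw [hgd, dist_comm, dist_comm c, dist_eq_norm, dist_eq_norm] at this
    rwa [hd]
  have hd0 : 0 < d := by
    rw [hd, norm_pos_iff, sub_ne_zero]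
    rintro rfl
    linarith
  have hpos : ∀ h', ‖h' - c‖ < d → 0 < T h' := fun h' hh' => by
    by_contra! hneg
    linarith [hmin h' hneg]
  have hnn : ∀ h', ‖h' - c‖ ≤ d → 0 ≤ T h' := by
    have h1 : closedBall c d ⊆ {h | 0 ≤ T h} := by
      rw [← closure_ball c hd0.ne']
      refine closure_minimal (fun h' hh' => ?_) (isClosed_le continuous_const hTc)
      rw [mem_ball, dist_eq_norm] at hh'
      exact (hpos h' hh').le
    exact fun h' hh' => h1 (by rwa [mem_closedBall, dist_eq_norm])
  have hTg : T g = 0 := le_antisymm hgT' (hnn g hd.symm.le)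
  have heg : 0 < ⟪e, g⟫ := by
    have h1 := hmin h hTh.le
    have h2 : ‖h - c‖ = M := by
      rw [hc, sub_add_cancel_left, norm_neg, norm_smul, S.norm_e, mul_one, Real.norm_eq_abs,
        abs_of_pos (by linarith)]
    have h3 := neg_le_of_abs_le (abs_inner_le_norm_of_unit (x := g - c) S.norm_e)
    rw [inner_sub_right, ← hd] at h3
    linarith
  obtain ⟨c₀, hc₀, hopf⟩ := hT.hopf S hd0 hpos hnn
  obtain ⟨n, hn⟩ := exists_nat_ge ((2 * θ₀ + 1) / ⟪e, g⟫)
  rw [div_le_iff₀ heg] at hn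
  have hn0 : n ≠ 0 := by
    rintro rfl
    rw [Nat.cast_zero, zero_mul] at hn
    linarith
  have hn0' : (0:ℝ) < n := by exact_mod_cast Nat.pos_of_ne_zero hn0
  obtain ⟨ε, hε, hsmp⟩ := hT.strong_max S hd0 hd.symm hTg hnn hc₀ hopf (D := n * ‖g‖ + 1)
    (η := 1 / n) (by positivity) (by positivity)
  obtain ⟨x₀, hx₀⟩ := hT.exists_lt g ε (by rwa [hTg])
  have hsum : ∑ i ∈ Finset.range n, (v (x₀ + ((i + 1 : ℕ) : ℝ) • g) - v (x₀ + (i : ℝ) • g)) =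
      v (x₀ + (n : ℝ) • g) - v (x₀ + ((0 : ℕ) : ℝ) • g) :=
    Finset.sum_range_sub (fun i : ℕ => v (x₀ + (i : ℝ) • g)) n
  have hlt : ∑ i ∈ Finset.range n, (v (x₀ + ((i + 1 : ℕ) : ℝ) • g) - v (x₀ + (i : ℝ) • g)) <
      ∑ _i ∈ Finset.range n, 1 / (n : ℝ) := by
    refine Finset.sum_lt_sum_of_nonempty (Finset.nonempty_range_iff.2 hn0) fun i hi => ?_
    rw [Finset.mem_range] at hi
    have hi' : (i:ℝ) ≤ n := by exact_mod_cast hi.le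
    have h1 : x₀ + ((i + 1 : ℕ) : ℝ) • g = (x₀ + (i : ℝ) • g) + g := by
      push_cast; module
    rw [h1]
    refine hsmp x₀ _ ?_ hx₀
    rw [sub_add_cancel_left, norm_neg, norm_smul, Real.norm_eq_abs, Nat.abs_cast]
    have : (i:ℝ) * ‖g‖ ≤ n * ‖g‖ := by gcongr
    linarith
  rw [hsum, Finset.sum_const, Finset.card_range, nsmul_eq_mul, mul_one_div_cancel hn0'.ne',
    Nat.cast_zero, zero_smul, add_zero] at hlt
  have h2 := S.le_shift ((n : ℝ) • g) x₀
  rw [real_inner_smul_right] at h2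
  linarith

theorem FlatSol.le_translate {δ₀ : ℝ} {G : (E →L[ℝ] E) → ℝ} {k : ℝ → ℝ} {u : E → ℝ}
    (S : FlatSol a A L δ₀ G k e u) {h : E} (hh : 0 < ⟪e, h⟫) (x : E) : u x ≤ u (x + h) := by
  obtain ⟨K, Z, φ, hφ, hkK⟩ := S.exists_profile
  obtain ⟨θ, Λ, L', 𝒢, hΛ, hL', hθ, hlip, hstr, hjet⟩ := S.exists_flat_equation hφ hkK
  have hmem := (S.exists_abs_sub_le hφ).1
  have hS : NearLinearSol a A L' Λ θ 𝒢 e fun x => Z (u x) :=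
    ⟨S.a_pos, S.A_nonneg, hL', hΛ, S.norm_e, hθ, hlip, hstr, hjet⟩
  exact (hφ.arc.strictMonoOn.le_iff_le (hmem x) (hmem (x + h))).1 (hS.le_translate hh x)

end ShiftStrongMax

section FlatEquation

theorem abs_posPart_div_sub_le {c : ℝ} (hc : 0 < c) {s t b : ℝ} (h : |s - t| ≤ b) :
    |max s 0 / c - max t 0 / c| ≤ b / c := by
  rw [← sub_div, abs_div, abs_of_pos hc]
  gcongr
  exact (abs_max_sub_max_le_abs s t 0).trans h

variable {E : Type*} [NormedAddCommGroup E] [InnerProductSpace ℝ E]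
variable {a A : ℝ} {G : (E →L[ℝ] E) → ℝ}

theorem EllipticOp.map_zero (hG : EllipticOp a A G) : G 0 = 0 := by
  have := hG.homog 0 le_rfl 0
  rwa [smul_zero, zero_mul] at this

theorem EllipticOp.le_rankOneSelf (hG : EllipticOp a A G) {e : E} (he : ‖e‖ = 1) :
    a ≤ G (rankOneSelf e) ∧ a ≤ -G (-rankOneSelf e) := by
  have hee : ⟪e, e⟫ = (1 : ℝ) := by rw [real_inner_self_eq_norm_sq, he, one_pow]
  have h0 := hG.map_zero
  have h1 : ∀ k, ⟪rankOneSelf e k, k⟫ = ⟪e, k⟫ ^ 2 := fun k => inner_rankOneSelf ..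
  constructor
  · have := hG.gain 0 (rankOneSelf e) 0 1 e le_rfl he (fun k => by
      rw [h1]
      simpa using sq_nonneg ⟪e, k⟫) (by
      rw [h1, hee]
      simp)
    linarith
  · have := hG.gain (-rankOneSelf e) 0 0 1 e le_rfl he (fun k => by
      rw [neg_apply, inner_neg_left, h1]
      simpa using sq_nonneg ⟪e, k⟫) (by
      rw [neg_apply, inner_neg_left, h1, hee]
      simp)
    linarith

/-- The factor `k` with `G (-k e ⊗ e) = -s`. -/
def rankOneCoeff (G : (E →L[ℝ] E) → ℝ) (e : E) (s : ℝ) : ℝ :=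
  max s 0 / -G (-rankOneSelf e) - max (-s) 0 / G (rankOneSelf e)

theorem EllipticOp.apply_rankOneCoeff (hG : EllipticOp a A G) (ha : 0 < a) {e : E}
    (he : ‖e‖ = 1) (s : ℝ) : G (-rankOneCoeff G e s • rankOneSelf e) = -s := by
  obtain ⟨h1, h2⟩ := hG.le_rankOneSelf he
  unfold rankOneCoeff
  rcases le_total 0 s with hs | hs
  · have hc : 0 < -G (-rankOneSelf e) := ha.trans_le h2
    rw [max_eq_left hs, max_eq_right (by linarith), zero_div, sub_zero, neg_smul, ← smul_neg,
      hG.homog _ (by positivity)]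
    have hc' : G (-rankOneSelf e) ≠ 0 := by linarith
    field_simp
  · have hc : 0 < G (rankOneSelf e) := ha.trans_le h1
    have hs' : 0 ≤ -s := by linarith
    rw [max_eq_right hs, max_eq_left hs', zero_div, zero_sub, neg_neg,
      hG.homog _ (by positivity), div_mul_cancel₀ _ hc.ne']

theorem EllipticOp.monotone_rankOneCoeff (hG : EllipticOp a A G) (ha : 0 < a) {e : E}
    (he : ‖e‖ = 1) : Monotone (rankOneCoeff G e) := fun s t hst => by
  obtain ⟨h1, h2⟩ := hG.le_rankOneSelf he
  have hc : 0 < -G (-rankOneSelf e) := ha.trans_le h2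
  have hc' : 0 < G (rankOneSelf e) := ha.trans_le h1
  exact sub_le_sub (div_le_div_of_nonneg_right (max_le_max_right 0 hst) hc.le)
    (div_le_div_of_nonneg_right (max_le_max_right 0 (neg_le_neg hst)) hc'.le)

theorem EllipticOp.abs_rankOneCoeff_sub_le (hG : EllipticOp a A G) (ha : 0 < a) {e : E}
    (he : ‖e‖ = 1) (s t : ℝ) :
    |rankOneCoeff G e s - rankOneCoeff G e t| ≤ 2 / a * |s - t| := by
  obtain ⟨h1, h2⟩ := hG.le_rankOneSelf he
  have h3 := abs_posPart_div_sub_le (ha.trans_le h2) (le_refl |s - t|)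
  have h4 := abs_posPart_div_sub_le (s := -s) (t := -t) (b := |s - t|) (ha.trans_le h1)
    (by rw [neg_sub_neg, abs_sub_comm])
  have h5 : |s - t| / -G (-rankOneSelf e) ≤ |s - t| / a := by gcongr
  have h6 : |s - t| / G (rankOneSelf e) ≤ |s - t| / a := by gcongr
  have h7 := abs_sub_le_iff.1 (h3.trans h5)
  have h8 := abs_sub_le_iff.1 (h4.trans h6)
  have h9 : 2 / a * |s - t| = |s - t| / a + |s - t| / a := by ring
  unfold rankOneCoeff
  rw [h9, abs_sub_le_iff]
  constructor <;> linarith [h7.1, h7.2, h8.1, h8.2]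

variable {N : ℕ} {Ftil : Matrix (Fin N) (Fin N) ℝ → ℝ} {f : ℝ → ℝ} {u : ESp N → ℝ}

theorem le_translate_of_exponent_eq_zero [NeZero N] (ha : 0 < a) (haA : a ≤ A)
    (hF : UniformlyElliptic N a A Ftil) (hf : ContDiffOn ℝ 1 f (Set.Icc (-1) 1))
    (hfm1 : f (-1) = 0) (hf1 : f 1 = 0)
    {δ₀ : ℝ} (hδ₀ : δ₀ ∈ Set.Ioo (0:ℝ) 1)
    (hmonoNeg : AntitoneOn f (Set.Icc (-1) (-1 + δ₀)))
    (hmonoPos : AntitoneOn f (Set.Icc (1 - δ₀) 1)) (hu : Continuous u)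
    (hrange : ∀ x, u x ∈ Set.Icc (-1 : ℝ) 1)
    (hsol : ViscSol 0 Ftil (fun _ s => -f s) Set.univ u)
    (hlimPos : ∀ ε > (0:ℝ), ∃ R : ℝ, ∀ x : ESp N, R ≤ x 0 → |u x - 1| < ε)
    (hlimNeg : ∀ ε > (0:ℝ), ∃ R : ℝ, ∀ x : ESp N, x 0 ≤ R → |u x + 1| < ε)
    {h : ESp N} (hh : 0 < h 0) (x : ESp N) : u x ≤ u (x + h) := by
  have hG := hF.ellipticOp ha
  have hA : 0 ≤ A * N := mul_nonneg (ha.le.trans haA) (Nat.cast_nonneg N)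
  obtain ⟨Lg, hLg, hg1, -⟩ := exists_clipExt_bounds hf
  have hδ := hδ₀.1
  have hδ' := hδ₀.2
  obtain ⟨G, hGdef⟩ : ∃ G, G = fun X : ESp N →L[ℝ] ESp N => Ftil (opMat X) := ⟨_, rfl⟩
  obtain ⟨e, hedef⟩ : ∃ e : ESp N, e = EuclideanSpace.single (0 : Fin N) (1 : ℝ) := ⟨_, rfl⟩
  have hjets : ∀ x p X, p ≠ 0 → (SuperJet u x p X → 0 ≤ G X + clipExt f (u x)) ∧
      (SubJet u x p X → G X + clipExt f (u x) ≤ 0) := fun x p X hp => by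
    have := jets_of_viscSol hG hrange hsol (x := x) (X := X) hp
    rw [neg_zero, Real.rpow_zero, mul_one] at this
    rw [hGdef]
    exact this
  rw [← hGdef] at hG
  have he : ‖e‖ = 1 := by simp [hedef]
  have hex : ∀ x, ⟪e, x⟫ = x 0 := fun x => by rw [hedef, inner_single_zero]
  have hmono := hG.monotone_rankOneCoeff ha he
  have happly := hG.apply_rankOneCoeff ha he
  have hS : FlatSol a (A * N) (2 / a * Lg) δ₀ G (fun s => rankOneCoeff G e (clipExt f s)) e u :=
    { a_pos := ha
      A_nonneg := hA
      elliptic := hG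
      L_nonneg := by positivity
      lip := fun s t => by
        refine (hG.abs_rankOneCoeff_sub_le ha he _ _).trans ?_
        rw [mul_assoc]
        exact mul_le_mul_of_nonneg_left (hg1 s t) (by positivity)
      zero := fun s hs => by
        have h0 : clipExt f s = 0 := by
          unfold clipExt
          rcases le_abs.1 hs with h | h
          · rw [min_eq_left h, max_eq_right (by norm_num), hf1]
          · rw [min_eq_right (by linarith), max_eq_left (by linarith), hfm1]
        simp [h0, rankOneCoeff]
      δ₀_mem := hδ₀
      antitone_neg := fun s hs t ht hst => by
        refine hmono ?_
        rw [clipExt_eq ⟨hs.1, by linarith [hs.2]⟩, clipExt_eq ⟨ht.1, by linarith [ht.2]⟩]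
        exact hmonoNeg hs ht hst
      antitone_pos := fun s hs t ht hst => by
        refine hmono ?_
        rw [clipExt_eq ⟨by linarith [hs.1], hs.2⟩, clipExt_eq ⟨by linarith [ht.1], ht.2⟩]
        exact hmonoPos hs ht hst
      norm_e := he
      continuous := hu
      range := hrange
      superJet := fun x p X hp h => by
        rw [happly]
        linarith [(hjets x p X hp).1 h]
      subJet := fun x p X hp h => by
        rw [happly]
        linarith [(hjets x p X hp).2 h]
      lim_pos := fun ε hε => by
        obtain ⟨R, hR⟩ := hlimPos ε hε
        refine ⟨R, fun x hx => ?_⟩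
        rw [hex] at hx
        linarith [(abs_lt.1 (hR x hx)).1]
      lim_neg := fun ε hε => by
        obtain ⟨R, hR⟩ := hlimNeg ε hε
        refine ⟨R, fun x hx => ?_⟩
        rw [hex] at hx
        linarith [(abs_lt.1 (hR x hx)).2] }
  exact hS.le_translate (by rwa [hex]) x

end FlatEquation

/-- **Monotonicity by sliding** (first part of the proof of Theorem 4.1).
For any direction `ν` with `ν₁ > 0` and any `t ≥ 0`, `u(x + tν) ≥ u(x)`;
in particular `u` is nondecreasing in the `x₁` variable. -/
theorem sliding_monotonicity
    (N : ℕ) [NeZero N] (a A α : ℝ) (ha : 0 < a) (haA : a ≤ A) (hα : -1 < α)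
    (Ftil : Matrix (Fin N) (Fin N) ℝ → ℝ) (hF : UniformlyElliptic N a A Ftil)
    (f : ℝ → ℝ) (hf : ContDiffOn ℝ 1 f (Set.Icc (-1) 1))
    (hfm1 : f (-1) = 0) (hf1 : f 1 = 0)
    (δ₀ : ℝ) (hδ₀ : δ₀ ∈ Set.Ioo (0:ℝ) 1)
    (hmonoNeg : AntitoneOn f (Set.Icc (-1) (-1 + δ₀)))
    (hmonoPos : AntitoneOn f (Set.Icc (1 - δ₀) 1))
    (u : ESp N → ℝ) (hu : Continuous u)
    (hrange : ∀ x, u x ∈ Set.Icc (-1 : ℝ) 1)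
    (hsol : ViscSol α Ftil (fun _ s => -f s) Set.univ u)
    (hlimPos : ∀ ε > (0:ℝ), ∃ R : ℝ, ∀ x : ESp N, R ≤ x 0 → |u x - 1| < ε)
    (hlimNeg : ∀ ε > (0:ℝ), ∃ R : ℝ, ∀ x : ESp N, x 0 ≤ R → |u x + 1| < ε)
    (hgrad : α ≠ 0 → ∀ b c : ℝ, b < c →
      ∃ m > (0:ℝ), GradGE m {x : ESp N | x 0 ∈ Set.Icc b c} u) :
    (∀ ν : ESp N, 0 < ν 0 → ∀ t : ℝ, 0 ≤ t → ∀ x : ESp N, u x ≤ u (x + t • ν)) ∧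
    (∀ x : ESp N, ∀ t : ℝ, 0 ≤ t →
      u x ≤ u (x + t • EuclideanSpace.single (0 : Fin N) (1 : ℝ))) := by
  have key : ∀ h : ESp N, 0 < h 0 → ∀ x, u x ≤ u (x + h) := fun h hh x => by
    rcases eq_or_ne α 0 with rfl | hα0
    · exact le_translate_of_exponent_eq_zero ha haA hF hf hfm1 hf1 hδ₀ hmonoNeg hmonoPos hu hrange
        hsol hlimPos hlimNeg hh x
    · exact le_translate_of_gradGE ha haA hα hF hf hδ₀ hmonoNeg hmonoPos hu hrange hsol hlimPos
        hlimNeg (hgrad hα0) hh x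
  have key' : ∀ ν : ESp N, 0 < ν 0 → ∀ t : ℝ, 0 ≤ t → ∀ x, u x ≤ u (x + t • ν) :=
    fun ν hν t ht x => by
      rcases ht.eq_or_lt with rfl | ht
      · rw [zero_smul, add_zero]
      · exact key (t • ν) (by simpa using mul_pos ht hν) x
  exact ⟨key', fun x t ht => key' _ (by simp) t ht x⟩
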